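/- arXiv:1206.5728 — 3 statements merged into one kernel-verified Lean document; each statement's English description precedes it below -/
import Mathlib

section
/- Each of the automorphisms P_{i,j}, I_i, (c_i^{±1}; z), γ_z, (a⁻¹; z) and θ commutes with the Nielsen automorphism ρ, and the centralizer C(ρ) of ρ in Aut(F_n) is generated by the set consisting of all of these automorphisms together with ρ itself. -/
/-! The free group `F m` of rank `m + 2` has basis `{a, b, c₁, …, c_m}` where
`a = of 0`, `b = of 1` and `cᵢ = of (i + 1)` (i.e. the basis elements of index
`≥ 2` are the `cᵢ`).  We characterise each of the automorphisms
`P_{i,j}`, `I_i`, `(cᵢ^{±1}; z)`, `γ_z`, `(a⁻¹; z)`, `θ` of the paper by its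
values on the basis. -/

abbrev F (m : ℕ) := FreeGroup (Fin (m + 2))

/-- `P_{i,j}`: interchanges `cᵢ` and `c_j`, fixes all other basis elements. -/
def IsP {m : ℕ} (φ : MulAut (F m)) : Prop :=
  ∃ i j : Fin (m + 2), 2 ≤ (i : ℕ) ∧ 2 ≤ (j : ℕ) ∧ i ≠ j ∧
    φ (FreeGroup.of i) = FreeGroup.of j ∧ φ (FreeGroup.of j) = FreeGroup.of i ∧
    ∀ k, k ≠ i → k ≠ j → φ (FreeGroup.of k) = FreeGroup.of k

/-- `I_i`: sends `cᵢ` to `cᵢ⁻¹`, fixes all other basis elements. -/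
def IsI {m : ℕ} (φ : MulAut (F m)) : Prop :=
  ∃ i : Fin (m + 2), 2 ≤ (i : ℕ) ∧ φ (FreeGroup.of i) = (FreeGroup.of i)⁻¹ ∧
    ∀ k, k ≠ i → φ (FreeGroup.of k) = FreeGroup.of k

/-- the allowed twisting elements for `(cᵢ^{±1}; z)` : `z ∈ {aba⁻¹, b} ∪ {c_j : j ≠ i}`. -/
def ZSet (m : ℕ) (i : Fin (m + 2)) : Set (F m) :=
  {FreeGroup.of 0 * FreeGroup.of 1 * (FreeGroup.of 0)⁻¹, FreeGroup.of 1} ∪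
    {x | ∃ j : Fin (m + 2), 2 ≤ (j : ℕ) ∧ j ≠ i ∧ x = FreeGroup.of j}

/-- `(cᵢ; z) : cᵢ ↦ cᵢ z` and `(cᵢ⁻¹; z) : cᵢ ↦ z⁻¹ cᵢ`, fixing all other basis
elements, for `z ∈ {aba⁻¹, b} ∪ {c_j : j ≠ i}`. -/
def IsTransC {m : ℕ} (φ : MulAut (F m)) : Prop :=
  ∃ i : Fin (m + 2), 2 ≤ (i : ℕ) ∧ ∃ z ∈ ZSet m i,
    (φ (FreeGroup.of i) = FreeGroup.of i * z ∨
      φ (FreeGroup.of i) = z⁻¹ * FreeGroup.of i) ∧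
    ∀ k, k ≠ i → φ (FreeGroup.of k) = FreeGroup.of k

/-- the allowed twisting elements for `γ_z` : `z ∈ {aba⁻¹} ∪ {c₁, …, c_m}`. -/
def GammaSet (m : ℕ) : Set (F m) :=
  {FreeGroup.of 0 * FreeGroup.of 1 * (FreeGroup.of 0)⁻¹} ∪
    {x | ∃ j : Fin (m + 2), 2 ≤ (j : ℕ) ∧ x = FreeGroup.of j}

/-- `γ_z : a ↦ az, b ↦ z⁻¹bz`, fixing the `cᵢ`, for `z ∈ {aba⁻¹} ∪ {c₁, …, c_m}`. -/
def IsGamma {m : ℕ} (φ : MulAut (F m)) : Prop :=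
  ∃ z ∈ GammaSet m,
    φ (FreeGroup.of 0) = FreeGroup.of 0 * z ∧
    φ (FreeGroup.of 1) = z⁻¹ * FreeGroup.of 1 * z ∧
    ∀ k : Fin (m + 2), 2 ≤ (k : ℕ) → φ (FreeGroup.of k) = FreeGroup.of k

/-- `(a⁻¹; z) : a ↦ z⁻¹a`, fixing all other basis elements, for
`z ∈ {b} ∪ {c₁, …, c_m}`. -/
def IsAinv {m : ℕ} (φ : MulAut (F m)) : Prop :=
  ∃ z ∈ ({FreeGroup.of 1} ∪
      {x | ∃ j : Fin (m + 2), 2 ≤ (j : ℕ) ∧ x = FreeGroup.of j} : Set (F m)),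
    φ (FreeGroup.of 0) = z⁻¹ * FreeGroup.of 0 ∧
    ∀ k : Fin (m + 2), k ≠ 0 → φ (FreeGroup.of k) = FreeGroup.of k

/-- `θ : a ↦ a⁻¹, b ↦ ab⁻¹a⁻¹`, fixing the `cᵢ`. -/
def IsTheta {m : ℕ} (φ : MulAut (F m)) : Prop :=
  φ (FreeGroup.of 0) = (FreeGroup.of 0)⁻¹ ∧
  φ (FreeGroup.of 1) = FreeGroup.of 0 * (FreeGroup.of 1)⁻¹ * (FreeGroup.of 0)⁻¹ ∧
  ∀ k : Fin (m + 2), 2 ≤ (k : ℕ) → φ (FreeGroup.of k) = FreeGroup.of k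

namespace NielsenCentralizer

open FreeGroup hiding map_mul map_inv map_one

section Suffix

variable {α : Type*}

/-- The element of the free group given by a generator (`true`) or its inverse (`false`). -/
def letter (l : α × Bool) : FreeGroup α := FreeGroup.mk [l]

lemma letter_true (a : α) : letter (a, true) = of a := rfl

lemma letter_not (a : α) (b : Bool) : letter (a, !b) = (letter (a, b))⁻¹ := by
  simp [letter, FreeGroup.inv_mk, FreeGroup.invRev]

lemma letter_false (a : α) : letter (a, false) = (of a)⁻¹ := letter_not a true

lemma mk_cons (l : α × Bool) (L : List (α × Bool)) :
    FreeGroup.mk (l :: L) = letter l * FreeGroup.mk L := by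
  simp [letter]

variable [DecidableEq α]

lemma letter_injective : Function.Injective (letter : α × Bool → FreeGroup α) := by
  intro l l' h
  have := congrArg toWord h
  simpa [letter, reduce_singleton] using this

lemma toWord_letter_mul (l : α × Bool) (x : FreeGroup α) :
    (letter l * x).toWord = l :: x.toWord ∨
      x.toWord = (l.1, !l.2) :: (letter l * x).toWord := by
  have h : (letter l * x).toWord = reduce (l :: x.toWord) := by
    rw [toWord_mul, letter, toWord_mk, reduce_singleton, List.singleton_append]
  rw [h, reduce.cons, reduce_toWord]
  rcases x.toWord with _ | ⟨⟨c, d⟩, L⟩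
  · simp
  · obtain ⟨a, b⟩ := l
    simp only
    split_ifs with hc
    · obtain ⟨h1, h2⟩ := hc
      right
      simp_all
    · left; rfl

/-- `Suf s t` says that the reduced word of `s` is a suffix of the reduced word of `t`. -/
def Suf (s t : FreeGroup α) : Prop := s.toWord <:+ t.toWord

lemma Suf.refl (s : FreeGroup α) : Suf s s := List.suffix_refl _

lemma Suf.trans {s t u : FreeGroup α} (h : Suf s t) (h' : Suf t u) : Suf s u :=
  List.IsSuffix.trans h h'

lemma one_suf (s : FreeGroup α) : Suf 1 s := by simp [Suf]

lemma Suf.antisymm {s t : FreeGroup α} (h : Suf s t) (h' : Suf t s) : s = t :=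
  toWord_injective (h.eq_of_length_le h'.length_le)

lemma toWord_mk_of_suffix {L : List (α × Bool)} {t : FreeGroup α} (h : L <:+ t.toWord) :
    (FreeGroup.mk L).toWord = L := by
  rw [toWord_mk]
  exact (isReduced_toWord.infix h.isInfix).reduce_eq

lemma suf_of_letter_mul {l : α × Bool} {s x : FreeGroup α} (h : Suf s (letter l * x)) :
    Suf s x ∨ s = letter l * x := by
  rcases toWord_letter_mul l x with h' | h'
  · rw [Suf, h', List.suffix_cons_iff] at h
    rcases h with h | h
    · right
      apply toWord_injective
      rw [h, h']
    · exact Or.inl h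
  · left
    rw [Suf, h']
    exact List.IsSuffix.trans h (List.suffix_cons _ _)

lemma suf_of_mk_mul {L : List (α × Bool)} {s x : FreeGroup α} (h : Suf s (FreeGroup.mk L * x)) :
    Suf s x ∨ ∃ L', L' <:+ L ∧ s = FreeGroup.mk L' * x := by
  induction L with
  | nil => left; simpa [← FreeGroup.one_eq_mk] using h
  | cons l L ih =>
    rw [mk_cons, mul_assoc] at h
    rcases suf_of_letter_mul h with h | h
    · rcases ih h with h | ⟨L', hL', h⟩
      · exact Or.inl h
      · exact Or.inr ⟨L', hL'.trans (List.suffix_cons _ _), h⟩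
    · exact Or.inr ⟨l :: L, List.suffix_refl _, by rw [mk_cons, mul_assoc, h]⟩

lemma exists_letter_mul {r : FreeGroup α} (hr : r ≠ 1) :
    ∃ l r', r = letter l * r' ∧ r.toWord = l :: r'.toWord := by
  rcases h : r.toWord with _ | ⟨l, L⟩
  · exact absurd (toWord_eq_nil_iff.1 h) hr
  · have hL : (FreeGroup.mk L).toWord = L :=
      toWord_mk_of_suffix (t := r) (by rw [h]; exact List.suffix_cons _ _)
    refine ⟨l, FreeGroup.mk L, ?_, by rw [hL]⟩
    rw [← mk_cons, ← h, mk_toWord]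

/-- Finite subtrees of the Cayley tree containing the base point, as sets of vertices. -/
structure IsTree (T : Finset (FreeGroup α)) : Prop where
  one_mem : 1 ∈ T
  closed : ∀ t ∈ T, ∀ s, Suf s t → s ∈ T

/-- Translate the part of the tree beyond `r` so that `r` is moved to `q`. -/
noncomputable def graft (r q t : FreeGroup α) : FreeGroup α :=
  open Classical in if Suf r t then t * r⁻¹ * q else t

lemma IsTree.graft {T : Finset (FreeGroup α)} (hT : IsTree T) {r q : FreeGroup α}
    (hq : q ∈ T) (hrq : ¬ Suf r q) : IsTree (T.image (graft r q)) := by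
  have stay : ∀ {s}, s ∈ T → ¬ Suf r s → s ∈ T.image (NielsenCentralizer.graft r q) :=
    fun {s} hs h => Finset.mem_image.2 ⟨s, hs, by simp [NielsenCentralizer.graft, h]⟩
  refine ⟨stay hT.one_mem fun h => hrq (h.trans (one_suf q)), ?_⟩
  intro t ht s hs
  obtain ⟨d, hd, rfl⟩ := Finset.mem_image.1 ht
  by_cases hrd : Suf r d
  · obtain ⟨L, hL⟩ := hrd
    have hdr : d = FreeGroup.mk L * r := by
      rw [← mk_toWord (x := d), ← hL, ← FreeGroup.mul_mk, mk_toWord]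
    have hrd : Suf r d := ⟨L, hL⟩
    have he : NielsenCentralizer.graft r q d = FreeGroup.mk L * q := by
      simp only [NielsenCentralizer.graft, hrd, if_true]
      rw [hdr]; group
    rw [he] at hs
    rcases suf_of_mk_mul hs with h | ⟨L', hL', rfl⟩
    · exact stay (hT.closed q hq s h) fun h' => hrq (h'.trans h)
    · have hsuf : L' ++ r.toWord <:+ d.toWord := by
        obtain ⟨M, rfl⟩ := hL'
        exact ⟨M, by rw [← hL, List.append_assoc]⟩
      have hw : (FreeGroup.mk L' * r).toWord = L' ++ r.toWord := by
        rw [← toWord_mk_of_suffix hsuf, ← FreeGroup.mul_mk, mk_toWord]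
      refine Finset.mem_image.2 ⟨FreeGroup.mk L' * r, hT.closed d hd _ ?_, ?_⟩
      · rw [Suf, hw]; exact hsuf
      · have : Suf r (FreeGroup.mk L' * r) := by rw [Suf, hw]; exact List.suffix_append _ _
        simp [NielsenCentralizer.graft, this]
  · have he : NielsenCentralizer.graft r q d = d := by simp [NielsenCentralizer.graft, hrd]
    rw [he] at hs
    exact stay (hT.closed d hd s hs) fun h => hrd (h.trans hs)

lemma card_graft_lt {T : Finset (FreeGroup α)} {r q : FreeGroup α} (hr : r ∈ T)
    (hq : q ∈ T) (hrq : ¬ Suf r q) : (T.image (graft r q)).card < T.card := by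
  refine lt_of_le_of_ne Finset.card_image_le fun h => ?_
  have hinj := Finset.card_image_iff.1 h
  have : r = q := hinj hr hq (by simp [graft, hrq, Suf.refl])
  exact hrq (this ▸ Suf.refl _)

end Suffix

section Reduction

variable {α : Type*}

/-- A subgroup of `Aut F(α)` containing the elementary Nielsen moves on the generators outside `S`
and the partial conjugations of the generators in `S`. -/
structure HasMoves (S : Set α) (G : Subgroup (MulAut (FreeGroup α))) : Prop where
  swap : ∀ i ∉ S, ∀ j ∉ S, i ≠ j → ∃ g ∈ G, g (of i) = of j ∧ g (of j) = of i ∧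
    ∀ k, k ≠ i → k ≠ j → g (of k) = of k
  inv : ∀ i ∉ S, ∃ g ∈ G, g (of i) = (of i)⁻¹ ∧ ∀ k, k ≠ i → g (of k) = of k
  mulRight : ∀ i ∉ S, ∀ j, j ≠ i → ∃ g ∈ G, g (of i) = of i * of j ∧
    ∀ k, k ≠ i → g (of k) = of k
  mulLeft : ∀ i ∉ S, ∀ j, j ≠ i → ∃ g ∈ G, g (of i) = (of j)⁻¹ * of i ∧
    ∀ k, k ≠ i → g (of k) = of k
  conj : ∀ i ∈ S, ∀ j, j ≠ i → ∃ g ∈ G, g (of i) = (of j)⁻¹ * of i * of j ∧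
    ∀ k, k ≠ i → g (of k) = of k

lemma apply_letter {g : MulAut (FreeGroup α)} {i : α} (h : g (of i) = of i) (e : Bool) :
    g (letter (i, e)) = letter (i, e) := by
  cases e
  · rw [letter_false, map_inv, h]
  · exact h

namespace HasMoves

variable {S : Set α} {G : Subgroup (MulAut (FreeGroup α))}

lemma exists_mulRight (hG : HasMoves S G) {i j : α} (hi : i ∉ S) (hj : j ≠ i) (e : Bool) :
    ∃ g ∈ G, g (of i) = of i * letter (j, e) ∧ ∀ k, k ≠ i → g (of k) = of k := by
  obtain ⟨g, hg, h1, h2⟩ := hG.mulRight i hi j hj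
  cases e
  · refine ⟨g⁻¹, G.inv_mem hg, ?_, fun k hk => ?_⟩
    · rw [MulAut.inv_apply, MulEquiv.symm_apply_eq, letter_false, map_mul, map_inv, h1, h2 j hj]
      group
    · rw [MulAut.inv_apply, MulEquiv.symm_apply_eq, h2 k hk]
  · exact ⟨g, hg, h1, h2⟩

lemma exists_mulLeft (hG : HasMoves S G) {i j : α} (hi : i ∉ S) (hj : j ≠ i) (e : Bool) :
    ∃ g ∈ G, g (of i) = letter (j, e) * of i ∧ ∀ k, k ≠ i → g (of k) = of k := by
  obtain ⟨g, hg, h1, h2⟩ := hG.mulLeft i hi j hj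
  cases e
  · exact ⟨g, hg, h1, h2⟩
  · refine ⟨g⁻¹, G.inv_mem hg, ?_, fun k hk => ?_⟩
    · rw [MulAut.inv_apply, MulEquiv.symm_apply_eq, letter_true, map_mul, h1, h2 j hj]
      group
    · rw [MulAut.inv_apply, MulEquiv.symm_apply_eq, h2 k hk]

lemma exists_conj (hG : HasMoves S G) {i j : α} (hi : i ∈ S) (hj : j ≠ i) (e : Bool) :
    ∃ g ∈ G, g (of i) = letter (j, e) * of i * (letter (j, e))⁻¹ ∧
      ∀ k, k ≠ i → g (of k) = of k := by
  obtain ⟨g, hg, h1, h2⟩ := hG.conj i hi j hj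
  cases e
  · exact ⟨g, hg, by rw [h1, letter_false]; group, h2⟩
  · refine ⟨g⁻¹, G.inv_mem hg, ?_, fun k hk => ?_⟩
    · rw [MulAut.inv_apply, MulEquiv.symm_apply_eq, letter_true, map_mul, map_mul, map_inv, h1,
        h2 j hj]
      group
    · rw [MulAut.inv_apply, MulEquiv.symm_apply_eq, h2 k hk]

lemma exists_single (hG : HasMoves S G) {i j : α} (hj : j ≠ i) (e : Bool) (ε δ : Prop)
    [Decidable ε] [Decidable δ] (h : i ∈ S → (ε ↔ δ)) :
    ∃ g ∈ G, g (of i) = (if ε then letter (j, e) else 1) * of i *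
        (if δ then (letter (j, e))⁻¹ else 1) ∧
      ∀ k, k ≠ i → g (of k) = of k := by
  by_cases hi : i ∈ S
  · have := h hi
    by_cases hε : ε
    · obtain ⟨g, hg, h1, h2⟩ := hG.exists_conj hi hj e
      exact ⟨g, hg, by rw [h1, if_pos hε, if_pos (this.1 hε)], h2⟩
    · exact ⟨1, G.one_mem, by simp [hε, this.not.1 hε], fun _ _ => rfl⟩
  · obtain ⟨g, hg, g1, g2⟩ := hG.exists_mulLeft hi hj e
    obtain ⟨f, hf, f1, f2⟩ := hG.exists_mulRight hi hj (!e)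
    have gf : ∀ k, k ≠ i → (g * f) (of k) = of k := fun k hk => by
      rw [MulAut.mul_apply, f2 k hk, g2 k hk]
    have hl : g (letter (j, !e)) = (letter (j, e))⁻¹ := by
      rw [letter_not, map_inv, apply_letter (g2 j hj)]
    by_cases hε : ε <;> by_cases hδ : δ <;> simp only [hε, hδ, if_true, if_false]
    · exact ⟨g * f, G.mul_mem hg hf, by rw [MulAut.mul_apply, f1, map_mul, g1, hl], gf⟩
    · exact ⟨g, hg, by simpa using g1, g2⟩
    · exact ⟨f, hf, by simpa [letter_not] using f1, f2⟩
    · exact ⟨1, G.one_mem, by simp, fun _ _ => rfl⟩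

variable [DecidableEq α]

/-- Whitehead automorphisms with multiplier `(i, e)`. -/
lemma exists_whitehead [Fintype α] (hG : HasMoves S G) (i : α) (e : Bool) (ε δ : α → Prop)
    [DecidablePred ε] [DecidablePred δ] (h : ∀ j ∈ S, (ε j ↔ δ j)) :
    ∃ g ∈ G, g (of i) = of i ∧ ∀ j, j ≠ i →
      g (of j) = (if ε j then letter (i, e) else 1) * of j *
        (if δ j then (letter (i, e))⁻¹ else 1) := by
  suffices H : ∀ J : Finset α, i ∉ J → ∃ g ∈ G, (∀ j ∉ J, g (of j) = of j) ∧ ∀ j ∈ J,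
      g (of j) = (if ε j then letter (i, e) else 1) * of j *
        (if δ j then (letter (i, e))⁻¹ else 1) by
    obtain ⟨g, hg, h1, h2⟩ := H (Finset.univ.erase i) (by simp)
    exact ⟨g, hg, h1 i (by simp), fun j hj => h2 j (by simp [hj])⟩
  intro J
  induction J using Finset.induction_on with
  | empty => exact fun _ => ⟨1, G.one_mem, fun _ _ => rfl, by simp⟩
  | insert j J hj ih =>
    intro hi
    simp only [Finset.mem_insert, not_or] at hi
    obtain ⟨g, hg, g1, g2⟩ := ih hi.2
    obtain ⟨f, hf, f1, f2⟩ := hG.exists_single hi.1 e (ε j) (δ j) (h j)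
    have hl := apply_letter (g1 i hi.2) e
    refine ⟨g * f, G.mul_mem hg hf, fun k hk => ?_, fun k hk => ?_⟩
    · simp only [Finset.mem_insert, not_or] at hk
      rw [MulAut.mul_apply, f2 k hk.1, g1 k hk.2]
    · rcases eq_or_ne k j with rfl | hkj
      · rw [MulAut.mul_apply, f1, map_mul, map_mul, g1 k hj]
        congr 2
        · split_ifs <;> simp [hl]
        · split_ifs <;> simp [hl]
      · rw [MulAut.mul_apply, f2 k hkj, g2 k (Finset.mem_of_mem_insert_of_ne hk hkj)]

end HasMoves

variable [DecidableEq α]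

/-- The element `u` is carried by a single edge joining two vertices of the tree `T`; when `i ∈ S`
the edge is moreover a loop labelled `i`. -/
def HasEdge (S : Set α) (T : Finset (FreeGroup α)) (i : α) (u : FreeGroup α) : Prop :=
  ∃ p ∈ T, ∃ q ∈ T, ∃ l, u = p⁻¹ * letter l * q ∧ (i ∈ S → p = q ∧ l = (i, true))

/-- Folding together the endpoints of an edge path that closes up to `ψ (of i)`. -/
lemma exists_fold [Fintype α] {S : Set α} {G : Subgroup (MulAut (FreeGroup α))}
    (hG : HasMoves S G) {T : Finset (FreeGroup α)} (hT : IsTree T) (ψ : MulAut (FreeGroup α))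
    {i : α} {r q : FreeGroup α} (hr : r ∈ T) (hq : q ∈ T) (hrq : ¬ Suf r q) (e : Bool)
    (hi : ψ (letter (i, e)) = q⁻¹ * r) (hS : i ∈ S → ψ (of i) = q⁻¹ * of i * q)
    (hj : ∀ j, j ≠ i → HasEdge S T j (ψ (of j))) :
    ∃ g ∈ G, ∃ T' : Finset (FreeGroup α), IsTree T' ∧ T'.card < T.card ∧
      ∀ j, HasEdge S T' j ((ψ * g) (of j)) := by
  classical
  have hj' : ∀ j, ∃ p ∈ T, ∃ q ∈ T, ∃ l, j ≠ i →
      ψ (of j) = p⁻¹ * letter l * q ∧ (j ∈ S → p = q ∧ l = (j, true)) := fun j => by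
    by_cases h : j = i
    · exact ⟨r, hr, r, hr, (i, true), fun h' => (h' h).elim⟩
    · obtain ⟨p, hp, q, hq, l, H⟩ := hj j h
      exact ⟨p, hp, q, hq, l, fun _ => H⟩
  choose P hP Q hQ l hl using hj'
  have hc : ∀ j ∈ S, j ≠ i → P j = Q j := fun j hjS hji => ((hl j hji).2 hjS).1
  obtain ⟨g, hg, g1, g2⟩ := hG.exists_whitehead i e (fun j => j ≠ i ∧ Suf r (P j))
    (fun j => j ≠ i ∧ Suf r (Q j)) (fun j hjS => by
      by_cases h : j = i
      · simp [h]
      · simp [hc j hjS h])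
  refine ⟨g, hg, T.image (graft r q), hT.graft hq hrq, card_graft_lt hr hq hrq, fun j => ?_⟩
  have mem : ∀ {t}, t ∈ T → graft r q t ∈ T.image (graft r q) :=
    fun {t} ht => Finset.mem_image_of_mem _ ht
  have memq : q ∈ T.image (graft r q) := by
    simpa [graft, hrq] using mem hq
  by_cases hji : j = i
  · subst hji
    rw [MulAut.mul_apply, g1]
    by_cases hjS : j ∈ S
    · exact ⟨q, memq, q, memq, (j, true), hS hjS, fun _ => ⟨rfl, rfl⟩⟩
    · have hr1 : r ≠ 1 := fun h => hrq (h ▸ one_suf q)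
      obtain ⟨⟨a, b⟩, r', hr', hw⟩ := exists_letter_mul hr1
      have hsuf : Suf r' r := by rw [Suf, hw]; exact List.suffix_cons _ _
      have hnot : ¬ Suf r r' := fun h => by
        have := h.length_le
        rw [hw] at this
        simp at this
      have memr' : r' ∈ T.image (graft r q) := by
        simpa [graft, hnot] using mem (hT.closed r hr r' hsuf)
      cases e
      · refine ⟨r', memr', q, memq, (a, !b), ?_, fun h => absurd h hjS⟩
        rw [letter_false, map_inv, hr'] at hi
        rw [letter_not, ← inv_inv (ψ (of j)), hi]
        group
      · refine ⟨q, memq, r', memr', (a, b), ?_, fun h => absurd h hjS⟩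
        rw [letter_true, hr'] at hi
        rw [hi]
        group
  · obtain ⟨h1, h2⟩ := hl j hji
    refine ⟨_, mem (hP j), _, mem (hQ j), l j, ?_, fun hjS => ⟨by rw [(h2 hjS).1], (h2 hjS).2⟩⟩
    rw [MulAut.mul_apply, g2 j hji, map_mul, map_mul, h1]
    have e1 : ψ (if j ≠ i ∧ Suf r (P j) then letter (i, e) else 1) * (P j)⁻¹ =
        (graft r q (P j))⁻¹ := by
      by_cases h : Suf r (P j)
      · simp [graft, h, hji, hi, mul_assoc]
      · simp [graft, h]
    have e2 : Q j * ψ (if j ≠ i ∧ Suf r (Q j) then (letter (i, e))⁻¹ else 1) =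
        graft r q (Q j) := by
      by_cases h : Suf r (Q j)
      · simp [graft, h, hji, hi, mul_assoc]
      · simp [graft, h]
    rw [← e1, ← e2]
    group

/-- A version of `exists_fold` that is symmetric in the two endpoints. -/
lemma exists_fold_of_ne [Fintype α] {S : Set α} {G : Subgroup (MulAut (FreeGroup α))}
    (hG : HasMoves S G) {T : Finset (FreeGroup α)} (hT : IsTree T) (ψ : MulAut (FreeGroup α))
    {i : α} {r q : FreeGroup α} (hr : r ∈ T) (hq : q ∈ T) (e : Bool)
    (hi : ψ (letter (i, e)) = q⁻¹ * r)
    (hS : i ∈ S → ψ (of i) = q⁻¹ * of i * q ∧ ψ (of i) = r⁻¹ * of i * r)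
    (hj : ∀ j, j ≠ i → HasEdge S T j (ψ (of j))) :
    ∃ g ∈ G, ∃ T' : Finset (FreeGroup α), IsTree T' ∧ T'.card < T.card ∧
      ∀ j, HasEdge S T' j ((ψ * g) (of j)) := by
  by_cases h : Suf r q
  · refine exists_fold hG hT ψ hq hr (fun h' => ?_) (!e) ?_ (fun h => (hS h).2) hj
    · rw [h.antisymm h', inv_mul_cancel, map_eq_one_iff _ ψ.injective] at hi
      cases e
      · rw [letter_false, inv_eq_one] at hi; exact of_ne_one i hi
      · exact of_ne_one i hi
    · rw [letter_not, map_inv, hi]; group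
  · exact exists_fold hG hT ψ hr hq h e hi (fun h => (hS h).1) hj

end Reduction

section Folded

lemma exists_perm_of_relation {X : Type*} [Finite X] {R : X → X → Prop}
    (hfun : ∀ x y z, R x y → R x z → y = z) (hinj : ∀ x y z, R x z → R y z → x = y) :
    ∃ σ : Equiv.Perm X, ∀ x y, R x y → σ x = y := by
  classical
  have := Fintype.ofFinite X
  let f : X → X := fun x => if h : ∃ y, R x y then h.choose else x
  have hf : ∀ x y, R x y → f x = y := fun x y h => by
    have hx : ∃ y, R x y := ⟨y, h⟩
    simp only [f, hx, dif_pos]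
    exact hfun _ _ _ hx.choose_spec h
  obtain ⟨σ, hσ⟩ := Finset.exists_equiv_extend_of_card_eq (α := X) (t := Finset.univ)
    (s := {x | ∃ y, R x y}) (f := f) (by simp) (Finset.subset_univ _) (by
      intro x hx y hy hxy
      obtain ⟨x', hx⟩ := by simpa using hx
      obtain ⟨y', hy⟩ := by simpa using hy
      rw [hf x x' hx, hf y y' hy] at hxy
      exact hinj _ _ _ hx (hxy ▸ hy))
  refine ⟨σ.trans (Equiv.subtypeUnivEquiv Finset.mem_univ), fun x y h => ?_⟩
  simpa [hf x y h] using hσ x (by simpa using ⟨y, h⟩)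

variable {α : Type*} [DecidableEq α]

/-- If the labelled graph made of the tree `T` and the oriented edges `d` is folded, and its
loops represent generators of the free group, then `T` is a single vertex. -/
lemma eq_one_of_folded {T : Finset (FreeGroup α)} (hT : IsTree T) (ψ : MulAut (FreeGroup α))
    {src tgt : α × Bool → FreeGroup α} {lab : α × Bool → α × Bool}
    (hsrc : ∀ d, src d ∈ T)
    (src_not : ∀ a b, src (a, !b) = tgt (a, b))
    (lab_not : ∀ a b, lab (a, !b) = ((lab (a, b)).1, !(lab (a, b)).2))
    (hψ : ∀ d, ψ (letter d) = (tgt d)⁻¹ * letter (lab d) * src d)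
    (hA : ∀ d, letter (lab d) * src d ∉ T)
    (hB : ∀ d d', src d = src d' → lab d = lab d' → d = d') :
    ∀ t ∈ T, t = 1 := by
  have tgt_not : ∀ a b, tgt (a, !b) = src (a, b) := fun a b => by
    rw [← src_not, Bool.not_not]
  have htgt : ∀ d, tgt d ∈ T := fun ⟨a, b⟩ => src_not a b ▸ hsrc _
  let R : α × Bool → T → T → Prop := fun l t t' =>
    (t' : FreeGroup α) = letter l * t ∨ ∃ d, lab d = l ∧ src d = t ∧ tgt d = t'
  have hfun : ∀ l t t' t'', R l t t' → R l t t'' → t' = t'' := by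
    rintro l t t' t'' (h | ⟨d, h1, h2, h3⟩) (h' | ⟨d', h1', h2', h3'⟩)
    · exact Subtype.ext (h.trans h'.symm)
    · exact absurd (h ▸ t'.2) (h1' ▸ h2' ▸ hA d')
    · exact absurd (h' ▸ t''.2) (h1 ▸ h2 ▸ hA d)
    · obtain rfl := hB d d' (h2.trans h2'.symm) (h1.trans h1'.symm)
      exact Subtype.ext (h3.symm.trans h3')
  have hrev : ∀ a b t t', R (a, b) t t' → R (a, !b) t' t := by
    rintro a b t t' (h | ⟨⟨c, e⟩, h1, h2, h3⟩)
    · left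
      rw [letter_not, h, inv_mul_cancel_left]
    · right
      exact ⟨(c, !e), by rw [lab_not, h1], (src_not c e).trans h3, (tgt_not c e).trans h2⟩
  choose σ hσ using fun a : α => exists_perm_of_relation (hfun (a, true))
    fun x y z hx hy => hfun _ _ _ _ (hrev a true x z hx) (hrev a true y z hy)
  let Φ : FreeGroup α →* Equiv.Perm T := FreeGroup.lift σ
  have hΦ : ∀ l t t', R l t t' → Φ (letter l) t = t' := by
    rintro ⟨a, b⟩ t t' h
    cases b
    · rw [letter_false, map_inv, Equiv.Perm.inv_eq_iff_eq]
      simpa [Φ] using (hσ a _ _ (hrev a false _ _ h)).symm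
    · simpa [Φ, letter_true] using hσ a _ _ h
  have hpath : ∀ n, ∀ t : T, (t : FreeGroup α).toWord.length = n →
      Φ t ⟨1, hT.one_mem⟩ = t := by
    intro n
    induction n with
    | zero =>
      rintro ⟨t, ht⟩ h
      obtain rfl : t = 1 := by simpa using h
      simp
    | succ n ih =>
      rintro ⟨t, ht⟩ h
      have ht1 : t ≠ 1 := by rintro rfl; simp at h
      obtain ⟨l, r, rfl, hw⟩ := exists_letter_mul ht1
      have hr : r ∈ T := hT.closed _ ht _ (by rw [Suf, hw]; exact List.suffix_cons _ _)
      simp only [hw, List.length_cons, Nat.add_right_cancel_iff] at h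
      rw [map_mul, Equiv.Perm.mul_apply, ih ⟨r, hr⟩ h]
      exact hΦ _ _ _ (Or.inl rfl)
  have hfix : ∀ w, Φ (ψ w) ⟨1, hT.one_mem⟩ = ⟨1, hT.one_mem⟩ := by
    have hgen : ∀ a, Φ (ψ (of a)) ⟨1, hT.one_mem⟩ = ⟨1, hT.one_mem⟩ := fun a => by
      rw [← letter_true, hψ, map_mul, map_mul, map_inv, Equiv.Perm.mul_apply, Equiv.Perm.mul_apply,
        hpath _ ⟨_, hsrc _⟩ rfl, hΦ _ _ ⟨_, htgt (a, true)⟩ (Or.inr ⟨_, rfl, rfl, rfl⟩),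
        Equiv.Perm.inv_eq_iff_eq, hpath _ ⟨_, htgt _⟩ rfl]
    intro w
    induction w using FreeGroup.induction_on with
    | C1 => simp
    | of a => exact hgen a
    | inv_of a h => rw [map_inv, map_inv, Equiv.Perm.inv_eq_iff_eq, h]
    | mul x y hx hy => rw [map_mul, map_mul, Equiv.Perm.mul_apply, hy, hx]
  intro t ht
  have h1 := hpath _ ⟨t, ht⟩ rfl
  have h2 := hfix (ψ.symm t)
  rw [MulEquiv.apply_symm_apply] at h2
  exact congrArg Subtype.val (h1.symm.trans h2)

end Folded

section Generation

variable {α : Type*} {S : Set α} {G : Subgroup (MulAut (FreeGroup α))}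

lemma HasMoves.exists_signed_swap (hG : HasMoves S G) {i j : α} (hi : i ∉ S) (hj : j ∉ S)
    (hij : i ≠ j) (b : Bool) : ∃ g ∈ G, g (of j) = letter (i, b) ∧ g (of i) = of j ∧
      ∀ k, k ≠ i → k ≠ j → g (of k) = of k := by
  obtain ⟨g, hg, g1, g2, g3⟩ := hG.swap i hi j hj hij
  cases b
  · obtain ⟨f, hf, f1, f2⟩ := hG.inv j hj
    refine ⟨g * f, G.mul_mem hg hf, ?_, ?_, fun k hki hkj => ?_⟩
    · rw [MulAut.mul_apply, f1, map_inv, g2, letter_false]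
    · rw [MulAut.mul_apply, f2 i hij, g1]
    · rw [MulAut.mul_apply, f2 k hkj, g3 k hki hkj]
  · exact ⟨g, hg, g2, g1, g3⟩

variable [DecidableEq α]

/-- Signed permutations of the basis fixing `S` are products of elementary moves. -/
lemma HasMoves.mem_of_letters [Fintype α] (hG : HasMoves S G) (ψ : MulAut (FreeGroup α))
    (hψ : ∀ i, ∃ l, ψ (of i) = letter l) (hS : ∀ i ∈ S, ψ (of i) = of i) : ψ ∈ G := by
  induction hn : Finset.card {i | ψ (of i) ≠ of i} using Nat.strong_induction_on generalizing ψ with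
  | _ n ih =>
  by_cases hall : ∀ i, ψ (of i) = of i
  · have : ψ = 1 := by
      apply MulEquiv.toMonoidHom_injective
      ext i
      exact hall i
    exact this ▸ G.one_mem
  push Not at hall
  obtain ⟨i, hi⟩ := hall
  have hiS : i ∉ S := fun h => hi (hS i h)
  obtain ⟨⟨j, b⟩, hl⟩ := hψ i
  rcases eq_or_ne i j with rfl | hij
  · have hb : b = false := by
      cases b
      · rfl
      · exact absurd hl hi
    subst hb
    obtain ⟨g, hg, g1, g2⟩ := hG.inv i hiS
    have h1 : (ψ * g) (of i) = of i := by
      rw [MulAut.mul_apply, g1, map_inv, hl, letter_false, inv_inv]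
    have h2 : ∀ k, k ≠ i → (ψ * g) (of k) = ψ (of k) := fun k hk => by
      rw [MulAut.mul_apply, g2 k hk]
    refine (G.mul_mem_cancel_right hg).1 (ih _ ?_ (ψ * g) (fun k => ?_) (fun k hk => ?_) rfl)
    · rw [← hn]
      refine Finset.card_lt_card (Finset.ssubset_iff_of_subset (fun k hk => ?_) |>.2 ⟨i, ?_, ?_⟩)
      · simp only [Finset.mem_filter, Finset.mem_univ, true_and] at hk ⊢
        rcases eq_or_ne k i with rfl | hki
        · exact hi
        · rwa [h2 k hki] at hk
      · simpa using hi
      · exact fun h => (Finset.mem_filter.1 h).2 h1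
    · rcases eq_or_ne k i with rfl | hki
      · exact ⟨(k, true), h1⟩
      · rw [h2 k hki]; exact hψ k
    · rw [h2 k (fun h => hiS (h ▸ hk)), hS k hk]
  · have hj : ψ (of j) ≠ of j := fun h => by
      have h3 : ψ (letter (j, b)) = ψ (of i) := by
        rw [hl]
        cases b
        · rw [letter_false, map_inv, h]
        · exact h
      have := letter_injective ((ψ.injective h3).trans (letter_true i).symm)
      exact hij (congrArg Prod.fst this).symm
    have hjS : j ∉ S := fun h => hj (hS j h)
    obtain ⟨g, hg, g1, g2, g3⟩ := hG.exists_signed_swap hiS hjS hij b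
    have h1 : (ψ * g) (of j) = of j := by
      rw [MulAut.mul_apply, g1]
      cases b
      · rw [letter_false, map_inv, hl, letter_false, inv_inv]
      · exact hl
    have h2 : (ψ * g) (of i) = ψ (of j) := by rw [MulAut.mul_apply, g2]
    have h3 : ∀ k, k ≠ i → k ≠ j → (ψ * g) (of k) = ψ (of k) := fun k hki hkj => by
      rw [MulAut.mul_apply, g3 k hki hkj]
    refine (G.mul_mem_cancel_right hg).1 (ih _ ?_ (ψ * g) (fun k => ?_) (fun k hk => ?_) rfl)
    · rw [← hn]
      refine Finset.card_lt_card (Finset.ssubset_iff_of_subset (fun k hk => ?_) |>.2 ⟨j, ?_, ?_⟩)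
      · simp only [Finset.mem_filter, Finset.mem_univ, true_and] at hk ⊢
        rcases eq_or_ne k i with rfl | hki
        · exact hi
        rcases eq_or_ne k j with rfl | hkj
        · exact hj
        · rwa [h3 k hki hkj] at hk
      · simpa using hj
      · exact fun h => (Finset.mem_filter.1 h).2 h1
    · rcases eq_or_ne k j with rfl | hkj
      · exact ⟨(k, true), h1⟩
      rcases eq_or_ne k i with rfl | hki
      · rw [h2]; exact hψ j
      · rw [h3 k hki hkj]; exact hψ k
    · rw [h3 k (fun h => hiS (h ▸ hk)) (fun h => hjS (h ▸ hk)), hS k hk]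

/-- One reduction step: as long as the tree is not a point, it can be made smaller. -/
lemma HasMoves.exists_smaller [Fintype α] (hG : HasMoves S G) {T : Finset (FreeGroup α)}
    (hT : IsTree T) (ψ : MulAut (FreeGroup α)) (hψ : ∀ i, HasEdge S T i (ψ (of i)))
    (hT1 : ∃ t ∈ T, t ≠ 1) :
    ∃ g ∈ G, ∃ T' : Finset (FreeGroup α), IsTree T' ∧ T'.card < T.card ∧
      ∀ j, HasEdge S T' j ((ψ * g) (of j)) := by
  choose P hP Q hQ l hl hlS using hψ
  let src : α × Bool → FreeGroup α := fun d => if d.2 then Q d.1 else P d.1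
  let tgt : α × Bool → FreeGroup α := fun d => if d.2 then P d.1 else Q d.1
  let lab : α × Bool → α × Bool := fun d => ((l d.1).1, if d.2 then (l d.1).2 else !(l d.1).2)
  have hsrc : ∀ d, src d ∈ T := by
    rintro ⟨a, _ | _⟩
    exacts [hP a, hQ a]
  have htgt : ∀ d, tgt d ∈ T := by
    rintro ⟨a, _ | _⟩
    exacts [hQ a, hP a]
  have hd : ∀ d, ψ (letter d) = (tgt d)⁻¹ * letter (lab d) * src d := by
    rintro ⟨a, _ | _⟩
    · change ψ (letter (a, false)) = (Q a)⁻¹ * letter ((l a).1, !(l a).2) * P a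
      rw [letter_false, map_inv, hl, letter_not]
      group
    · exact hl a
  have labS : ∀ i ∈ S, ∀ b, lab (i, b) = (i, b) ∧ tgt (i, b) = src (i, b) := by
    intro i hi b
    obtain ⟨h1, h2⟩ := hlS i hi
    cases b <;> simp [lab, src, tgt, h1, h2]
  by_cases hA : ∀ d, letter (lab d) * src d ∉ T
  swap
  · push Not at hA
    obtain ⟨⟨i, b⟩, hA⟩ := hA
    refine exists_fold_of_ne hG hT ψ hA (htgt (i, b)) b (by rw [hd, mul_assoc]) (fun hi => ?_)
      fun j _ => ⟨P j, hP j, Q j, hQ j, l j, hl j, hlS j⟩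
    obtain ⟨h1, h2⟩ := labS i hi b
    have h3 : ψ (of i) = (src (i, b))⁻¹ * of i * src (i, b) := by
      obtain ⟨e1, e2⟩ := hlS i hi
      rw [hl, e2, letter_true]
      cases b <;> simp [src, e1]
    refine ⟨by rw [h2, h3], ?_⟩
    rw [h1, h3]
    cases b
    · rw [letter_false]; group
    · rw [letter_true]; group
  by_cases hB : ∀ d d', src d = src d' → lab d = lab d' → d = d'
  · obtain ⟨t, ht, ht1⟩ := hT1
    refine absurd (eq_one_of_folded hT ψ hsrc ?_ ?_ hd hA hB t ht) ht1
    · rintro a (_ | _) <;> rfl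
    · rintro a (_ | _) <;> simp [lab]
  push Not at hB
  obtain ⟨⟨i, b⟩, ⟨j, c⟩, hs, hlab, hne⟩ := hB
  have hij : i ≠ j := by
    rintro rfl
    have := congrArg Prod.snd hlab
    rcases b with _ | _ <;> rcases c with _ | _
    · exact hne rfl
    · exact Bool.not_ne_self _ this
    · exact Bool.not_ne_self _ this.symm
    · exact hne rfl
  wlog hjS : j ∉ S generalizing i j b c
  · refine this j c i b hs.symm hlab.symm (Ne.symm hne) hij.symm fun hiS => ?_
    rw [(labS i hiS b).1, (labS j (not_not.1 hjS) c).1] at hlab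
    exact hne hlab
  have hh : ∃ h ∈ G, h (letter (j, c)) = letter (j, c) * letter (i, !b) ∧
      ∀ k, k ≠ j → h (of k) = of k := by
    cases c
    · obtain ⟨h, hh, h1, h2⟩ := hG.exists_mulLeft hjS hij b
      refine ⟨h, hh, ?_, h2⟩
      rw [letter_false, map_inv, h1, letter_not]
      group
    · exact hG.exists_mulRight hjS hij (!b)
  obtain ⟨h, hh, h1, h2⟩ := hh
  obtain ⟨g, hg, T', hT', hcard, hedge⟩ := exists_fold_of_ne hG hT (ψ * h) (i := j)
    (htgt (i, b)) (htgt (j, c)) c (by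
      rw [MulAut.mul_apply, h1, map_mul, letter_not, map_inv, hd, hd, hs, hlab]
      group) (fun hj => absurd hj hjS) fun k hk => by
      rw [MulAut.mul_apply, h2 k hk]
      exact ⟨P k, hP k, Q k, hQ k, l k, hl k, hlS k⟩
  exact ⟨h * g, G.mul_mem hh hg, T', hT', hcard, fun k => by
    simpa only [mul_assoc] using hedge k⟩

lemma exists_isTree (A : Finset (FreeGroup α)) : ∃ T, IsTree T ∧ A ⊆ T := by
  have mem : ∀ s t : FreeGroup α, s ∈ (t.toWord.tails.map FreeGroup.mk).toFinset ↔ Suf s t := by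
    intro s t
    simp only [List.mem_toFinset, List.mem_map, List.mem_tails]
    constructor
    · rintro ⟨L, hL, rfl⟩
      rwa [Suf, toWord_mk_of_suffix hL]
    · exact fun h => ⟨_, h, mk_toWord⟩
  refine ⟨insert 1 (A.biUnion fun t => (t.toWord.tails.map FreeGroup.mk).toFinset), ⟨?_, ?_⟩, ?_⟩
  · exact Finset.mem_insert_self _ _
  · intro t ht s hs
    simp only [Finset.mem_insert, Finset.mem_biUnion, mem] at ht ⊢
    rcases ht with rfl | ⟨a, ha, ht⟩
    · exact Or.inl (hs.antisymm (one_suf s))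
    · exact Or.inr ⟨a, ha, hs.trans ht⟩
  · intro a ha
    simp only [Finset.mem_insert, Finset.mem_biUnion, mem]
    exact Or.inr ⟨a, ha, Suf.refl a⟩

/-- Automorphisms of a free group sending each generator in `S` to a conjugate of itself are
products of elementary moves. -/
theorem HasMoves.mem_of_conj [Fintype α] (hG : HasMoves S G) (ψ : MulAut (FreeGroup α))
    (hψ : ∀ i ∈ S, ∃ p, ψ (of i) = p⁻¹ * of i * p) : ψ ∈ G := by
  have key : ∀ n, ∀ T : Finset (FreeGroup α), T.card = n → IsTree T → ∀ ψ : MulAut (FreeGroup α),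
      (∀ i, HasEdge S T i (ψ (of i))) → ψ ∈ G := by
    intro n
    induction n using Nat.strong_induction_on with
    | _ n ih =>
    intro T hn hT ψ hψ
    by_cases hT1 : ∃ t ∈ T, t ≠ 1
    · obtain ⟨g, hg, T', hT', hlt, hedge⟩ := hG.exists_smaller hT ψ hψ hT1
      exact (G.mul_mem_cancel_right hg).1 (ih _ (hn ▸ hlt) T' rfl hT' _ hedge)
    · push Not at hT1
      refine hG.mem_of_letters ψ (fun i => ?_) fun i hi => ?_
      · obtain ⟨p, hp, q, hq, l, h, -⟩ := hψ i
        exact ⟨l, by simpa [hT1 p hp, hT1 q hq] using h⟩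
      · obtain ⟨p, hp, q, hq, l, h, hS⟩ := hψ i
        obtain ⟨-, rfl⟩ := hS hi
        simpa [hT1 p hp, hT1 q hq, letter_true] using h
  have hedge : ∀ i, ∃ p q l, ψ (of i) = p⁻¹ * letter l * q ∧ (i ∈ S → p = q ∧ l = (i, true)) := by
    intro i
    by_cases hi : i ∈ S
    · obtain ⟨p, hp⟩ := hψ i hi
      exact ⟨p, p, (i, true), hp, fun _ => ⟨rfl, rfl⟩⟩
    · have : ψ (of i) ≠ 1 := fun h => of_ne_one i ((map_eq_one_iff ψ ψ.injective).1 h)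
      obtain ⟨l, r, h, -⟩ := exists_letter_mul this
      exact ⟨1, r, l, by simpa using h, fun h => absurd h hi⟩
  choose P Q l h hS using hedge
  obtain ⟨T, hT, hA⟩ := exists_isTree (Finset.univ.image P ∪ Finset.univ.image Q)
  exact key _ T rfl hT ψ fun i => ⟨P i, hA (by simp), Q i, hA (by simp), l i, h i, hS i⟩

end Generation

section HNN

open HNNExtension HNNExtension.NormalWord

variable {G : Type*} [Group G] {A B : Subgroup G} {φ : A ≃* B}

variable (φ) in
/-- The product in the HNN extension of a list of syllables `t ^ u * g`. -/
def syllableProd (L : List (ℤˣ × G)) : HNNExtension G A B φ :=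
  (L.map fun x => t ^ (x.1 : ℤ) * HNNExtension.of x.2).prod

lemma syllableProd_cons (u : ℤˣ) (g : G) (L : List (ℤˣ × G)) :
    syllableProd φ ((u, g) :: L) = t ^ (u : ℤ) * HNNExtension.of g * syllableProd φ L := by
  simp [syllableProd]

variable (A B) in
/-- No subword `t ^ u * g * t ^ (-u)` with `g` in `toSubgroup A B u`. -/
def IsReduced (L : List (ℤˣ × G)) : Prop :=
  L.IsChain fun a b => a.2 ∈ toSubgroup A B a.1 → a.1 = b.1

lemma exists_syllableProd_mul (y : G) (u : ℤˣ) (g : G) (L : List (ℤˣ × G))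
    (h : IsReduced A B ((u, g) :: L)) :
    ∃ g' L', IsReduced A B ((u, g') :: L') ∧
      syllableProd φ ((u, g') :: L') = syllableProd φ ((u, g) :: L) * HNNExtension.of y := by
  induction L generalizing u g with
  | nil => exact ⟨g * y, [], List.isChain_singleton _, by simp [syllableProd, mul_assoc]⟩
  | cons a L ih =>
    obtain ⟨v, k⟩ := a
    obtain ⟨h1, h2⟩ := List.isChain_cons_cons.1 h
    obtain ⟨k', L', h3, h4⟩ := ih v k h2
    refine ⟨g, (v, k') :: L', List.isChain_cons_cons.2 ⟨h1, h3⟩, ?_⟩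
    rw [syllableProd_cons, h4, syllableProd_cons u, mul_assoc _ _ (HNNExtension.of y)]

lemma exists_isReduced (w : HNNExtension G A B φ) :
    ∃ h L, IsReduced A B L ∧ w = HNNExtension.of h * syllableProd φ L := by
  obtain ⟨d⟩ := TransversalPair.nonempty G A B
  let r := NormalWord.equiv φ d w
  exact ⟨r.head, r.toList, r.chain, ((NormalWord.equiv φ d).symm_apply_apply w).symm⟩

/-- Let `σ` be a twist of the HNN extension, multiplying the stable letter by a central
element of the associated subgroup. An element `w` with `σ w = w * y` for `y` in the base
has at most one syllable. -/
lemma eq_of_twist (σ : HNNExtension G A B φ →* HNNExtension G A B φ)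
    (hσ : ∀ g, σ (HNNExtension.of g) = HNNExtension.of g) (z : ℤˣ → G)
    (hσt : ∀ u : ℤˣ, σ (t ^ (u : ℤ)) = t ^ (u : ℤ) * HNNExtension.of (z u))
    (hz : ∀ u, z u ∈ toSubgroup A B u)
    (hneg : ∀ u g, g⁻¹ * z u * g ∉ toSubgroup A B (-u))
    (hpos : ∀ u g, g⁻¹ * z u * g ∈ toSubgroup A B u → g ∈ toSubgroup A B u)
    {w : HNNExtension G A B φ} {y : G} (hw : σ w = w * HNNExtension.of y) :
    (∃ h, w = HNNExtension.of h) ∨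
      ∃ (u : ℤˣ) (h g : G), w = HNNExtension.of h * t ^ (u : ℤ) * HNNExtension.of g := by
  obtain ⟨h, L, hL, rfl⟩ := exists_isReduced w
  rcases L with _ | ⟨⟨u, g⟩, _ | ⟨⟨v, k⟩, L⟩⟩
  · exact Or.inl ⟨h, by simp [syllableProd]⟩
  · exact Or.inr ⟨u, h, g, by simp [syllableProd, mul_assoc]⟩
  exfalso
  obtain ⟨h1, h2⟩ := List.isChain_cons_cons.1 hL
  let τ : ℤˣ × G → ℤˣ × G := fun a => (a.1, z a.1 * a.2)
  have hτ : ∀ M, IsReduced A B M → IsReduced A B (M.map τ) := fun M hM =>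
    (List.isChain_map τ).2 (hM.imp fun a b hab h =>
      hab (((toSubgroup A B a.1).mul_mem_cancel_left (hz a.1)).1 h))
  have hστ : ∀ M, σ (syllableProd φ M) = syllableProd φ (M.map τ) := by
    intro M
    induction M with
    | nil => simp [syllableProd]
    | cons a M ih =>
      obtain ⟨u, g⟩ := a
      rw [List.map_cons, syllableProd_cons, syllableProd_cons, ← ih, map_mul, map_mul, hσt, hσ,
        map_mul, mul_assoc (t ^ _)]
  obtain ⟨k', L', h3, h4⟩ := exists_syllableProd_mul (φ := φ) y v k L h2
  have key : (⟨g, _, h3⟩ : ReducedWord G A B).prod φ =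
      (⟨z u * g, _, hτ _ h2⟩ : ReducedWord G A B).prod φ := by
    change HNNExtension.of g * syllableProd φ _ = HNNExtension.of (z u * g) * syllableProd φ _
    rw [map_mul, syllableProd_cons, map_mul, map_mul, hσ, hσ, hσt, hστ] at hw
    rw [h4, map_mul]
    simpa only [mul_assoc, mul_right_inj] using hw.symm
  have := (ReducedWord.map_fst_eq_and_of_prod_eq φ key).2 v rfl
  change g⁻¹ * (z u * g) ∈ _ at this
  rw [← mul_assoc] at this
  rcases Int.units_eq_one_or (v * u) with h5 | h5
  · obtain rfl : v = u := by rwa [mul_eq_one_iff_eq_inv, Int.units_inv_eq_self] at h5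
    exact hneg v g this
  · obtain rfl : u = -v := by
      rw [← Int.units_inv_eq_self v, ← mul_neg_one, ← h5, inv_mul_cancel_left]
    have : -v = v := h1 (hpos _ g this)
    rcases Int.units_eq_one_or v with rfl | rfl <;> exact absurd this (by decide)

end HNN

section ZPowers

variable {α : Type*} [DecidableEq α]

lemma mem_zpowers_of_commute {a : α} {g : FreeGroup α} (h : g * of a = of a * g) :
    g ∈ Subgroup.zpowers (of a) := by
  induction hn : g.toWord.length generalizing g with
  | zero =>
    obtain rfl : g = 1 := by simpa using hn
    exact one_mem _
  | succ n ih =>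
    have hg : g ≠ 1 := by rintro rfl; simp at hn
    obtain ⟨⟨c, b⟩, r, rfl, hw⟩ := exists_letter_mul hg
    have hmem : ∀ b, letter (a, b) ∈ Subgroup.zpowers (of a) := by
      rintro (_ | _)
      · exact letter_false a ▸ inv_mem (Subgroup.mem_zpowers _)
      · exact Subgroup.mem_zpowers _
    by_cases hca : c = a
    · subst hca
      refine mul_mem (hmem b) (ih ?_ (by simpa [hw] using hn))
      have hc : letter (c, b) * of c = of c * letter (c, b) := by
        cases b
        · simp [letter_false]
        · rfl
      rw [mul_assoc, ← mul_assoc (of c), ← hc, mul_assoc] at h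
      exact mul_left_cancel h
    · exfalso
      have h1 : (of a * (letter (c, b) * r)).toWord = (a, true) :: (c, b) :: r.toWord := by
        rcases toWord_letter_mul (a, true) (letter (c, b) * r) with h2 | h2
        · rw [← letter_true, h2, hw]
        · rw [hw] at h2
          exact absurd (congrArg Prod.fst (List.cons.inj h2).1) hca
      have h2 := FreeGroup.toWord_mul_sublist (letter (c, b) * r) (of a)
      rw [h, h1, hw] at h2
      have h3 := h2.eq_of_length (by simp)
      exact hca (congrArg Prod.fst (List.cons.inj h3).1).symm

lemma eq_and_mem_zpowers_of_conj {i j : α} {u : ℤˣ} {g : FreeGroup α}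
    (h : g⁻¹ * of i ^ (u : ℤ) * g ∈ Subgroup.zpowers (of j)) :
    i = j ∧ g ∈ Subgroup.zpowers (of j) := by
  obtain ⟨k, hk⟩ := h
  let χ : FreeGroup α →* Multiplicative ℤ :=
    FreeGroup.lift fun l => if l = i then Multiplicative.ofAdd 1 else 1
  have h1 := congrArg χ hk
  simp only [χ, map_mul, map_inv, map_zpow, lift_apply_of, if_true, inv_mul_cancel_comm] at h1
  have hij : i = j := by
    by_contra hij
    rw [if_neg (Ne.symm hij), one_zpow, ← ofAdd_zsmul, smul_eq_mul, mul_one] at h1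
    exact u.ne_zero (Multiplicative.ofAdd.injective h1.symm)
  subst hij
  rw [if_pos rfl, ← ofAdd_zsmul, ← ofAdd_zsmul, smul_eq_mul, smul_eq_mul, mul_one, mul_one] at h1
  obtain rfl : k = u := Multiplicative.ofAdd.injective h1
  refine ⟨rfl, mem_zpowers_of_commute ?_⟩
  rcases Int.units_eq_one_or u with rfl | rfl
  · simp only [Units.val_one, zpow_one] at hk
    nth_rewrite 1 [hk]
    group
  · simp only [Units.val_neg, Units.val_one, zpow_neg, zpow_one] at hk
    have hc : g * (of i)⁻¹ = (of i)⁻¹ * g := by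
      nth_rewrite 1 [hk]
      group
    exact Commute.inv_right_iff.1 hc

end ZPowers

section Embedding

variable {m : ℕ}

/-- The embedding of the free group onto the subgroup generated by `aba⁻¹`, `b` and the `cᵢ`. -/
def iota (m : ℕ) : F m →* F m :=
  FreeGroup.lift fun k => if k = 0 then of 0 * of 1 * (of 0)⁻¹ else of k

lemma iota_zero : iota m (of 0) = of 0 * of 1 * (of 0)⁻¹ := by simp [iota]

lemma iota_of {k : Fin (m + 2)} (hk : k ≠ 0) : iota m (of k) = of k := by simp [iota, hk]

lemma iota_one : iota m (of 1) = of 1 := iota_of (by simp)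

/-- The isomorphism from `⟨b⟩` to `⟨a⟩`. -/
def zpowersEquiv (m : ℕ) : Subgroup.zpowers (of 1 : F m) ≃*
    (Subgroup.zpowers (of 1 : F m)).map
      (freeGroupCongr (Equiv.swap (0 : Fin (m + 2)) 1) : F m →* F m) :=
  MulEquiv.subgroupMap (freeGroupCongr (Equiv.swap (0 : Fin (m + 2)) 1)) _

lemma map_zpowers_of_one : (Subgroup.zpowers (of 1 : F m)).map
    (freeGroupCongr (Equiv.swap (0 : Fin (m + 2)) 1) : F m →* F m) =
      Subgroup.zpowers (of 0) := by
  rw [MonoidHom.map_zpowers]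
  simp

/-- The free group as an HNN extension whose stable letter is `a`. -/
abbrev Ext (m : ℕ) := HNNExtension (F m) _ _ (zpowersEquiv m)

lemma zpowersEquiv_one : (zpowersEquiv m ⟨of 1, Subgroup.mem_zpowers _⟩ : F m) = of 0 := by
  simp [zpowersEquiv]

lemma t_mul_of_one : (HNNExtension.t : Ext m) * HNNExtension.of (of 1) =
    HNNExtension.of (of 0) * HNNExtension.t := by
  have := HNNExtension.t_mul_of (φ := zpowersEquiv m) ⟨of 1, Subgroup.mem_zpowers _⟩
  rwa [zpowersEquiv_one] at this

lemma zpowersEquiv_zpow (k : ℤ) : (zpowersEquiv m (⟨of 1, Subgroup.mem_zpowers _⟩ ^ k) : F m) =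
    of 0 ^ k := by
  rw [map_zpow, Subgroup.coe_zpow, zpowersEquiv_one]

/-- Homomorphisms out of the HNN extension. -/
lemma exists_hom {H : Type*} [Group H] (f : F m →* H) (x : H) (h : x * f (of 1) = f (of 0) * x) :
    ∃ g : Ext m →* H, (∀ w, g (HNNExtension.of w) = f w) ∧ g HNNExtension.t = x := by
  refine ⟨HNNExtension.lift f x ?_, fun w => HNNExtension.lift_of _ _ _ _,
    HNNExtension.lift_t _ _ _⟩
  rintro ⟨_, k, rfl⟩
  have : (⟨of 1 ^ k, k, rfl⟩ : Subgroup.zpowers (of 1 : F m)) =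
    ⟨of 1, Subgroup.mem_zpowers _⟩ ^ k := Subtype.ext (by simp)
  change x * f (of 1 ^ k) = f (zpowersEquiv m ⟨of 1 ^ k, k, rfl⟩) * x
  rw [this, zpowersEquiv_zpow, map_zpow, map_zpow]
  exact SemiconjBy.zpow_right h k

/-- The homomorphism to the HNN extension sending `a` to the stable letter. -/
def toExt (m : ℕ) : F m →* Ext m :=
  FreeGroup.lift fun k => if k = 0 then HNNExtension.t else HNNExtension.of (of k)

lemma toExt_zero : toExt m (of 0) = HNNExtension.t := by simp [toExt]

lemma toExt_of {k : Fin (m + 2)} (hk : k ≠ 0) : toExt m (of k) = HNNExtension.of (of k) := by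
  simp [toExt, hk]

lemma toExt_iota (w : F m) : toExt m (iota m w) = HNNExtension.of w := by
  suffices (toExt m).comp (iota m) = HNNExtension.of from DFunLike.congr_fun this w
  ext k
  rcases eq_or_ne k 0 with rfl | hk
  · rw [MonoidHom.comp_apply, iota_zero, map_mul, map_mul, map_inv, toExt_zero,
      toExt_of (by simp), t_mul_of_one, mul_inv_cancel_right]
  · rw [MonoidHom.comp_apply, iota_of hk, toExt_of hk]

lemma iota_injective : Function.Injective (iota m) := fun v w h =>
  HNNExtension.of_injective (zpowersEquiv m) (by rw [← toExt_iota, h, toExt_iota])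

variable {ρ : MulAut (F m)}

/-- An element `w` with `ρ w = w * y`, where `y` is fixed by `ρ`, has at most one syllable. -/
lemma eq_iota_of_twist (hρa : ρ (of 0) = of 0 * of 1) (hρ : ∀ i, i ≠ 0 → ρ (of i) = of i)
    {w y : F m} (hw : ρ w = w * iota m y) :
    (∃ h, w = iota m h) ∨
      ∃ (u : ℤˣ) (h g : F m), w = iota m h * of 0 ^ (u : ℤ) * iota m g := by
  obtain ⟨p, hp, hpt⟩ := exists_hom (iota m) (of 0) (by rw [iota_zero, iota_one]; group)
  obtain ⟨σ, hσ, hσt⟩ := exists_hom (m := m) (HNNExtension.of (φ := zpowersEquiv m))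
    (HNNExtension.t * HNNExtension.of (of 1)) (by rw [← mul_assoc, ← t_mul_of_one])
  have hpt' : ∀ v, p (toExt m v) = v := by
    suffices p.comp (toExt m) = MonoidHom.id _ from DFunLike.congr_fun this
    ext k
    rcases eq_or_ne k 0 with rfl | hk
    · rw [MonoidHom.comp_apply, toExt_zero, hpt, MonoidHom.id_apply]
    · rw [MonoidHom.comp_apply, toExt_of hk, hp, iota_of hk, MonoidHom.id_apply]
  have hσρ : ∀ v, σ (toExt m v) = toExt m (ρ v) := by
    suffices σ.comp (toExt m) = (toExt m).comp ρ.toMonoidHom from DFunLike.congr_fun this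
    ext k
    rcases eq_or_ne k 0 with rfl | hk
    · change σ (toExt m (of 0)) = toExt m (ρ (of 0))
      rw [toExt_zero, hσt, hρa, map_mul, toExt_zero, toExt_of (by simp)]
    · change σ (toExt m (of k)) = toExt m (ρ (of k))
      rw [hρ k hk, toExt_of hk, hσ]
  let c : ℤˣ → Fin (m + 2) := fun u => if u = 1 then 1 else 0
  have hc : ∀ u, HNNExtension.toSubgroup (Subgroup.zpowers (of 1 : F m))
      ((Subgroup.zpowers (of 1 : F m)).map
      (freeGroupCongr (Equiv.swap (0 : Fin (m + 2)) 1) : F m →* F m)) u =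
        Subgroup.zpowers (of (c u)) := by
    intro u
    rcases Int.units_eq_one_or u with rfl | rfl
    · rfl
    · exact map_zpowers_of_one
  have hcneg : ∀ u, c u ≠ c (-u) := by
    intro u
    rcases Int.units_eq_one_or u with rfl | rfl <;> simp [c]
  have := eq_of_twist σ hσ (fun u => of (c u) ^ (u : ℤ)) (fun u => ?_) (fun u => ?_)
    (fun u g h => ?_) (fun u g h => ?_) (w := toExt m w) (y := y)
    (by rw [hσρ, hw, map_mul, toExt_iota])
  · rcases this with ⟨h, hh⟩ | ⟨u, h, g, hh⟩
    · exact Or.inl ⟨h, by rw [← hpt' w, hh, hp]⟩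
    · exact Or.inr ⟨u, h, g, by rw [← hpt' w, hh, map_mul, map_mul, map_zpow, hp, hp, hpt]⟩
  · rcases Int.units_eq_one_or u with rfl | rfl
    · simpa [c] using hσt
    · simp only [c, Units.val_neg, Units.val_one, zpow_neg, zpow_one, map_inv, hσt, t_mul_of_one]
      simp
  · rw [hc]
    exact zpow_mem (Subgroup.mem_zpowers _) _
  · rw [hc] at h
    exact hcneg u (eq_and_mem_zpowers_of_conj h).1
  · rw [hc] at h ⊢
    exact (eq_and_mem_zpowers_of_conj h).2

lemma map_iota (hρa : ρ (of 0) = of 0 * of 1) (hρ : ∀ i, i ≠ 0 → ρ (of i) = of i) (w : F m) :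
    ρ (iota m w) = iota m w := by
  suffices ρ.toMonoidHom.comp (iota m) = iota m from DFunLike.congr_fun this w
  ext k
  change ρ (iota m (of k)) = _
  rcases eq_or_ne k 0 with rfl | hk
  · rw [iota_zero, map_mul, map_mul, map_inv, hρa, hρ 1 (by simp)]
    group
  · rw [iota_of hk, hρ k hk]

lemma exists_iota_of_fixed (hρa : ρ (of 0) = of 0 * of 1) (hρ : ∀ i, i ≠ 0 → ρ (of i) = of i)
    {w : F m} (hw : ρ w = w) : ∃ h, w = iota m h := by
  rcases eq_iota_of_twist hρa hρ (y := 1) (by simpa using hw) with h | ⟨u, h, g, rfl⟩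
  · exact h
  · rw [map_mul, map_mul, map_iota hρa hρ, map_iota hρa hρ, map_zpow, hρa, mul_left_inj,
      mul_right_inj] at hw
    rcases Int.units_eq_one_or u with rfl | rfl <;> simp at hw

end Embedding

section Generators

variable {m : ℕ}

lemma two_le_val_iff {k : Fin (m + 2)} : 2 ≤ (k : ℕ) ↔ k ≠ 0 ∧ k ≠ 1 := by
  rw [Ne, Ne, Fin.ext_iff, Fin.ext_iff, Fin.val_zero, Fin.val_one]
  omega

lemma mem_ZSet {i : Fin (m + 2)} (hi : 2 ≤ (i : ℕ)) {z : F m} :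
    z ∈ ZSet m i ↔ ∃ j, j ≠ i ∧ z = iota m (of j) := by
  obtain ⟨hi0, hi1⟩ := two_le_val_iff.1 hi
  constructor
  · rintro ((rfl | rfl) | ⟨j, hj, hji, rfl⟩)
    · exact ⟨0, hi0.symm, iota_zero.symm⟩
    · exact ⟨1, hi1.symm, iota_one.symm⟩
    · exact ⟨j, hji, (iota_of (two_le_val_iff.1 hj).1).symm⟩
  · rintro ⟨j, hji, rfl⟩
    rcases eq_or_ne j 0 with rfl | h0
    · exact Or.inl (Or.inl iota_zero)
    rcases eq_or_ne j 1 with rfl | h1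
    · exact Or.inl (Or.inr iota_one)
    · exact Or.inr ⟨j, two_le_val_iff.2 ⟨h0, h1⟩, hji, iota_of h0⟩

lemma mem_GammaSet {z : F m} : z ∈ GammaSet m ↔ ∃ j, j ≠ 1 ∧ z = iota m (of j) := by
  constructor
  · rintro (rfl | ⟨j, hj, rfl⟩)
    · exact ⟨0, by simp, iota_zero.symm⟩
    · exact ⟨j, (two_le_val_iff.1 hj).2, (iota_of (two_le_val_iff.1 hj).1).symm⟩
  · rintro ⟨j, h1, rfl⟩
    rcases eq_or_ne j 0 with rfl | h0
    · exact Or.inl iota_zero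
    · exact Or.inr ⟨j, two_le_val_iff.2 ⟨h0, h1⟩, iota_of h0⟩

lemma exists_aut {α : Type*} (f g : α → FreeGroup α) (hfg : ∀ k, FreeGroup.lift f (g k) = of k)
    (hgf : ∀ k, FreeGroup.lift g (f k) = of k) :
    ∃ φ : MulAut (FreeGroup α), ∀ k, φ (of k) = f k := by
  refine ⟨MonoidHom.toMulEquiv (FreeGroup.lift f) (FreeGroup.lift g) ?_ ?_, fun k => ?_⟩
  · ext k
    simpa using hgf k
  · ext k
    simpa using hfg k
  · simp

/-- Multiplying a basis element by words in which it does not occur is an automorphism. -/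
lemma exists_aut_mul {α : Type*} [DecidableEq α] (i : α) (y z : FreeGroup α)
    (hy : ∀ χ : FreeGroup α →* FreeGroup α, (∀ k, k ≠ i → χ (of k) = of k) → χ y = y)
    (hz : ∀ χ : FreeGroup α →* FreeGroup α, (∀ k, k ≠ i → χ (of k) = of k) → χ z = z) :
    ∃ φ : MulAut (FreeGroup α), φ (of i) = y * of i * z ∧ ∀ k, k ≠ i → φ (of k) = of k := by
  suffices ∃ φ : MulAut (FreeGroup α), ∀ k, φ (of k) = if k = i then y * of i * z else of k by
    obtain ⟨φ, hφ⟩ := this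
    exact ⟨φ, by simp [hφ], fun k hk => by simp [hφ, hk]⟩
  refine exists_aut _ (fun k => if k = i then y⁻¹ * of i * z⁻¹ else of k) (fun k => ?_)
    (fun k => ?_)
  all_goals
    rcases eq_or_ne k i with rfl | hk
    · rw [if_pos rfl]
      simp only [map_mul, map_inv]
      rw [hy _ fun l hl => by simp [hl], hz _ fun l hl => by simp [hl], lift_apply_of, if_pos rfl]
      group
    · simp [hk]

variable (m) in
/-- The generators of the centralizer of the Nielsen automorphism, apart from that one. -/
def gens : Set (MulAut (F m)) :=
  {φ | IsP φ ∨ IsI φ ∨ IsTransC φ ∨ IsGamma φ ∨ IsAinv φ ∨ IsTheta φ}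

lemma exists_gen_swap {i j : Fin (m + 2)} (hi : 2 ≤ (i : ℕ)) (hj : 2 ≤ (j : ℕ)) (hij : i ≠ j) :
    ∃ φ ∈ gens m, φ (of i) = of j ∧ φ (of j) = of i ∧ ∀ k, k ≠ i → k ≠ j → φ (of k) = of k := by
  have h : ∀ k, freeGroupCongr (Equiv.swap i j) (of k) = of (Equiv.swap i j k) := fun k => by simp
  have h1 := (h i).trans (congrArg of (Equiv.swap_apply_left i j))
  have h2 := (h j).trans (congrArg of (Equiv.swap_apply_right i j))
  have h3 : ∀ k, k ≠ i → k ≠ j → freeGroupCongr (Equiv.swap i j) (of k) = of k :=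
    fun k hki hkj => (h k).trans (congrArg of (Equiv.swap_apply_of_ne_of_ne hki hkj))
  exact ⟨freeGroupCongr (Equiv.swap i j), Or.inl ⟨i, j, hi, hj, hij, h1, h2, h3⟩, h1, h2, h3⟩

lemma exists_gen_inv {i : Fin (m + 2)} (hi : 2 ≤ (i : ℕ)) :
    ∃ φ ∈ gens m, φ (of i) = (of i)⁻¹ ∧ ∀ k, k ≠ i → φ (of k) = of k := by
  have h : ∀ k, FreeGroup.lift (fun k => if k = i then (of i)⁻¹ else of k)
      (if k = i then (of i)⁻¹ else of k) = of k := by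
    intro k
    rcases eq_or_ne k i with rfl | hk
    · simp
    · simp [hk]
  obtain ⟨φ, hφ⟩ := exists_aut _ _ h h
  have h1 : φ (of i) = (of i)⁻¹ := by simp [hφ]
  have h2 : ∀ k, k ≠ i → φ (of k) = of k := fun k hk => by simp [hφ, hk]
  exact ⟨φ, Or.inr (Or.inl ⟨i, hi, h1, h2⟩), h1, h2⟩

lemma iota_eq_of_fix {i j : Fin (m + 2)} (hi : 2 ≤ (i : ℕ)) (hj : j ≠ i) (χ : F m →* F m)
    (hχ : ∀ k, k ≠ i → χ (of k) = of k) : χ (iota m (of j)) = iota m (of j) := by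
  obtain ⟨hi0, hi1⟩ := two_le_val_iff.1 hi
  rcases eq_or_ne j 0 with rfl | h0
  · rw [iota_zero, map_mul, map_mul, map_inv, hχ 0 hi0.symm, hχ 1 hi1.symm]
  · rw [iota_of h0, hχ j hj]

lemma exists_gen_mulRight {i j : Fin (m + 2)} (hi : 2 ≤ (i : ℕ)) (hj : j ≠ i) :
    ∃ φ ∈ gens m, φ (of i) = of i * iota m (of j) ∧ ∀ k, k ≠ i → φ (of k) = of k := by
  obtain ⟨φ, h1, h2⟩ := exists_aut_mul i 1 (iota m (of j)) (fun χ _ => map_one χ)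
    (iota_eq_of_fix hi hj)
  rw [one_mul] at h1
  exact ⟨φ, Or.inr (Or.inr (Or.inl
    ⟨i, hi, _, (mem_ZSet hi).2 ⟨j, hj, rfl⟩, Or.inl h1, h2⟩)), h1, h2⟩

lemma exists_gen_mulLeft {i j : Fin (m + 2)} (hi : 2 ≤ (i : ℕ)) (hj : j ≠ i) :
    ∃ φ ∈ gens m, φ (of i) = (iota m (of j))⁻¹ * of i ∧ ∀ k, k ≠ i → φ (of k) = of k := by
  obtain ⟨φ, h1, h2⟩ := exists_aut_mul i (iota m (of j))⁻¹ 1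
    (fun χ hχ => by rw [map_inv, iota_eq_of_fix hi hj χ hχ]) (fun χ _ => map_one χ)
  rw [mul_one] at h1
  exact ⟨φ, Or.inr (Or.inr (Or.inl
    ⟨i, hi, _, (mem_ZSet hi).2 ⟨j, hj, rfl⟩, Or.inr h1, h2⟩)), h1, h2⟩

lemma exists_gen_ainv {j : Fin (m + 2)} (hj : j ≠ 0) :
    ∃ φ ∈ gens m, φ (of 0) = (of j)⁻¹ * of 0 ∧ ∀ k, k ≠ 0 → φ (of k) = of k := by
  obtain ⟨φ, h1, h2⟩ := exists_aut_mul 0 (of j)⁻¹ 1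
    (fun χ hχ => by rw [map_inv, hχ j hj]) (fun χ _ => map_one χ)
  rw [mul_one] at h1
  refine ⟨φ, Or.inr (Or.inr (Or.inr (Or.inr (Or.inl ⟨_, ?_, h1, h2⟩)))), h1, h2⟩
  rcases eq_or_ne j 1 with rfl | hj1
  · exact Or.inl rfl
  · exact Or.inr ⟨j, two_le_val_iff.2 ⟨hj, hj1⟩, rfl⟩

lemma exists_gen_gamma {j : Fin (m + 2)} (hj : j ≠ 1) :
    ∃ φ ∈ gens m, φ (of 0) = of 0 * iota m (of j) ∧
      φ (of 1) = (iota m (of j))⁻¹ * of 1 * iota m (of j) ∧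
      ∀ k : Fin (m + 2), 2 ≤ (k : ℕ) → φ (of k) = of k := by
  let f : F m → Fin (m + 2) → F m := fun z k =>
    if k = 0 then of 0 * z else if k = 1 then z⁻¹ * of 1 * z else of k
  have f0 : ∀ z, f z 0 = of 0 * z := fun z => rfl
  have f1 : ∀ z, f z 1 = z⁻¹ * of 1 * z := fun z => by simp [f]
  have f2 : ∀ z (k : Fin (m + 2)), 2 ≤ (k : ℕ) → f z k = of k := fun z k hk => by
    simp [f, two_le_val_iff.1 hk]
  have hfix : ∀ z, FreeGroup.lift (f z) (iota m (of j)) = iota m (of j) := by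
    intro z
    rcases eq_or_ne j 0 with rfl | h0
    · simp only [iota_zero, map_mul, map_inv, lift_apply_of, f0, f1]
      group
    · rw [iota_of h0, lift_apply_of, f2 _ _ (two_le_val_iff.2 ⟨h0, hj⟩)]
  set z := iota m (of j)
  suffices ∃ φ : MulAut (F m), ∀ k, φ (of k) = f z k by
    obtain ⟨φ, hφ⟩ := this
    have h0 := (hφ 0).trans (f0 z)
    have h1 := (hφ 1).trans (f1 z)
    have h2 := fun k hk => (hφ k).trans (f2 z k hk)
    exact ⟨φ, Or.inr (Or.inr (Or.inr (Or.inl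
      ⟨z, mem_GammaSet.2 ⟨j, hj, rfl⟩, h0, h1, h2⟩))), h0, h1, h2⟩
  refine exists_aut (f z) (f z⁻¹) (fun k => ?_) (fun k => ?_)
  all_goals
    rcases eq_or_ne k 0 with rfl | h0
    · simp only [f0, map_mul, map_inv, lift_apply_of, hfix]
      group
    rcases eq_or_ne k 1 with rfl | h1
    · simp only [f1, map_mul, map_inv, lift_apply_of, hfix]
      group
    · have hk := two_le_val_iff.2 ⟨h0, h1⟩
      rw [f2 _ k hk, lift_apply_of, f2 _ k hk]

variable (m) in
lemma exists_gen_theta : ∃ φ ∈ gens m, φ (of 0) = (of 0)⁻¹ := by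
  let f : Fin (m + 2) → F m := fun k =>
    if k = 0 then (of 0)⁻¹ else if k = 1 then of 0 * (of 1)⁻¹ * (of 0)⁻¹ else of k
  have f0 : f 0 = (of 0)⁻¹ := rfl
  have f1 : f 1 = of 0 * (of 1)⁻¹ * (of 0)⁻¹ := by simp [f]
  have f2 : ∀ k : Fin (m + 2), 2 ≤ (k : ℕ) → f k = of k := fun k hk => by
    simp [f, two_le_val_iff.1 hk]
  have h : ∀ k, FreeGroup.lift f (f k) = of k := by
    intro k
    rcases eq_or_ne k 0 with rfl | h0
    · simp only [f0, map_inv, lift_apply_of, inv_inv]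
    rcases eq_or_ne k 1 with rfl | h1
    · simp only [f0, f1, map_mul, map_inv, lift_apply_of]
      group
    · have hk := two_le_val_iff.2 ⟨h0, h1⟩
      rw [f2 k hk, lift_apply_of, f2 k hk]
  obtain ⟨φ, hφ⟩ := exists_aut f f h h
  exact ⟨φ, Or.inr (Or.inr (Or.inr (Or.inr (Or.inr
    ⟨hφ 0, (hφ 1).trans f1, fun k hk => (hφ k).trans (f2 k hk)⟩)))), hφ 0⟩

end Generators

section Centralizer

variable {m : ℕ} {ρ : MulAut (F m)}

lemma mul_comm_of_basis (hρa : ρ (of 0) = of 0 * of 1) (hρ : ∀ i, i ≠ 0 → ρ (of i) = of i)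
    {φ : MulAut (F m)} (h0 : ρ (φ (of 0)) = φ (of 0) * φ (of 1))
    (h : ∀ k, k ≠ 0 → ρ (φ (of k)) = φ (of k)) : φ * ρ = ρ * φ := by
  apply MulEquiv.toMonoidHom_injective
  ext k
  change φ (ρ (of k)) = ρ (φ (of k))
  rcases eq_or_ne k 0 with rfl | hk
  · rw [hρa, map_mul, h0]
  · rw [hρ k hk, h k hk]

lemma mul_comm_of_mem_gens (hρa : ρ (of 0) = of 0 * of 1) (hρ : ∀ i, i ≠ 0 → ρ (of i) = of i)
    {φ : MulAut (F m)} (hφ : φ ∈ gens m) : φ * ρ = ρ * φ := by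
  have hρx := map_iota hρa hρ
  have hb := hρ 1 (by simp)
  rcases hφ with ⟨i, j, hi, hj, -, h1, h2, h3⟩ | ⟨i, hi, h1, h2⟩ | ⟨i, hi, z, hz, h1, h2⟩ |
    ⟨z, hz, h0, h1, h2⟩ | ⟨z, hz, h1, h2⟩ | ⟨h0, h1, h2⟩
  · rw [two_le_val_iff] at hi hj
    have hk : ∀ k, k ≠ 0 → ρ (φ (of k)) = φ (of k) := by
      intro k hk
      rcases eq_or_ne k i with rfl | hki
      · rw [h1, hρ j hj.1]
      rcases eq_or_ne k j with rfl | hkj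
      · rw [h2, hρ i hi.1]
      · rw [h3 k hki hkj, hρ k hk]
    refine mul_comm_of_basis hρa hρ ?_ hk
    rw [h3 0 hi.1.symm hj.1.symm, h3 1 hi.2.symm hj.2.symm, hρa]
  · rw [two_le_val_iff] at hi
    refine mul_comm_of_basis hρa hρ ?_ fun k hk => ?_
    · rw [h2 0 hi.1.symm, h2 1 hi.2.symm, hρa]
    · rcases eq_or_ne k i with rfl | hki
      · rw [h1, map_inv, hρ k hk]
      · rw [h2 k hki, hρ k hk]
  · obtain ⟨j, -, rfl⟩ := (mem_ZSet hi).1 hz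
    rw [two_le_val_iff] at hi
    refine mul_comm_of_basis hρa hρ ?_ fun k hk => ?_
    · rw [h2 0 hi.1.symm, h2 1 hi.2.symm, hρa]
    · rcases eq_or_ne k i with rfl | hki
      · rcases h1 with h1 | h1 <;> simp only [h1, map_mul, map_inv, hρx, hρ k hk]
      · rw [h2 k hki, hρ k hk]
  · obtain ⟨j, -, rfl⟩ := mem_GammaSet.1 hz
    refine mul_comm_of_basis hρa hρ ?_ fun k hk => ?_
    · rw [h0, h1, map_mul, hρa, hρx]
      group
    · rcases eq_or_ne k 1 with rfl | hk1
      · simp only [h1, map_mul, map_inv, hρx, hb]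
      · rw [h2 k (two_le_val_iff.2 ⟨hk, hk1⟩), hρ k hk]
  · have hz : ρ z = z := by
      rcases hz with rfl | ⟨j, hj, rfl⟩
      · exact hb
      · exact hρ j (two_le_val_iff.1 hj).1
    refine mul_comm_of_basis hρa hρ ?_ fun k hk => ?_
    · rw [h1, h2 1 (by simp), map_mul, map_inv, hz, hρa, mul_assoc]
    · rw [h2 k hk, hρ k hk]
  · refine mul_comm_of_basis hρa hρ ?_ fun k hk => ?_
    · rw [h0, h1, map_inv, hρa]
      group
    · rcases eq_or_ne k 1 with rfl | hk1
      · rw [h1]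
        simp only [map_mul, map_inv, hρa, hb]
        group
      · rw [h2 k (two_le_val_iff.2 ⟨hk, hk1⟩), hρ k hk]

/-- An automorphism commuting with `ρ` induces an automorphism of the fixed subgroup of `ρ`. -/
lemma exists_restrict (hρa : ρ (of 0) = of 0 * of 1) (hρ : ∀ i, i ≠ 0 → ρ (of i) = of i)
    {φ : MulAut (F m)} (hφ : φ * ρ = ρ * φ) :
    ∃ ψ : MulAut (F m), ∀ w, φ (iota m w) = iota m (ψ w) := by
  have key : ∀ φ : MulAut (F m), φ * ρ = ρ * φ → ∀ w, ∃ v, φ (iota m w) = iota m v :=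
    fun φ hφ w => exists_iota_of_fixed hρa hρ (by
      rw [← MulAut.mul_apply, ← hφ, MulAut.mul_apply, map_iota hρa hρ])
  choose f hf using key φ hφ
  choose g hg using key φ⁻¹ (Commute.inv_left hφ)
  refine ⟨{ toFun := f, invFun := g, left_inv := fun w => ?_, right_inv := fun w => ?_,
            map_mul' := fun v w => ?_ }, hf⟩
  · apply iota_injective
    rw [← hg, ← hf, MulAut.inv_apply_self]
  · apply iota_injective
    rw [← hf, ← hg, MulAut.apply_inv_self]
  · apply iota_injective
    rw [map_mul, ← hf, ← hf, ← hf, map_mul, map_mul]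

/-- The automorphisms of the fixed subgroup of `ρ` induced by the elements of `C`. -/
def induced (C : Subgroup (MulAut (F m))) : Subgroup (MulAut (F m)) where
  carrier := {ψ | ∃ φ ∈ C, ∀ w, φ (iota m w) = iota m (ψ w)}
  one_mem' := ⟨1, C.one_mem, fun _ => rfl⟩
  mul_mem' := by
    rintro ψ ψ' ⟨φ, hφ, h⟩ ⟨φ', hφ', h'⟩
    exact ⟨φ * φ', C.mul_mem hφ hφ', fun w => by simp only [MulAut.mul_apply, h', h]⟩
  inv_mem' := by
    rintro ψ ⟨φ, hφ, h⟩
    refine ⟨φ⁻¹, C.inv_mem hφ, fun w => ?_⟩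
    conv_lhs => rw [← MulAut.apply_inv_self _ ψ w]
    rw [← h, MulAut.inv_apply_self]

lemma hasMoves_induced (hρa : ρ (of 0) = of 0 * of 1) (hρ : ∀ i, i ≠ 0 → ρ (of i) = of i)
    {C : Subgroup (MulAut (F m))} (hC : gens m ⊆ C) : HasMoves {0, 1} (induced C) := by
  have key : ∀ φ ∈ gens m, ∃ ψ ∈ induced C, ∀ k v, φ (iota m (of k)) = iota m v →
      ψ (of k) = v := by
    intro φ hφ
    obtain ⟨ψ, hψ⟩ := exists_restrict hρa hρ (mul_comm_of_mem_gens hρa hρ hφ)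
    exact ⟨ψ, ⟨φ, hC hφ, hψ⟩, fun k v h => iota_injective ((hψ _).symm.trans h)⟩
  have hS : ∀ i : Fin (m + 2), i ∉ ({0, 1} : Set (Fin (m + 2))) ↔ 2 ≤ (i : ℕ) := fun i => by
    simp [two_le_val_iff]
  have single : ∀ i : Fin (m + 2), 2 ≤ (i : ℕ) → ∀ φ ∈ gens m, (∀ k, k ≠ i → φ (of k) = of k) →
      ∀ v, φ (of i) = iota m v →
      ∃ ψ ∈ induced C, ψ (of i) = v ∧ ∀ k, k ≠ i → ψ (of k) = of k := by
    intro i hi φ hφ h v hv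
    obtain ⟨ψ, hψ, h'⟩ := key φ hφ
    exact ⟨ψ, hψ, h' i v (by rw [iota_of (two_le_val_iff.1 hi).1, hv]),
      fun k hk => h' k _ (iota_eq_of_fix hi hk φ.toMonoidHom h)⟩
  refine ⟨?_, ?_, ?_, ?_, ?_⟩
  · intro i hi j hj hij
    rw [hS] at hi hj
    obtain ⟨φ, hφ, h1, h2, h3⟩ := exists_gen_swap hi hj hij
    obtain ⟨ψ, hψ, h⟩ := key φ hφ
    rw [two_le_val_iff] at hi hj
    refine ⟨ψ, hψ, h i _ ?_, h j _ ?_, fun k hki hkj => h k _ ?_⟩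
    · rw [iota_of hi.1, iota_of hj.1, h1]
    · rw [iota_of hi.1, iota_of hj.1, h2]
    · rcases eq_or_ne k 0 with rfl | hk
      · rw [iota_zero, map_mul, map_mul, map_inv, h3 0 hki hkj, h3 1 hi.2.symm hj.2.symm]
      · rw [iota_of hk, h3 k hki hkj]
  · intro i hi
    rw [hS] at hi
    obtain ⟨φ, hφ, h1, h2⟩ := exists_gen_inv hi
    exact single i hi φ hφ h2 _ (by rw [h1, map_inv, iota_of (two_le_val_iff.1 hi).1])
  · intro i hi j hj
    rw [hS] at hi
    obtain ⟨φ, hφ, h1, h2⟩ := exists_gen_mulRight hi hj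
    exact single i hi φ hφ h2 _ (by rw [h1, map_mul, iota_of (two_le_val_iff.1 hi).1])
  · intro i hi j hj
    rw [hS] at hi
    obtain ⟨φ, hφ, h1, h2⟩ := exists_gen_mulLeft hi hj
    exact single i hi φ hφ h2 _ (by rw [h1, map_mul, map_inv, iota_of (two_le_val_iff.1 hi).1])
  · rintro i (rfl | rfl) j hj
    · obtain ⟨φ, hφ, h1, h2⟩ := exists_gen_ainv hj
      obtain ⟨ψ, hψ, h⟩ := key φ hφ
      refine ⟨ψ, hψ, h 0 _ ?_, fun k hk => h k _ ?_⟩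
      · simp only [map_mul, map_inv, iota_zero, iota_of hj, h1,
          h2 1 (by simp : (1 : Fin (m + 2)) ≠ 0)]
        group
      · rw [iota_of hk, h2 k hk]
    · obtain ⟨φ, hφ, h0, h1, h2⟩ := exists_gen_gamma hj
      obtain ⟨ψ, hψ, h⟩ := key φ hφ
      refine ⟨ψ, hψ, h 1 _ ?_, fun k hk => h k _ ?_⟩
      · rw [map_mul, map_mul, map_inv, iota_one, h1]
      · rcases eq_or_ne k 0 with rfl | hk0
        · rw [iota_zero, map_mul, map_mul, map_inv, h0, h1]
          group
        · rw [iota_of hk0, h2 k (two_le_val_iff.2 ⟨hk0, hk⟩)]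

lemma zpow_apply (hρa : ρ (of 0) = of 0 * of 1) (hρ : ∀ i, i ≠ 0 → ρ (of i) = of i) (k : ℤ) :
    (ρ ^ k) (of 0) = of 0 * of 1 ^ k ∧ ∀ i, i ≠ 0 → (ρ ^ k) (of i) = of i := by
  have hfix : ∀ i, i ≠ 0 → (ρ ^ k) (of i) = of i := fun i hi =>
    zpow_mem (show ρ ∈ MulAction.stabilizer (MulAut (F m)) (of i) from hρ i hi) k
  have hfix' : ∀ k : ℤ, (ρ ^ k) (of 1) = of 1 := fun k =>
    zpow_mem (show ρ ∈ MulAction.stabilizer (MulAut (F m)) (of 1 : F m) from hρ 1 (by simp)) k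
  refine ⟨?_, hfix⟩
  clear hfix
  induction k with
  | zero => simp
  | succ k ih =>
    rw [zpow_add_one, MulAut.mul_apply, hρa, map_mul, ih, hfix', zpow_add_one, mul_assoc]
  | pred k ih =>
    have : ρ⁻¹ (of 0) = of 0 * (of 1)⁻¹ := by
      rw [MulAut.inv_apply, MulEquiv.symm_apply_eq, map_mul, map_inv, hρa, hρ 1 (by simp)]
      group
    rw [zpow_sub_one, MulAut.mul_apply, this, map_mul, map_inv, ih, hfix', zpow_sub_one, mul_assoc]

lemma mem_of_apply_zero (hρa : ρ (of 0) = of 0 * of 1) (hρ : ∀ i, i ≠ 0 → ρ (of i) = of i)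
    {C : Subgroup (MulAut (F m))} (hC : gens m ⊆ C) (hρC : ρ ∈ C)
    {φ : MulAut (F m)} (hφ : φ * ρ = ρ * φ) {h g : F m}
    (hw : φ (of 0) = iota m h * of 0 * iota m g) : φ ∈ C := by
  obtain ⟨ψ, hψ⟩ := exists_restrict hρa hρ hφ
  have hb : φ (of 1) = (iota m g)⁻¹ * of 1 * iota m g := by
    have h1 : φ (ρ (of 0)) = ρ (φ (of 0)) := DFunLike.congr_fun hφ _
    rw [hρa, map_mul, hw, map_mul, map_mul, map_iota hρa hρ, map_iota hρa hρ, hρa] at h1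
    rw [← mul_right_inj (iota m h * of 0 * iota m g), h1]
    group
  obtain ⟨φ', hφ', h'⟩ : ψ ∈ induced C := by
    refine (hasMoves_induced hρa hρ hC).mem_of_conj ψ ?_
    rintro i (rfl | rfl)
    · refine ⟨h⁻¹, iota_injective ?_⟩
      rw [← hψ, iota_zero, map_mul, map_mul, map_inv, hw, hb, map_mul, map_mul, map_inv,
        map_inv, iota_zero]
      group
    · refine ⟨g, iota_injective ?_⟩
      rw [← hψ, iota_one, hb, map_mul, map_mul, map_inv, iota_one]
  refine (C.mul_mem_cancel_left (C.inv_mem hφ')).1 (?_ : φ'⁻¹ * φ ∈ C)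
  have hfix : ∀ w, (φ'⁻¹ * φ) (iota m w) = iota m w := fun w => by
    rw [MulAut.mul_apply, hψ, ← h', MulAut.inv_apply_self]
  set χ := φ'⁻¹ * φ
  have hχ : ∀ i, i ≠ 0 → χ (of i) = of i := fun i hi => by
    rw [← iota_of hi, hfix]
  obtain ⟨k, hk⟩ := mem_zpowers_of_commute (a := (1 : Fin (m + 2))) (g := (of 0)⁻¹ * χ (of 0)) (by
    have h1 := hfix (of 0)
    rw [iota_zero, map_mul, map_mul, map_inv, hχ 1 (by simp), mul_inv_eq_iff_eq_mul] at h1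
    rw [mul_assoc, h1]
    group)
  have : χ = ρ ^ k := by
    obtain ⟨h1, h2⟩ := zpow_apply hρa hρ k
    apply MulEquiv.toMonoidHom_injective
    ext i
    change χ (of i) = (ρ ^ k) (of i)
    rcases eq_or_ne i 0 with rfl | hi
    · exact h1.symm ▸ (inv_mul_eq_iff_eq_mul.1 hk.symm)
    · rw [hχ i hi, h2 i hi]
  exact this ▸ C.zpow_mem hρC k

lemma mem_of_mul_comm (hρa : ρ (of 0) = of 0 * of 1) (hρ : ∀ i, i ≠ 0 → ρ (of i) = of i)
    {C : Subgroup (MulAut (F m))} (hC : gens m ⊆ C) (hρC : ρ ∈ C)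
    {φ : MulAut (F m)} (hφ : φ * ρ = ρ * φ) : φ ∈ C := by
  obtain ⟨ψ, hψ⟩ := exists_restrict hρa hρ hφ
  have hw : ρ (φ (of 0)) = φ (of 0) * iota m (ψ (of 1)) := by
    rw [← MulAut.mul_apply, ← hφ, MulAut.mul_apply, hρa, map_mul, ← hψ, iota_one]
  rcases eq_iota_of_twist hρa hρ hw with ⟨h, hh⟩ | ⟨u, h, g, hh⟩
  · rw [hh, map_iota hρa hρ, eq_comm, mul_eq_left, ← hψ, iota_one] at hw
    exact absurd ((map_eq_one_iff φ φ.injective).1 hw) (of_ne_one _)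
  rcases Int.units_eq_one_or u with rfl | rfl
  · exact mem_of_apply_zero hρa hρ hC hρC hφ (by simpa using hh)
  · obtain ⟨θ, hθ, h0⟩ := exists_gen_theta m
    refine (C.mul_mem_cancel_right (hC hθ)).1 (mem_of_apply_zero hρa hρ hC hρC
      (Commute.mul_left hφ (mul_comm_of_mem_gens hρa hρ hθ)) (h := g⁻¹) (g := h⁻¹) ?_)
    rw [MulAut.mul_apply, h0, map_inv, hh, map_inv, map_inv]
    simp [mul_assoc]

end Centralizer

end NielsenCentralizer

/-- each of the automorphisms `P_{i,j}`, `I_i`, `(cᵢ^{±1}; z)`, `γ_z`,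
`(a⁻¹; z)`, `θ` commutes with the Nielsen automorphism `ρ : a ↦ ab, b ↦ b, cᵢ ↦ cᵢ`,
and the centralizer of `ρ` in `Aut(F_n)` is generated by all of these automorphisms
together with `ρ` itself. -/
theorem nielsen_centralizer_generators
    (m : ℕ) (ρ : MulAut (F m))
    (hρa : ρ (FreeGroup.of 0) = FreeGroup.of 0 * FreeGroup.of 1)
    (hρ : ∀ i : Fin (m + 2), i ≠ 0 → ρ (FreeGroup.of i) = FreeGroup.of i) :
    (∀ φ : MulAut (F m),
        (IsP φ ∨ IsI φ ∨ IsTransC φ ∨ IsGamma φ ∨ IsAinv φ ∨ IsTheta φ) →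
        φ * ρ = ρ * φ) ∧
    Subgroup.closure
        ({φ | IsP φ ∨ IsI φ ∨ IsTransC φ ∨ IsGamma φ ∨ IsAinv φ ∨ IsTheta φ} ∪ {ρ})
      = Subgroup.centralizer {ρ} := by
  refine ⟨fun φ hφ => NielsenCentralizer.mul_comm_of_mem_gens hρa hρ hφ, le_antisymm ?_ ?_⟩
  · rw [Subgroup.closure_le]
    rintro φ (hφ | rfl)
    · exact Subgroup.mem_centralizer_singleton_iff.2
        (NielsenCentralizer.mul_comm_of_mem_gens hρa hρ hφ)
    · exact Subgroup.mem_centralizer_singleton_iff.2 rfl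
  · intro φ hφ
    refine NielsenCentralizer.mem_of_mul_comm hρa hρ ?_ ?_
      (Subgroup.mem_centralizer_singleton_iff.1 hφ)
    · exact fun χ hχ => Subgroup.subset_closure (Or.inl hχ)
    · exact Subgroup.subset_closure (Or.inr rfl)
end

section
/- The set C⁰(ρ) = { ψ ∈ C(ρ) : ψ(b) is conjugate to b in F_n } is a subgroup of C(ρ), and it is generated by the automorphisms P_{i,j}, I_i, (c_i^{±1}; z), γ_z, (a⁻¹; z) together with ρ (i.e. by all the listed generators of C(ρ) except θ). -/
namespace FreeGroup

section CommonPrefix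

variable {β : Type*} [DecidableEq β]

/-- The length of the longest common prefix of two lists. -/
def lcpLength : List β → List β → ℕ
  | a :: l, b :: l' => if a = b then lcpLength l l' + 1 else 0
  | _, _ => 0

theorem le_lcpLength_iff {n : ℕ} {l l' : List β} :
    n ≤ lcpLength l l' ↔ n ≤ l.length ∧ n ≤ l'.length ∧ l.take n = l'.take n := by
  induction l generalizing n l' with
  | nil => cases l' <;> simp +contextual [lcpLength]
  | cons a l ih =>
    cases l' with
    | nil => simp +contextual [lcpLength]
    | cons b l' =>
      cases n with
      | zero => simp
      | succ n =>
        by_cases h : a = b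
        · simp [lcpLength, h, ih]
        · simp [lcpLength, h]

end CommonPrefix

section WordVal

variable {α : Type*} [Fintype α]

/-- The value of a word read as a numeral, the first letter being the most significant digit. -/
noncomputable def wordVal (l : List (α × Bool)) : ℕ :=
  Nat.ofDigits (Fintype.card (α × Bool) + 2)
    (l.map fun x => (Fintype.equivFin (α × Bool) x : ℕ)).reverse

theorem wordVal_lt (l : List (α × Bool)) :
    wordVal l < (Fintype.card (α × Bool) + 2) ^ l.length := by
  have := Nat.ofDigits_lt_base_pow_length' (b := Fintype.card (α × Bool))
    (l := (l.map fun x => (Fintype.equivFin (α × Bool) x : ℕ)).reverse) (by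
      simp only [List.mem_reverse, List.mem_map]
      rintro _ ⟨y, -, rfl⟩
      have := (Fintype.equivFin (α × Bool) y).isLt
      omega)
  simpa [wordVal] using this

theorem wordVal_append (p r : List (α × Bool)) :
    wordVal (p ++ r) =
      wordVal r + (Fintype.card (α × Bool) + 2) ^ r.length * wordVal p := by
  simp [wordVal, Nat.ofDigits_append]

theorem wordVal_append_lt {p q r s : List (α × Bool)} (hrs : r.length = s.length)
    (h : wordVal p < wordVal q) : wordVal (p ++ r) < wordVal (q ++ s) := by
  rw [wordVal_append, wordVal_append, hrs]
  have h1 := wordVal_lt r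
  rw [hrs] at h1
  set K := (Fintype.card (α × Bool) + 2) ^ s.length
  have : K * (wordVal p + 1) ≤ K * wordVal q := Nat.mul_le_mul_left _ h
  rw [mul_add, mul_one] at this
  omega

theorem wordVal_injective {p q : List (α × Bool)} (hpq : p.length = q.length)
    (h : wordVal p = wordVal q) : p = q := by
  have := Nat.ofDigits_inj_of_len_eq (b := Fintype.card (α × Bool) + 2) (by omega)
    (L1 := (p.map fun x => (Fintype.equivFin (α × Bool) x : ℕ)).reverse)
    (L2 := (q.map fun x => (Fintype.equivFin (α × Bool) x : ℕ)).reverse) (by simpa using hpq)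
    (by
      simp only [List.mem_reverse, List.mem_map]
      rintro _ ⟨y, -, rfl⟩
      have := (Fintype.equivFin (α × Bool) y).isLt
      omega)
    (by
      simp only [List.mem_reverse, List.mem_map]
      rintro _ ⟨y, -, rfl⟩
      have := (Fintype.equivFin (α × Bool) y).isLt
      omega) h
  refine List.map_injective_iff.2 ?_ (List.reverse_injective this)
  exact fun a b hab => (Fintype.equivFin (α × Bool)).injective (Fin.ext hab)

end WordVal

theorem mk_letter_inv {α : Type*} (ℓ : α × Bool) : mk [(ℓ.1, !ℓ.2)] = (mk [ℓ])⁻¹ := by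
  rw [inv_mk]; rfl

theorem mk_false_letter {α : Type*} (x : α) : mk [(x, false)] = (of x)⁻¹ :=
  mk_letter_inv (x, true)

variable {α : Type*} [DecidableEq α]

theorem IsReduced.invRev_append {a : List (α × Bool)} {b : List (α × Bool)}
    (ha : IsReduced a) (hb : IsReduced b)
    (h : ∀ x ∈ a.head?, ∀ y ∈ b.head?, x ≠ y) : IsReduced (invRev a ++ b) := by
  have ha' : IsReduced (invRev a) := by
    rw [isReduced_iff_reduce_eq, reduce_invRev, ha.reduce_eq]
  refine List.isChain_append.2 ⟨ha', hb, fun x hx y hy hxy => ?_⟩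
  simp only [invRev, List.getLast?_reverse, List.head?_map, Option.mem_def,
    Option.map_eq_some_iff] at hx
  obtain ⟨z, hz, rfl⟩ := hx
  have := h z hz y hy
  obtain ⟨z1, z2⟩ := z
  obtain ⟨y1, y2⟩ := y
  simp only at hxy
  subst hxy
  cases z2 <;> cases y2 <;> simp_all

theorem reduce_invRev_append {a b : List (α × Bool)} (ha : IsReduced a) (hb : IsReduced b) :
    reduce (invRev a ++ b) =
      invRev (a.drop (lcpLength a b)) ++ b.drop (lcpLength a b) := by
  induction a generalizing b with
  | nil => simpa [lcpLength] using hb.reduce_eq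
  | cons x a ih =>
    cases b with
    | nil => simpa [lcpLength, reduce_invRev] using congrArg invRev ha.reduce_eq
    | cons y b =>
      by_cases h : x = y
      · subst h
        have := ih (b := b) (ha.infix ⟨[x], [], by simp⟩) (hb.infix ⟨[x], [], by simp⟩)
        simp only [lcpLength, if_true, List.drop_succ_cons]
        rw [← this]
        apply reduce.sound
        rw [← mul_mk, ← mul_mk, ← inv_mk, ← inv_mk, ← List.singleton_append (l := a),
          ← List.singleton_append (l := b), ← mul_mk, ← mul_mk]
        group
      · simp only [lcpLength, if_neg h, List.drop_zero]
        exact (ha.invRev_append hb (by simpa using h)).reduce_eq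

/-- The Gromov product of two elements of a free group, based at `1`. -/
def gromov (x y : FreeGroup α) : ℕ := lcpLength x.toWord y.toWord

theorem le_gromov_iff {n : ℕ} {x y : FreeGroup α} :
    n ≤ gromov x y ↔ n ≤ x.norm ∧ n ≤ y.norm ∧ x.toWord.take n = y.toWord.take n :=
  le_lcpLength_iff

theorem toWord_inv_mul (x y : FreeGroup α) :
    (x⁻¹ * y).toWord = invRev (x.toWord.drop (gromov x y)) ++ y.toWord.drop (gromov x y) := by
  rw [toWord_mul, toWord_inv, reduce_invRev_append isReduced_toWord isReduced_toWord]
  rfl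

theorem gromov_le_left (x y : FreeGroup α) : gromov x y ≤ x.norm :=
  (le_gromov_iff.1 le_rfl).1

theorem gromov_le_right (x y : FreeGroup α) : gromov x y ≤ y.norm :=
  (le_gromov_iff.1 le_rfl).2.1

theorem gromov_comm (x y : FreeGroup α) : gromov x y = gromov y x :=
  le_antisymm
    (le_gromov_iff.2 ⟨gromov_le_right x y, gromov_le_left x y, (le_gromov_iff.1 le_rfl).2.2.symm⟩)
    (le_gromov_iff.2 ⟨gromov_le_right y x, gromov_le_left y x, (le_gromov_iff.1 le_rfl).2.2.symm⟩)

theorem min_gromov_le (x y z : FreeGroup α) :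
    min (gromov x y) (gromov y z) ≤ gromov x z := by
  obtain ⟨h1, -, h3⟩ := le_gromov_iff.1 (min_le_left (gromov x y) (gromov y z))
  obtain ⟨-, h5, h6⟩ := le_gromov_iff.1 (min_le_right (gromov x y) (gromov y z))
  exact le_gromov_iff.2 ⟨h1, h5, h3.trans h6⟩

theorem norm_inv_mul_add (x y : FreeGroup α) :
    (x⁻¹ * y).norm + 2 * gromov x y = x.norm + y.norm := by
  have h := congrArg List.length (toWord_inv_mul x y)
  have h1 := gromov_le_left x y
  have h2 := gromov_le_right x y
  simp only [norm, List.length_append, invRev_length, List.length_drop] at *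
  omega

theorem norm_mul_add (x y : FreeGroup α) :
    (x * y).norm + 2 * gromov x⁻¹ y = x.norm + y.norm := by
  simpa [norm_inv_eq] using norm_inv_mul_add x⁻¹ y

/-- A nontrivial element cancels less than half of itself when it is squared. -/
theorem two_mul_gromov_inv_self_lt {v : FreeGroup α} (hv : v ≠ 1) :
    2 * gromov v⁻¹ v < v.norm := by
  by_contra! h
  have hred : IsReduced v.toWord := isReduced_toWord
  obtain ⟨-, -, h3⟩ := le_gromov_iff.1 (le_refl (gromov v⁻¹ v))
  set k := gromov v⁻¹ v
  have hpos : 0 < v.norm := Nat.pos_of_ne_zero (by simpa [norm_eq_zero] using hv)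
  rw [toWord_inv] at h3
  unfold norm at h hpos
  generalize v.toWord = w at *
  have key : ∀ i, i < k → (hi : i < w.length) →
      w[i] = ((w[w.length - 1 - i]).1, !(w[w.length - 1 - i]).2) := by
    intro i hik hi
    have := congrArg (fun l => l[i]?) h3
    simp only [List.getElem?_take, hik, if_true] at this
    rw [List.getElem?_eq_getElem hi, List.getElem?_eq_getElem (by simpa using hi)] at this
    simpa [invRev] using (Option.some.inj this).symm
  rcases Nat.even_or_odd' w.length with ⟨t, ht | ht⟩
  · have h1 := key (t - 1) (by omega) (by omega)
    have h2 := (List.isChain_iff_getElem.1 hred) (t - 1) (by omega)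
    have e1 : w.length - 1 - (t - 1) = t - 1 + 1 := by omega
    simp only [e1] at h1
    rw [h1] at h2
    simp at h2
  · have h1 := key t (by omega) (by omega)
    have e1 : w.length - 1 - t = t := by omega
    simp only [e1] at h1
    simpa using congrArg Prod.snd h1


section Weight

variable [Fintype α]

/-- The tie-breaking weight of an element: the sum of the values of the initial halves of the
element and of its inverse. -/
noncomputable def halfWeight (g : FreeGroup α) : ℕ :=
  wordVal (g.toWord.take (g.norm / 2)) + wordVal (g⁻¹.toWord.take (g.norm / 2))

theorem halfWeight_inv (g : FreeGroup α) : halfWeight g⁻¹ = halfWeight g := by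
  simp [halfWeight, norm_inv_eq, add_comm]

end Weight

section Conj

theorem conj_eq_mk (k : FreeGroup α) (ℓ : α × Bool) :
    k * mk [ℓ] * k⁻¹ = mk (k.toWord ++ ℓ :: invRev k.toWord) := by
  have : mk (k.toWord ++ ([ℓ] ++ invRev k.toWord)) = k * (mk [ℓ] * k⁻¹) := by
    rw [← mul_mk, ← mul_mk, ← inv_mk, mk_toWord]
  rw [mul_assoc, ← this, List.singleton_append]

theorem toWord_of_isConj {ℓ : α × Bool} {g : FreeGroup α} (hg : IsConj (mk [ℓ]) g) :
    ∃ h : FreeGroup α, g = h * mk [ℓ] * h⁻¹ ∧ g.toWord = h.toWord ++ ℓ :: invRev h.toWord := by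
  classical
  have hex : ∃ n, ∃ h : FreeGroup α, h.norm = n ∧ g = h * mk [ℓ] * h⁻¹ := by
    obtain ⟨h, rfl⟩ := isConj_iff.1 hg
    exact ⟨_, h, rfl, rfl⟩
  obtain ⟨h, hn, hh⟩ := Nat.find_spec hex
  have hlast : ∀ z ∈ h.toWord.getLast?, z.1 ≠ ℓ.1 := by
    intro z hz hzℓ
    obtain ⟨l, hl⟩ := List.getLast?_eq_some_iff.1 hz
    have hcomm : mk [z] * mk [ℓ] * (mk [z])⁻¹ = mk [ℓ] := by
      by_cases h2 : z = ℓ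
      · subst h2; group
      · have : z = (ℓ.1, !ℓ.2) := by
          obtain ⟨z1, z2⟩ := z
          obtain ⟨l1, l2⟩ := ℓ
          simp only at hzℓ
          subst hzℓ
          cases z2 <;> cases l2 <;> simp_all
        have : mk [z] = (mk [ℓ])⁻¹ := by rw [this, inv_mk]; rfl
        rw [this]; group
    have hhl : h = mk l * mk [z] := by rw [mul_mk, ← hl, mk_toWord]
    have hlt : (mk l).norm < Nat.find hex := by
      rw [← hn]
      refine norm_mk_le.trans_lt ?_
      simp [norm, hl]
    refine Nat.find_min hex hlt ⟨mk l, rfl, ?_⟩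
    calc g = mk l * (mk [z] * mk [ℓ] * (mk [z])⁻¹) * (mk l)⁻¹ := by rw [hh, hhl]; group
      _ = mk l * mk [ℓ] * (mk l)⁻¹ := by rw [hcomm]
  refine ⟨h, hh, ?_⟩
  have hred : IsReduced (h.toWord ++ ℓ :: invRev h.toWord) := by
    have h1 : IsReduced h.toWord := isReduced_toWord
    have h2 : IsReduced (invRev h.toWord) := by
      rw [← toWord_inv]; exact isReduced_toWord
    refine List.isChain_append.2 ⟨h1, List.isChain_cons.2 ⟨fun y hy hy' => ?_, h2⟩, ?_⟩
    · simp only [invRev, List.head?_reverse, List.getLast?_map, Option.mem_def,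
        Option.map_eq_some_iff] at hy
      obtain ⟨z, hz, rfl⟩ := hy
      exact absurd hy'.symm (hlast z hz)
    · intro x hx y hy hxy
      simp only [List.head?_cons, Option.mem_def, Option.some.injEq] at hy
      subst hy
      exact absurd hxy (hlast x hx)
  rw [hh, conj_eq_mk, toWord_mk, hred.reduce_eq]

theorem conj_toWord_sublist (k : FreeGroup α) (ℓ : α × Bool) :
    (k * mk [ℓ] * k⁻¹).toWord.Sublist (k.toWord ++ ℓ :: invRev k.toWord) := by
  rw [conj_eq_mk, toWord_mk]
  exact reduce.red.sublist

theorem norm_conj_le (k : FreeGroup α) (ℓ : α × Bool) :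
    (k * mk [ℓ] * k⁻¹).norm ≤ 2 * k.norm + 1 := by
  have := (conj_toWord_sublist k ℓ).length_le
  simp only [List.length_append, List.length_cons, invRev_length] at this
  unfold norm
  omega

theorem toWord_conj_of_norm_eq {k : FreeGroup α} {ℓ : α × Bool}
    (h : (k * mk [ℓ] * k⁻¹).norm = 2 * k.norm + 1) :
    (k * mk [ℓ] * k⁻¹).toWord = k.toWord ++ ℓ :: invRev k.toWord := by
  refine (conj_toWord_sublist k ℓ).eq_of_length ?_
  simp only [List.length_append, List.length_cons, invRev_length]
  unfold norm at h
  omega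

end Conj

theorem toWord_mul_eq_take_append_drop (x y : FreeGroup α) :
    (x * y).toWord =
      x.toWord.take (x.norm - gromov x⁻¹ y) ++ y.toWord.drop (gromov x⁻¹ y) := by
  have h := toWord_inv_mul x⁻¹ y
  rw [inv_inv] at h
  rw [h, toWord_inv]
  congr 1
  simp [invRev, List.map_reverse, List.map_take, List.drop_reverse, norm,
    Function.comp_def]

theorem mk_letter_ne_one (ℓ : α × Bool) : mk [ℓ] ≠ 1 := by
  intro h
  have := congrArg toWord h
  rw [toWord_mk, reduce_singleton, toWord_one] at this
  exact List.cons_ne_nil _ _ this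

theorem norm_eq_of_toWord {g h : FreeGroup α} {ℓ : α × Bool}
    (hg : g.toWord = h.toWord ++ ℓ :: invRev h.toWord) : g.norm = 2 * h.norm + 1 := by
  simp only [norm, hg, List.length_append, List.length_cons, invRev_length]
  omega

theorem halfWeight_conj [Fintype α] {g h : FreeGroup α} {ℓ : α × Bool}
    (hg : g.toWord = h.toWord ++ ℓ :: invRev h.toWord) :
    halfWeight g = 2 * wordVal h.toWord := by
  have hn : g.norm / 2 = h.toWord.length := by
    rw [norm_eq_of_toWord hg, norm]
    omega
  have hg' : g⁻¹.toWord = h.toWord ++ (ℓ.1, !ℓ.2) :: invRev h.toWord := by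
    rw [toWord_inv, hg, ← List.singleton_append, invRev_append, invRev_append, invRev_invRev]
    simp [invRev]
  rw [halfWeight, hn, hg, hg', List.take_left', List.take_left', two_mul] <;> rfl

/-- `φ` sends every `x ∈ B` to a conjugate of `x`, and the images of the basis elements cannot be
made shorter, nor lighter at equal length, by multiplying the image of an element outside `B`
(conjugating the image of an element of `B`) by the image of another basis element or its
inverse. -/
structure IsNielsenMinimal [Fintype α] (B : Set α) (φ : MulAut (FreeGroup α)) : Prop where
  of_forall ::
  isConj : ∀ x ∈ B, IsConj (of x) (φ (of x))
  mul_le : ∀ ℓ' ℓ : α × Bool, ℓ'.1 ≠ ℓ.1 → ℓ.1 ∉ B →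
    (φ (mk [ℓ])).norm ≤ (φ (mk [ℓ']) * φ (mk [ℓ])).norm ∧
    ((φ (mk [ℓ']) * φ (mk [ℓ])).norm = (φ (mk [ℓ])).norm →
      halfWeight (φ (mk [ℓ])) ≤ halfWeight (φ (mk [ℓ']) * φ (mk [ℓ])))
  conj_le : ∀ ℓ' ℓ : α × Bool, ℓ'.1 ≠ ℓ.1 → ℓ.1 ∈ B →
    (φ (mk [ℓ])).norm ≤ (φ (mk [ℓ']) * φ (mk [ℓ]) * (φ (mk [ℓ']))⁻¹).norm ∧
    ((φ (mk [ℓ']) * φ (mk [ℓ]) * (φ (mk [ℓ']))⁻¹).norm = (φ (mk [ℓ])).norm →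
      halfWeight (φ (mk [ℓ])) ≤ halfWeight (φ (mk [ℓ']) * φ (mk [ℓ]) * (φ (mk [ℓ']))⁻¹))

theorem exists_toWord_of_isConj {φ : MulAut (FreeGroup α)} {ℓ : α × Bool}
    (h : IsConj (of ℓ.1) (φ (of ℓ.1))) :
    ∃ h : FreeGroup α, φ (mk [ℓ]) = h * mk [ℓ] * h⁻¹ ∧
      (φ (mk [ℓ])).toWord = h.toWord ++ ℓ :: invRev h.toWord := by
  apply toWord_of_isConj
  obtain ⟨x, _ | _⟩ := ℓ
  · obtain ⟨c, hc⟩ := isConj_iff.1 h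
    refine isConj_iff.2 ⟨c, ?_⟩
    have : mk [(x, false)] = (of x)⁻¹ := mk_letter_inv (x, true)
    rw [this, _root_.map_inv, ← hc]
    group
  · exact h

theorem map_letter_ne_one (φ : MulAut (FreeGroup α)) (ℓ : α × Bool) : φ (mk [ℓ]) ≠ 1 := by
  simpa using mk_letter_ne_one ℓ

namespace IsNielsenMinimal

variable [Fintype α] {B : Set α} {φ : MulAut (FreeGroup α)}

theorem two_mul_gromov_le_or (H : IsNielsenMinimal B φ) {ℓ' ℓ : α × Bool} (h : ℓ'.1 ≠ ℓ.1) :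
    2 * gromov (φ (mk [ℓ']))⁻¹ (φ (mk [ℓ])) ≤ (φ (mk [ℓ'])).norm ∨
    ∃ k : FreeGroup α, (φ (mk [ℓ])).toWord = k.toWord ++ ℓ :: invRev k.toWord ∧
      2 * k.norm ≤ (φ (mk [ℓ'])).norm := by
  by_cases hB : ℓ.1 ∈ B
  · obtain ⟨k, hk, hk'⟩ := exists_toWord_of_isConj (H.isConj _ hB)
    by_contra! hcon
    obtain ⟨hcon, hcon'⟩ := hcon
    have hcon' := hcon' k hk'
    have h1 := (H.conj_le _ _ h hB).1
    have h2 := norm_conj_le (φ (mk [ℓ']) * k) ℓ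
    have h3 : φ (mk [ℓ']) * φ (mk [ℓ]) * (φ (mk [ℓ']))⁻¹ =
        φ (mk [ℓ']) * k * mk [ℓ] * (φ (mk [ℓ']) * k)⁻¹ := by rw [hk]; group
    rw [h3] at h1
    have h4 := norm_eq_of_toWord hk'
    have h5 := norm_mul_add (φ (mk [ℓ'])) k
    have h6 : k.norm ≤ gromov (φ (mk [ℓ])) k := by
      refine le_gromov_iff.2 ⟨by omega, le_rfl, ?_⟩
      rw [hk', norm, List.take_left' rfl, List.take_length]
    have h7 := min_gromov_le (φ (mk [ℓ']))⁻¹ (φ (mk [ℓ])) k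
    omega
  · left
    have h1 := (H.mul_le _ _ h hB).1
    have h2 := norm_mul_add (φ (mk [ℓ'])) (φ (mk [ℓ]))
    omega

theorem two_mul_gromov_le_of_ne (H : IsNielsenMinimal B φ) {ℓ' ℓ : α × Bool} (h : ℓ'.1 ≠ ℓ.1) :
    2 * gromov (φ (mk [ℓ']))⁻¹ (φ (mk [ℓ])) ≤ (φ (mk [ℓ'])).norm ∧
    2 * gromov (φ (mk [ℓ']))⁻¹ (φ (mk [ℓ])) ≤ (φ (mk [ℓ])).norm := by
  have h1 := H.two_mul_gromov_le_or h
  have h2 := H.two_mul_gromov_le_or (ℓ' := (ℓ.1, !ℓ.2)) (ℓ := (ℓ'.1, !ℓ'.2)) h.symm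
  simp only [mk_letter_inv, _root_.map_inv, inv_inv, norm_inv_eq] at h2
  rw [gromov_comm] at h2
  rcases h1 with h1 | ⟨k, hk, h1⟩ <;> rcases h2 with h2 | ⟨k', hk', h2⟩
  · exact ⟨h1, h2⟩
  · have e := norm_eq_of_toWord hk'
    rw [norm_inv_eq] at e
    omega
  · have e := norm_eq_of_toWord hk
    omega
  · have e := norm_eq_of_toWord hk
    have e' := norm_eq_of_toWord hk'
    rw [norm_inv_eq] at e'
    by_contra hcon
    have hk1 : k'.toWord.length = k.toWord.length := by
      change k'.norm = k.norm
      omega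
    obtain ⟨-, -, h5⟩ := (le_gromov_iff (n := k.norm + 1) (x := (φ (mk [ℓ']))⁻¹)
      (y := φ (mk [ℓ]))).1 (by omega)
    have h6 := congrArg (fun l => l[k.norm]?) h5
    simp only [hk, hk', norm, List.getElem?_take, Nat.lt_succ_self, if_true,
      List.getElem?_append_right le_rfl, List.getElem?_append_right hk1.le, hk1, Nat.sub_self,
      List.getElem?_cons_zero, Option.some.injEq] at h6
    have h7 := congrArg Prod.fst h6
    exact h h7

theorem two_mul_gromov_le (H : IsNielsenMinimal B φ) {ℓ' ℓ : α × Bool}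
    (h : ℓ'.1 = ℓ.1 → ℓ'.2 = ℓ.2) :
    2 * gromov (φ (mk [ℓ']))⁻¹ (φ (mk [ℓ])) ≤ (φ (mk [ℓ'])).norm ∧
    2 * gromov (φ (mk [ℓ']))⁻¹ (φ (mk [ℓ])) ≤ (φ (mk [ℓ])).norm := by
  by_cases h1 : ℓ'.1 = ℓ.1
  · obtain rfl : ℓ' = ℓ := Prod.ext h1 (h h1)
    have := two_mul_gromov_inv_self_lt (map_letter_ne_one φ ℓ')
    omega
  · exact H.two_mul_gromov_le_of_ne h1

/-- The initial half of an element entirely cancelled from the right is not lighter than the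
prefix cancelled. -/
theorem wordVal_take_le (H : IsNielsenMinimal B φ) {ℓ' ℓ : α × Bool} (h : ℓ'.1 ≠ ℓ.1)
    (hk : (φ (mk [ℓ'])).norm = 2 * gromov (φ (mk [ℓ']))⁻¹ (φ (mk [ℓ]))) :
    wordVal ((φ (mk [ℓ])).toWord.take (gromov (φ (mk [ℓ']))⁻¹ (φ (mk [ℓ])))) ≤
      wordVal ((φ (mk [ℓ'])).toWord.take (gromov (φ (mk [ℓ']))⁻¹ (φ (mk [ℓ])))) := by
  have hle := (H.two_mul_gromov_le_of_ne h).2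
  by_contra! hlt
  by_cases hB : ℓ.1 ∈ B
  · have hmin := H.conj_le _ _ h hB
    obtain ⟨q, hq, hq'⟩ := exists_toWord_of_isConj (H.isConj _ hB)
    have e := norm_eq_of_toWord hq'
    set v := φ (mk [ℓ'])
    set w := φ (mk [ℓ])
    set k := gromov v⁻¹ w
    have h3 : v * w * v⁻¹ = v * q * mk [ℓ] * (v * q)⁻¹ := by rw [hq]; group
    rw [h3] at hmin
    have hwq : w.toWord.take k = q.toWord.take k := by
      rw [hq', List.take_append_of_le_length]
      change k ≤ q.norm
      omega
    have h1 := norm_conj_le (v * q) ℓ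
    have h2 := norm_mul_add v q
    have h4 : k ≤ gromov v⁻¹ q := by
      refine le_gromov_iff.2 ⟨gromov_le_left _ _, by omega, ?_⟩
      rw [← hwq]
      exact (le_gromov_iff.1 le_rfl).2.2
    have h5 : gromov v⁻¹ q = k := by omega
    have h6 := hmin.2 (by omega)
    rw [halfWeight_conj hq', halfWeight_conj (toWord_conj_of_norm_eq (by omega)),
      toWord_mul_eq_take_append_drop, h5, show v.norm - k = k by omega] at h6
    rw [hwq] at hlt
    have h7 := wordVal_append_lt (r := q.toWord.drop k) rfl hlt
    rw [List.take_append_drop] at h7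
    omega
  · have hmin := H.mul_le _ _ h hB
    set v := φ (mk [ℓ'])
    set w := φ (mk [ℓ])
    set k := gromov v⁻¹ w
    have h1 : (v * w).norm + 2 * k = v.norm + w.norm := norm_mul_add v w
    have hvw : (v * w).norm = w.norm := by omega
    have h2 : (v * w).toWord = v.toWord.take k ++ w.toWord.drop k := by
      rw [toWord_mul_eq_take_append_drop]
      congr 2
      change v.norm - k = k
      omega
    have h3 := hmin.2 hvw
    have hlk : (v.toWord.take k).length = k := by
      rw [List.length_take]
      exact min_eq_left (by change k ≤ v.norm; omega)
    have hlk' : (w.toWord.take k).length = k := by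
      rw [List.length_take]
      exact min_eq_left (by change k ≤ w.norm; omega)
    have key : ∀ p : List (α × Bool), p.length = k →
        (p ++ w.toWord.drop k).take (w.norm / 2) =
          p ++ (w.toWord.drop k).take (w.norm / 2 - k) ∧
        (invRev (p ++ w.toWord.drop k)).take (w.norm / 2) =
          (invRev (w.toWord.drop k)).take (w.norm / 2) := by
      intro p hp
      constructor
      · rw [List.take_append, List.take_of_length_le (by omega), hp]
      · rw [invRev_append, List.take_append_of_le_length]
        rw [invRev_length, List.length_drop]
        change w.norm / 2 ≤ w.norm - k
        omega
    have hw := key _ hlk'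
    rw [List.take_append_drop] at hw
    rw [halfWeight, halfWeight, toWord_inv, toWord_inv, hvw, h2, (key _ hlk).1, (key _ hlk).2,
      hw.1, hw.2] at h3
    have h7 := wordVal_append_lt (r := (w.toWord.drop k).take (w.norm / 2 - k)) rfl hlt
    omega

theorem gromov_add_gromov_lt (H : IsNielsenMinimal B φ) {ℓ₁ ℓ₂ ℓ₃ : α × Bool}
    (h₁ : ℓ₁.1 = ℓ₂.1 → ℓ₁.2 = ℓ₂.2) (h₂ : ℓ₂.1 = ℓ₃.1 → ℓ₂.2 = ℓ₃.2) :
    gromov (φ (mk [ℓ₁]))⁻¹ (φ (mk [ℓ₂])) + gromov (φ (mk [ℓ₂]))⁻¹ (φ (mk [ℓ₃])) <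
      (φ (mk [ℓ₂])).norm := by
  have hc₁ := (H.two_mul_gromov_le h₁).2
  have hc₂ := (H.two_mul_gromov_le h₂).1
  have hsq := two_mul_gromov_inv_self_lt (map_letter_ne_one φ ℓ₂)
  by_contra! hcon
  have n₁ : ℓ₂.1 ≠ ℓ₁.1 := by
    intro h
    obtain rfl : ℓ₁ = ℓ₂ := Prod.ext h.symm (h₁ h.symm)
    omega
  have n₂ : ℓ₂.1 ≠ ℓ₃.1 := by
    intro h
    obtain rfl : ℓ₂ = ℓ₃ := Prod.ext h (h₂ h)
    omega
  have w₂ := H.wordVal_take_le n₂ (by omega)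
  have w₁ := H.wordVal_take_le (ℓ' := (ℓ₂.1, !ℓ₂.2)) (ℓ := (ℓ₁.1, !ℓ₁.2)) n₁
  simp only [mk_letter_inv, _root_.map_inv, inv_inv, norm_inv_eq] at w₁
  rw [gromov_comm] at w₁
  replace w₁ := w₁ (by omega)
  set v₁ := φ (mk [ℓ₁])
  set v₂ := φ (mk [ℓ₂])
  set v₃ := φ (mk [ℓ₃])
  have e₁ := (le_gromov_iff.1 (le_refl (gromov v₁⁻¹ v₂))).2.2
  have e₂ := (le_gromov_iff.1 (le_refl (gromov v₂⁻¹ v₃))).2.2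
  have hk : gromov v₁⁻¹ v₂ = gromov v₂⁻¹ v₃ := by omega
  rw [← e₂] at w₂
  rw [e₁, hk] at w₁
  have heq := wordVal_injective (by simp [toWord_inv]) (le_antisymm w₁ w₂)
  have : gromov v₂⁻¹ v₃ ≤ gromov v₂⁻¹ v₂ :=
    le_gromov_iff.2 ⟨by rw [norm_inv_eq]; omega, by omega, heq.symm⟩
  omega

theorem cons_aux (H : IsNielsenMinimal B φ) (ℓ : α × Bool) (L : List (α × Bool))
    (hL : IsReduced (ℓ :: L)) :
    L.length + 1 ≤ (φ (mk (ℓ :: L))).norm ∧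
    ∀ u : α × Bool, (u.1 = ℓ.1 → u.2 = ℓ.2) →
      gromov (φ (mk [u]))⁻¹ (φ (mk (ℓ :: L))) = gromov (φ (mk [u]))⁻¹ (φ (mk [ℓ])) ∧
      L.length + 1 + gromov (φ (mk [u]))⁻¹ (φ (mk [ℓ])) ≤ (φ (mk (ℓ :: L))).norm := by
  induction L generalizing ℓ with
  | nil =>
    have h0 : 0 < (φ (mk [ℓ])).norm :=
      Nat.pos_of_ne_zero (by simpa [norm_eq_zero] using mk_letter_ne_one ℓ)
    refine ⟨by simpa using Nat.succ_le_of_lt h0, fun u hu => ⟨rfl, ?_⟩⟩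
    have := (H.two_mul_gromov_le hu).2
    simp only [List.length_nil]
    omega
  | cons ℓ₂ L ih =>
    obtain ⟨h12, hL'⟩ := isReduced_cons_cons.1 hL
    obtain ⟨-, ih⟩ := ih ℓ₂ hL'
    obtain ⟨ih1, ih2⟩ := ih ℓ h12
    have hmul : φ (mk (ℓ :: ℓ₂ :: L)) = φ (mk [ℓ]) * φ (mk (ℓ₂ :: L)) := by
      rw [← _root_.map_mul, mul_mk, List.singleton_append]
    have h0 : 0 < (φ (mk [ℓ])).norm :=
      Nat.pos_of_ne_zero (by simpa [norm_eq_zero] using mk_letter_ne_one ℓ)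
    rw [hmul]
    have hn := norm_mul_add (φ (mk [ℓ])) (φ (mk (ℓ₂ :: L)))
    have hc := (H.two_mul_gromov_le h12).1
    simp only [List.length_cons]
    refine ⟨by omega, fun u hu => ?_⟩
    have hlt := H.gromov_add_gromov_lt hu h12
    have hg := norm_inv_mul_add (φ (mk [ℓ]) * φ (mk (ℓ₂ :: L))) (φ (mk [ℓ]))
    have hcancel : ((φ (mk [ℓ]) * φ (mk (ℓ₂ :: L)))⁻¹ * φ (mk [ℓ])).norm =
        (φ (mk (ℓ₂ :: L))).norm := by
      rw [mul_inv_rev, inv_mul_cancel_right, norm_inv_eq]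
    have m1 := min_gromov_le (φ (mk [u]))⁻¹ (φ (mk [ℓ])) (φ (mk [ℓ]) * φ (mk (ℓ₂ :: L)))
    have m2 := min_gromov_le (φ (mk [u]))⁻¹ (φ (mk [ℓ]) * φ (mk (ℓ₂ :: L))) (φ (mk [ℓ]))
    rw [gromov_comm (φ (mk [ℓ])) (φ (mk [ℓ]) * φ (mk (ℓ₂ :: L)))] at m1
    constructor <;> omega

theorem norm_le (H : IsNielsenMinimal B φ) (g : FreeGroup α) : g.norm ≤ (φ g).norm := by
  have hg : IsReduced g.toWord := isReduced_toWord
  conv_rhs => rw [← mk_toWord (x := g)]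
  unfold norm
  generalize g.toWord = L at hg
  cases L with
  | nil => simp
  | cons ℓ L => simpa [norm] using (H.cons_aux ℓ L hg).1

end IsNielsenMinimal

section Elementary

theorem exists_mulAut {α : Type*} (f g : α → FreeGroup α) (hfg : ∀ x, lift f (g x) = of x)
    (hgf : ∀ x, lift g (f x) = of x) : ∃ κ : MulAut (FreeGroup α), ∀ x, κ (of x) = f x :=
  ⟨MonoidHom.toMulEquiv (lift f) (lift g) (by ext x; simpa using hgf x)
    (by ext x; simpa using hfg x), fun x => by simp [MonoidHom.toMulEquiv]⟩

theorem exists_mulAut_mul (x : α) (l r : FreeGroup α)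
    (hl : ∀ f : α → FreeGroup α, (∀ y, y ≠ x → f y = of y) → lift f l = l)
    (hr : ∀ f : α → FreeGroup α, (∀ y, y ≠ x → f y = of y) → lift f r = r) :
    ∃ κ : MulAut (FreeGroup α), κ (of x) = l * of x * r ∧ ∀ y, y ≠ x → κ (of y) = of y := by
  have hu : ∀ (w : FreeGroup α) y, y ≠ x → Function.update (of : α → FreeGroup α) x w y = of y :=
    fun w y hy => Function.update_of_ne hy _ _
  obtain ⟨κ, hκ⟩ := exists_mulAut (Function.update of x (l * of x * r))
    (Function.update of x (l⁻¹ * of x * r⁻¹))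
    (fun y => by
      by_cases h : y = x
      · subst h
        simp only [Function.update_self, _root_.map_mul, _root_.map_inv, hl _ (hu _), hr _ (hu _),
          lift_apply_of]
        group
      · simp [h])
    (fun y => by
      by_cases h : y = x
      · subst h
        simp only [Function.update_self, _root_.map_mul, hl _ (hu _), hr _ (hu _),
          lift_apply_of]
        group
      · simp [h])
  exact ⟨κ, by simp [hκ], fun y hy => by simp [hκ, hy]⟩

theorem mulAut_inv_apply_of {α : Type*} {κ : MulAut (FreeGroup α)} {x : α} {l r : FreeGroup α}
    (hx : κ (of x) = l * of x * r) (hκ : ∀ y, y ≠ x → κ (of y) = of y) (hl : κ l = l)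
    (hr : κ r = r) :
    κ⁻¹ (of x) = l⁻¹ * of x * r⁻¹ ∧ ∀ y, y ≠ x → κ⁻¹ (of y) = of y := by
  refine ⟨?_, fun y hy => ?_⟩
  · rw [MulAut.inv_apply, MulEquiv.symm_apply_eq]
    simp only [_root_.map_mul, _root_.map_inv, hl, hr, hx]
    group
  · rw [MulAut.inv_apply, MulEquiv.symm_apply_eq, hκ y hy]

theorem map_mk_letter {α : Type*} {κ : MulAut (FreeGroup α)} {x y : α} (h : κ (of x) = of y) (b : Bool) :
    κ (mk [(x, b)]) = mk [(y, b)] := by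
  cases b
  · rw [mk_false_letter, mk_false_letter, _root_.map_inv, h]
  · exact h

/-- The subgroup `K` contains the swaps, inversions, transvections and partial conjugations
adapted to a set `B` of basis elements to be preserved up to conjugacy. -/
structure ContainsElementary {α : Type*} (B : Set α) (K : Subgroup (MulAut (FreeGroup α))) :
    Prop where
  of_forall ::
  swap : ∀ (κ : MulAut (FreeGroup α)) (x y : α), x ∉ B → y ∉ B → x ≠ y → κ (of x) = of y →
    κ (of y) = of x → (∀ k, k ≠ x → k ≠ y → κ (of k) = of k) → κ ∈ K
  inv : ∀ (κ : MulAut (FreeGroup α)) (x : α), x ∉ B → κ (of x) = (of x)⁻¹ →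
    (∀ k, k ≠ x → κ (of k) = of k) → κ ∈ K
  right : ∀ (κ : MulAut (FreeGroup α)) (x y : α), x ∉ B → y ≠ x → κ (of x) = of x * of y →
    (∀ k, k ≠ x → κ (of k) = of k) → κ ∈ K
  left : ∀ (κ : MulAut (FreeGroup α)) (x y : α), x ∉ B → y ≠ x → κ (of x) = (of y)⁻¹ * of x →
    (∀ k, k ≠ x → κ (of k) = of k) → κ ∈ K
  conj : ∀ (κ : MulAut (FreeGroup α)) (x y : α), x ∈ B → y ≠ x →
    κ (of x) = (of y)⁻¹ * of x * of y → (∀ k, k ≠ x → κ (of k) = of k) → κ ∈ K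

namespace ContainsElementary

variable {B : Set α} {K : Subgroup (MulAut (FreeGroup α))}

theorem exists_right (hK : ContainsElementary B K) {x : α} (hx : x ∉ B) (ℓ : α × Bool)
    (hℓ : ℓ.1 ≠ x) :
    ∃ κ ∈ K, κ (of x) = of x * mk [ℓ] ∧ ∀ y, y ≠ x → κ (of y) = of y := by
  obtain ⟨y, b⟩ := ℓ
  obtain ⟨κ, h1, h2⟩ := exists_mulAut_mul x 1 (of y) (by simp) (fun f hf => by simp [hf y hℓ])
  have hκ : κ ∈ K := hK.right κ x y hx hℓ (by simpa using h1) h2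
  cases b
  · obtain ⟨h3, h4⟩ := mulAut_inv_apply_of h1 h2 (_root_.map_one _) (h2 y hℓ)
    refine ⟨κ⁻¹, K.inv_mem hκ, ?_, h4⟩
    rw [h3, mk_false_letter]
    simp [of]
  · exact ⟨κ, hκ, by rw [h1, one_mul]; rfl, h2⟩

theorem exists_left (hK : ContainsElementary B K) {x : α} (hx : x ∉ B) (ℓ : α × Bool)
    (hℓ : ℓ.1 ≠ x) :
    ∃ κ ∈ K, κ (of x) = mk [ℓ] * of x ∧ ∀ y, y ≠ x → κ (of y) = of y := by
  obtain ⟨y, b⟩ := ℓ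
  obtain ⟨κ, h1, h2⟩ := exists_mulAut_mul x (of y)⁻¹ 1 (fun f hf => by simp [hf y hℓ]) (by simp)
  have hκ : κ ∈ K := hK.left κ x y hx hℓ (by simpa using h1) h2
  cases b
  · refine ⟨κ, hκ, ?_, h2⟩
    rw [h1, mk_false_letter]
    simp [of]
  · obtain ⟨h3, h4⟩ := mulAut_inv_apply_of h1 h2 (by simp [h2 y hℓ]) (_root_.map_one _)
    refine ⟨κ⁻¹, K.inv_mem hκ, ?_, h4⟩
    rw [h3, inv_inv, inv_one, mul_one]
    rfl

theorem exists_conj (hK : ContainsElementary B K) {x : α} (hx : x ∈ B) (ℓ : α × Bool)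
    (hℓ : ℓ.1 ≠ x) :
    ∃ κ ∈ K, κ (of x) = mk [ℓ] * of x * (mk [ℓ])⁻¹ ∧ ∀ y, y ≠ x → κ (of y) = of y := by
  obtain ⟨y, b⟩ := ℓ
  obtain ⟨κ, h1, h2⟩ := exists_mulAut_mul x (of y)⁻¹ (of y) (fun f hf => by simp [hf y hℓ])
    (fun f hf => by simp [hf y hℓ])
  have hκ : κ ∈ K := hK.conj κ x y hx hℓ h1 h2
  cases b
  · refine ⟨κ, hκ, ?_, h2⟩
    rw [h1, mk_false_letter, inv_inv]
  · obtain ⟨h3, h4⟩ := mulAut_inv_apply_of h1 h2 (by simp [h2 y hℓ]) (h2 y hℓ)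
    refine ⟨κ⁻¹, K.inv_mem hκ, ?_, h4⟩
    rw [h3, inv_inv]
    rfl

theorem exists_mul (hK : ContainsElementary B K) (ℓ' ℓ : α × Bool) (h : ℓ'.1 ≠ ℓ.1)
    (hB : ℓ.1 ∉ B) :
    ∃ κ ∈ K, κ (mk [ℓ]) = mk [ℓ'] * mk [ℓ] ∧ ∀ y, y ≠ ℓ.1 → κ (of y) = of y := by
  obtain ⟨x, b⟩ := ℓ
  cases b
  · obtain ⟨κ, hκ, h1, h2⟩ := hK.exists_right hB (ℓ'.1, !ℓ'.2) h
    refine ⟨κ, hκ, ?_, h2⟩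
    rw [mk_false_letter, _root_.map_inv, h1, mk_letter_inv]
    simp
  · exact hK.exists_left hB ℓ' h

theorem exists_mul_conj (hK : ContainsElementary B K) (ℓ' ℓ : α × Bool) (h : ℓ'.1 ≠ ℓ.1)
    (hB : ℓ.1 ∈ B) :
    ∃ κ ∈ K, κ (mk [ℓ]) = mk [ℓ'] * mk [ℓ] * (mk [ℓ'])⁻¹ ∧
      ∀ y, y ≠ ℓ.1 → κ (of y) = of y := by
  obtain ⟨κ, hκ, h1, h2⟩ := hK.exists_conj hB ℓ' h
  refine ⟨κ, hκ, ?_, h2⟩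
  obtain ⟨x, b⟩ := ℓ
  cases b
  · rw [mk_false_letter, _root_.map_inv, h1]
    group
  · exact h1

/-- Signed permutations of the basis fixing `B` lie in `K`. -/
theorem mem_of_signedPerm (hK : ContainsElementary B K) (s : Finset α) :
    ∀ φ : MulAut (FreeGroup α), (∀ x, ∃ ℓ, φ (of x) = mk [ℓ]) → (∀ x ∈ B, φ (of x) = of x) →
      (∀ x ∉ s, φ (of x) = of x) → φ ∈ K := by
  induction s using Finset.induction_on with
  | empty =>
    intro φ _ _ h
    have : φ = 1 := by
      have : φ.toMonoidHom = MonoidHom.id _ := by ext x; simpa using h x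
      ext x
      exact DFunLike.congr_fun this x
    rw [this]
    exact K.one_mem
  | insert a s has ih =>
    have key : ∀ φ : MulAut (FreeGroup α), (∀ x, ∃ ℓ, φ (of x) = mk [ℓ]) →
        (∀ x ∈ B, φ (of x) = of x) → (∀ x ∉ insert a s, φ (of x) = of x) →
        (∃ b, φ (of a) = mk [(a, b)]) → φ ∈ K := by
      rintro φ h1 h2 h3 ⟨b, hb⟩
      by_cases ha : φ (of a) = of a
      · refine ih φ h1 h2 fun x hx => ?_
        by_cases hxa : x = a
        · rw [hxa, ha]
        · exact h3 x (by simp [hxa, hx])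
      · have haB : a ∉ B := fun h => ha (h2 a h)
        obtain ⟨κ, hκ⟩ := exists_mulAut (Function.update of a (of a)⁻¹)
          (Function.update of a (of a)⁻¹)
          (fun y => by by_cases h : y = a <;> simp [h])
          (fun y => by by_cases h : y = a <;> simp [h])
        have hκa : κ (of a) = (of a)⁻¹ := by simp [hκ]
        have hκx : ∀ x, x ≠ a → κ (of x) = of x := fun x hx => by simp [hκ, hx]
        have hba : φ (of a) = (of a)⁻¹ := by
          cases b
          · rw [hb]; exact mk_false_letter a
          · exact absurd hb ha
        have hφκa : (φ * κ) (of a) = of a := by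
          rw [MulAut.mul_apply, hκa, _root_.map_inv, hba, inv_inv]
        have hφκx : ∀ x, x ≠ a → (φ * κ) (of x) = φ (of x) := fun x hx => by
          rw [MulAut.mul_apply, hκx x hx]
        refine (K.mul_mem_cancel_right (hK.inv κ a haB hκa hκx)).1 (ih _ ?_ ?_ ?_)
        · intro x
          by_cases hxa : x = a
          · exact ⟨(a, true), by rw [hxa, hφκa]; rfl⟩
          · rw [hφκx x hxa]; exact h1 x
        · intro x hx
          rw [hφκx x (fun h => haB (h ▸ hx)), h2 x hx]
        · intro x hx
          by_cases hxa : x = a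
          · rw [hxa, hφκa]
          · rw [hφκx x hxa, h3 x (by simp [hxa, hx])]
    intro φ h1 h2 h3
    obtain ⟨⟨z, b⟩, hz⟩ := h1 a
    by_cases hza : z = a
    · subst hza
      exact key φ h1 h2 h3 ⟨b, hz⟩
    have hz_ne : φ (of z) ≠ of z := by
      intro h
      have h4 : φ (mk [(z, b)]) = φ (of a) := by rw [hz, map_mk_letter h]
      have h5 := congrArg toWord (φ.injective h4)
      rw [toWord_mk, reduce_singleton, toWord_of] at h5
      simp only [List.cons.injEq, Prod.mk.injEq] at h5
      exact hza h5.1.1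
    have haB : a ∉ B := by
      intro h
      have h5 := congrArg toWord (hz.symm.trans (h2 a h))
      rw [toWord_mk, reduce_singleton, toWord_of] at h5
      simp only [List.cons.injEq, Prod.mk.injEq] at h5
      exact hza h5.1.1
    have hzB : z ∉ B := fun h => hz_ne (h2 z h)
    have hzs : z ∈ insert a s := by
      by_contra h
      exact hz_ne (h3 z h)
    set κ : MulAut (FreeGroup α) := freeGroupCongr (Equiv.swap a z) with hκdef
    have hκ : ∀ x, κ (of x) = of (Equiv.swap a z x) := fun x => by simp [hκdef]
    have hκm : κ ∈ K := by
      refine hK.swap κ a z haB hzB (Ne.symm hza) (by simp [hκ]) (by simp [hκ]) fun k hk hk' => ?_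
      rw [hκ, Equiv.swap_apply_of_ne_of_ne hk hk']
    have hfix : ∀ x, x ≠ a → x ≠ z → φ (of x) = of x → (κ * φ) (of x) = of x := by
      intro x hxa hxz hx
      rw [MulAut.mul_apply, hx, hκ, Equiv.swap_apply_of_ne_of_ne hxa hxz]
    refine (K.mul_mem_cancel_left hκm).1 (key _ ?_ ?_ ?_ ⟨b, ?_⟩)
    · intro x
      obtain ⟨⟨w, c⟩, hw⟩ := h1 x
      exact ⟨(_, c), by rw [MulAut.mul_apply, hw, map_mk_letter (hκ w)]⟩
    · intro x hx
      exact hfix x (fun h => haB (h ▸ hx)) (fun h => hzB (h ▸ hx)) (h2 x hx)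
    · intro x hx
      exact hfix x (fun h => hx (by simp [h])) (fun h => hx (h ▸ hzs)) (h3 x hx)
    · rw [MulAut.mul_apply, hz, map_mk_letter (hκ z), Equiv.swap_apply_right]

variable [Fintype α]

theorem mem_of_isNielsenMinimal (hK : ContainsElementary B K) {φ : MulAut (FreeGroup α)}
    (hφ : IsNielsenMinimal B φ) : φ ∈ K := by
  have hinv : ∀ x, ∃ ℓ : α × Bool, φ (mk [ℓ]) = of x := by
    intro x
    have h1 := hφ.norm_le (φ⁻¹ (of x))
    rw [MulAut.apply_inv_self, norm_of] at h1
    have h2 : (φ⁻¹ (of x)).norm ≠ 0 := by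
      rw [Ne, norm_eq_zero, MulEquiv.map_eq_one_iff]
      exact of_ne_one x
    obtain ⟨ℓ, hℓ⟩ := List.length_eq_one_iff.1 (show (φ⁻¹ (of x)).toWord.length = 1 by
      unfold norm at h1 h2; omega)
    refine ⟨ℓ, ?_⟩
    rw [← hℓ, mk_toWord, MulAut.apply_inv_self]
  choose ℓ hℓ using hinv
  have hinj : Function.Injective fun x => (ℓ x).1 := by
    intro x y hxy
    have h3 : ℓ x = ℓ y ∨ ℓ x = ((ℓ y).1, !(ℓ y).2) := by
      simp only [Prod.ext_iff]
      simp only at hxy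
      cases (ℓ x).2 <;> cases (ℓ y).2 <;> simp [hxy]
    rcases h3 with h3 | h3
    · exact of_injective (by rw [← hℓ x, ← hℓ y, h3])
    · have h4 : of x = (of y)⁻¹ := by
        rw [← hℓ x, ← hℓ y, h3, mk_letter_inv, _root_.map_inv]
      have h5 := congrArg toWord h4
      rw [toWord_inv, toWord_of, toWord_of] at h5
      simp [invRev] at h5
  have hletter : ∀ y, ∃ ℓ' : α × Bool, φ (of y) = mk [ℓ'] := by
    intro y
    obtain ⟨x, rfl⟩ := Finite.injective_iff_surjective.1 hinj y
    have h := hℓ x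
    rcases hx : ℓ x with ⟨z, _ | _⟩
    · rw [hx, mk_false_letter, _root_.map_inv, inv_eq_iff_eq_inv] at h
      exact ⟨(x, false), by simp only [hx, h]; exact (mk_false_letter x).symm⟩
    · rw [hx] at h
      exact ⟨(x, true), by simp only [hx]; exact h⟩
  refine hK.mem_of_signedPerm Finset.univ φ hletter (fun x hx => ?_)
    (fun x hx => absurd (Finset.mem_univ x) hx)
  obtain ⟨h, h1, h2⟩ := exists_toWord_of_isConj (ℓ := (x, true)) (hφ.isConj x hx)
  obtain ⟨ℓ', hℓ'⟩ := hletter x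
  have h3 := norm_eq_of_toWord h2
  have h4 : φ (mk [(x, true)]) = mk [ℓ'] := hℓ'
  rw [h4, norm, toWord_mk, reduce_singleton, List.length_singleton] at h3
  obtain rfl : h = 1 := norm_eq_zero.1 (by omega)
  rw [one_mul, inv_one, mul_one] at h1
  exact h1

theorem mem_of_isConj (hK : ContainsElementary B K) (φ : MulAut (FreeGroup α))
    (hφ : ∀ x ∈ B, IsConj (of x) (φ (of x))) : φ ∈ K := by
  suffices H : ∀ N W : ℕ, ∀ φ : MulAut (FreeGroup α), ∑ x, (φ (of x)).norm = N →
      ∑ x, halfWeight (φ (of x)) = W → (∀ x ∈ B, IsConj (of x) (φ (of x))) → φ ∈ K from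
    H _ _ φ rfl rfl hφ
  clear hφ φ
  intro N
  induction N using Nat.strong_induction_on with
  | _ N ihN =>
  intro W
  induction W using Nat.strong_induction_on with
  | _ W ihW =>
  intro φ hN hW hφ
  have norm_of_letter : ∀ (ψ : MulAut (FreeGroup α)) (ℓ : α × Bool),
      (ψ (mk [ℓ])).norm = (ψ (of ℓ.1)).norm ∧
        halfWeight (ψ (mk [ℓ])) = halfWeight (ψ (of ℓ.1)) := by
    rintro ψ ⟨x, _ | _⟩
    · rw [mk_false_letter, _root_.map_inv,
        norm_inv_eq, halfWeight_inv]
      exact ⟨rfl, rfl⟩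
    · exact ⟨rfl, rfl⟩
  have step : ∀ (ℓ : α × Bool) (κ : MulAut (FreeGroup α)), κ ∈ K →
      (∀ y, y ≠ ℓ.1 → κ (of y) = of y) → (ℓ.1 ∈ B → IsConj (mk [ℓ]) (κ (mk [ℓ]))) →
      (φ (κ (mk [ℓ]))).norm < (φ (mk [ℓ])).norm ∨
        ((φ (κ (mk [ℓ]))).norm = (φ (mk [ℓ])).norm ∧
          halfWeight (φ (κ (mk [ℓ]))) < halfWeight (φ (mk [ℓ]))) → φ ∈ K := by
    intro ℓ κ hκ hκy hκB hlt
    rw [← K.mul_mem_cancel_right hκ]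
    have hne : ∀ y, y ≠ ℓ.1 → (φ * κ) (of y) = φ (of y) := fun y hy => by
      rw [MulAut.mul_apply, hκy y hy]
    have hconj : ∀ x ∈ B, IsConj (of x) ((φ * κ) (of x)) := by
      intro x hx
      by_cases hxℓ : x = ℓ.1
      · subst hxℓ
        have h1 : IsConj (of ℓ.1) (κ (of ℓ.1)) := by
          have h2 := hκB hx
          rcases ℓ with ⟨x, _ | _⟩
          · rw [mk_false_letter, _root_.map_inv] at h2
            obtain ⟨c, hc⟩ := isConj_iff.1 h2
            refine isConj_iff.2 ⟨c, inv_injective ?_⟩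
            rw [← hc]
            group
          · exact h2
        exact (hφ _ hx).trans (φ.toMonoidHom.map_isConj h1)
      · rw [hne x hxℓ]
        exact hφ x hx
    rw [← MulAut.mul_apply, (norm_of_letter _ ℓ).1, (norm_of_letter _ ℓ).1, (norm_of_letter _ ℓ).2,
      (norm_of_letter _ ℓ).2] at hlt
    rcases hlt with hlt | ⟨heq, hlt⟩
    · refine ihN _ ?_ _ (φ * κ) rfl rfl hconj
      rw [← hN]
      refine Finset.sum_lt_sum (fun y _ => ?_) ⟨ℓ.1, Finset.mem_univ _, hlt⟩
      by_cases hy : y = ℓ.1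
      · rw [hy]; exact hlt.le
      · rw [hne y hy]
    · refine ihW _ ?_ (φ * κ) ?_ rfl hconj
      · rw [← hW]
        refine Finset.sum_lt_sum (fun y _ => ?_) ⟨ℓ.1, Finset.mem_univ _, hlt⟩
        by_cases hy : y = ℓ.1
        · rw [hy]; exact hlt.le
        · rw [hne y hy]
      · rw [← hN]
        refine Finset.sum_congr rfl fun y _ => ?_
        by_cases hy : y = ℓ.1
        · rw [hy]; exact heq
        · rw [hne y hy]
  by_contra hφK
  refine hφK (hK.mem_of_isNielsenMinimal (.of_forall hφ ?_ ?_))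
  · intro ℓ' ℓ h hB
    obtain ⟨κ, hκ, h1, h2⟩ := hK.exists_mul ℓ' ℓ h hB
    have h3 := mt (step ℓ κ hκ h2 (fun h => absurd h hB)) hφK
    rw [h1, _root_.map_mul] at h3
    push Not at h3
    exact h3
  · intro ℓ' ℓ h hB
    obtain ⟨κ, hκ, h1, h2⟩ := hK.exists_mul_conj ℓ' ℓ h hB
    have h3 := mt (step ℓ κ hκ h2 (fun _ => isConj_iff.2 ⟨_, h1.symm⟩)) hφK
    rw [h1, _root_.map_mul, _root_.map_mul, _root_.map_inv] at h3
    push Not at h3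
    exact h3

end ContainsElementary
end Elementary

section Lead

variable {α : Type*} [DecidableEq α] {b : α}

/-- The exponent of the maximal initial power of `b` in a word, and the letter following it. -/
def wordLead (b : α) : List (α × Bool) → ℤ × Option (α × Bool)
  | [] => (0, none)
  | ℓ :: L =>
    if ℓ.1 = b then (cond ℓ.2 1 (-1) + (wordLead b L).1, (wordLead b L).2) else (0, some ℓ)

/-- The exponent of the maximal initial power of `b` in the reduced word of an element, and the
letter following it. -/
def lead (b : α) (x : FreeGroup α) : ℤ × Option (α × Bool) := wordLead b x.toWord

theorem lead_one : lead b 1 = (0, none) := by simp [lead, wordLead]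

theorem toWord_letter_mul_of_toWord_eq_nil {ℓ : α × Bool} {x : FreeGroup α} (h : x.toWord = []) :
    (mk [ℓ] * x).toWord = [ℓ] := by
  rw [toWord_eq_nil_iff] at h
  rw [h, mul_one, toWord_mk, reduce_singleton]

theorem toWord_letter_mul_of_toWord_eq_cons {ℓ ℓ' : α × Bool} {L : List (α × Bool)}
    {x : FreeGroup α} (h : x.toWord = ℓ' :: L) :
    (mk [ℓ] * x).toWord = if ℓ.1 = ℓ'.1 ∧ ℓ.2 = !ℓ'.2 then L else ℓ :: ℓ' :: L := by
  rw [toWord_mul, toWord_mk, reduce_singleton, List.singleton_append, reduce.cons, reduce_toWord, h]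

theorem lead_base_mul (e : Bool) (x : FreeGroup α) :
    lead b (mk [(b, e)] * x) = (cond e 1 (-1) + (lead b x).1, (lead b x).2) := by
  unfold lead
  rcases h : x.toWord with _ | ⟨⟨c, e'⟩, L⟩
  · rw [toWord_letter_mul_of_toWord_eq_nil h]
    simp [wordLead]
  · rw [toWord_letter_mul_of_toWord_eq_cons h]
    split_ifs with hc
    · obtain ⟨h1, h2⟩ := hc
      simp only at h1 h2
      subst h1 h2
      cases e' <;> simp [wordLead]
    · simp [wordLead]

theorem lead_of_mul (x : FreeGroup α) :
    lead b (of b * x) = (1 + (lead b x).1, (lead b x).2) :=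
  lead_base_mul true x

theorem lead_of_inv_mul (x : FreeGroup α) :
    lead b ((of b)⁻¹ * x) = (-1 + (lead b x).1, (lead b x).2) := by
  rw [← mk_false_letter]
  exact lead_base_mul false x

theorem lead_zpow_mul (k : ℤ) (x : FreeGroup α) :
    lead b (of b ^ k * x) = (k + (lead b x).1, (lead b x).2) := by
  induction k with
  | zero => simp
  | succ i ih =>
    rw [add_comm, zpow_add, zpow_one, mul_assoc, lead_of_mul, ih]
    simp [add_assoc]
  | pred i ih =>
    rw [sub_eq_add_neg, add_comm, zpow_add, zpow_neg_one, mul_assoc, lead_of_inv_mul, ih]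
    simp [add_assoc]

theorem lead_zpow (k : ℤ) : lead b (of b ^ k) = (k, none) := by
  simpa [lead_one] using lead_zpow_mul (b := b) k 1

theorem of_zpow_injective {k l : ℤ} (h : of b ^ k = of b ^ l) : k = l := by
  simpa [lead_zpow] using congrArg (lead b) h

theorem lead_letter_mul {ℓ : α × Bool} (hℓ : ℓ.1 ≠ b) {x : FreeGroup α}
    (hx : lead b x ≠ (0, some (ℓ.1, !ℓ.2))) : lead b (mk [ℓ] * x) = (0, some ℓ) := by
  unfold lead at *
  rcases h : x.toWord with _ | ⟨⟨c, e'⟩, L⟩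
  · rw [toWord_letter_mul_of_toWord_eq_nil h]
    simp [wordLead, hℓ]
  · rw [toWord_letter_mul_of_toWord_eq_cons h]
    split_ifs with hc
    · obtain ⟨h1, h2⟩ := hc
      simp only at h1 h2
      subst h1
      simp [h, wordLead, hℓ, h2] at hx
    · simp [wordLead, hℓ]

theorem wordLead_sign {e : Bool} {L : List (α × Bool)} (hL : IsReduced ((b, e) :: L)) :
    0 < cond e 1 (-1) * (wordLead b ((b, e) :: L)).1 := by
  induction L with
  | nil => cases e <;> simp [wordLead]
  | cons ℓ L ih =>
    rw [isReduced_cons_cons] at hL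
    by_cases h : ℓ.1 = b
    · obtain ⟨c, e'⟩ := ℓ
      simp only at h
      subst h
      obtain rfl : e = e' := hL.1 rfl
      have := ih hL.2
      cases e <;> simp [wordLead] at this ⊢ <;> omega
    · cases e <;> simp [wordLead, h]

theorem eq_cons_of_wordLead_eq {ℓ : α × Bool} {L : List (α × Bool)} (hL : IsReduced L)
    (h : wordLead b L = (0, some ℓ)) : ∃ L', L = ℓ :: L' := by
  rcases L with _ | ⟨⟨c, e⟩, L⟩
  · simp [wordLead] at h
  · by_cases hc : c = b
    · subst hc
      have := wordLead_sign hL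
      rw [h] at this
      simp at this
    · simp only [wordLead, hc, if_false, Prod.mk.injEq, Option.some.injEq, true_and] at h
      exact ⟨L, by rw [h]⟩

theorem exists_of_toWord_eq_cons {x : FreeGroup α} {ℓ : α × Bool} {L : List (α × Bool)}
    (h : x.toWord = ℓ :: L) :
    ∃ y : FreeGroup α, x = mk [ℓ] * y ∧ x.norm = y.norm + 1 ∧ y.toWord = L := by
  have hL : IsReduced L := by
    have h1 : IsReduced (ℓ :: L) := h ▸ isReduced_toWord
    exact h1.infix (List.infix_cons (List.infix_refl L))
  have hy : (mk L).toWord = L := by rw [toWord_mk, hL.reduce_eq]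
  exact ⟨mk L, by rw [mul_mk, List.singleton_append, ← h, mk_toWord], by simp [norm, h, hy], hy⟩

/-- Induction on the reduced word of an element, distinguishing the letters `b` and `b⁻¹`. -/
theorem lead_induction {P : FreeGroup α → Prop} (one : P 1)
    (base : ∀ e x, P x → P (mk [(b, e)] * x))
    (letter : ∀ (ℓ : α × Bool) (x : FreeGroup α), ℓ.1 ≠ b → lead b x ≠ (0, some (ℓ.1, !ℓ.2)) →
      P x → P (mk [ℓ] * x)) (x : FreeGroup α) : P x := by
  induction hn : x.norm generalizing x with
  | zero => rwa [norm_eq_zero.1 hn]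
  | succ n ih =>
    rcases h : x.toWord with _ | ⟨ℓ, L⟩
    · simp [norm, h] at hn
    obtain ⟨y, rfl, hy, hyL⟩ := exists_of_toWord_eq_cons h
    have hPy := ih y (by omega)
    by_cases hℓ : ℓ.1 = b
    · obtain ⟨c, e⟩ := ℓ
      simp only at hℓ
      subst hℓ
      exact base e y hPy
    · refine letter ℓ y hℓ (fun h1 => ?_) hPy
      obtain ⟨L', hL'⟩ := eq_cons_of_wordLead_eq isReduced_toWord h1
      have h2 : IsReduced (ℓ :: (ℓ.1, !ℓ.2) :: L') := by
        rw [← hL', hyL, ← h]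
        exact isReduced_toWord
      rw [isReduced_cons_cons] at h2
      simpa using h2.1 rfl

theorem lead_mul_zpow (k : ℤ) (x : FreeGroup α) :
    (lead b (x * of b ^ k)).2 = (lead b x).2 ∧
      ((lead b x).2 ≠ none → (lead b (x * of b ^ k)).1 = (lead b x).1) := by
  induction x using lead_induction (b := b) with
  | one => simp [lead_zpow, lead_one]
  | base e x ih =>
    rw [mul_assoc, lead_base_mul, lead_base_mul]
    exact ⟨ih.1, fun h => by rw [ih.2 h]⟩
  | letter ℓ x hℓ hx ih =>
    have h1 : lead b (x * of b ^ k) ≠ (0, some (ℓ.1, !ℓ.2)) := by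
      intro h
      rw [h] at ih
      refine hx (Prod.ext (ih.2 ?_).symm ih.1.symm)
      rw [← ih.1]
      simp
    rw [mul_assoc, lead_letter_mul hℓ h1, lead_letter_mul hℓ hx]
    simp

theorem lead_mul_zpow_of_ne {k : ℤ} {x : FreeGroup α} (h : (lead b x).2 ≠ none) :
    lead b (x * of b ^ k) = lead b x :=
  Prod.ext ((lead_mul_zpow k x).2 h) (lead_mul_zpow k x).1

theorem eq_zpow_of_lead {x : FreeGroup α} (h : (lead b x).2 = none) : ∃ i : ℤ, x = of b ^ i := by
  induction x using lead_induction (b := b) with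
  | one => exact ⟨0, by simp⟩
  | base e x ih =>
    rw [lead_base_mul] at h
    obtain ⟨i, rfl⟩ := ih h
    cases e
    · exact ⟨-1 + i, by rw [mk_false_letter, zpow_add, zpow_neg_one]⟩
    · exact ⟨1 + i, by rw [zpow_add, zpow_one]; rfl⟩
  | letter ℓ x hℓ hx ih =>
    rw [lead_letter_mul hℓ hx] at h
    simp at h

theorem exists_eq_zpow_mul_of_lead {x : FreeGroup α} {ℓ : α × Bool} (h : (lead b x).2 = some ℓ) :
    ∃ (i : ℤ) (y : FreeGroup α), x = of b ^ i * (mk [ℓ] * y) ∧ y.norm < x.norm := by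
  induction hn : x.norm generalizing x with
  | zero => rw [norm_eq_zero.1 hn, lead_one] at h; simp at h
  | succ n ih =>
    rcases hx : x.toWord with _ | ⟨ℓ', L⟩
    · simp [norm, hx] at hn
    obtain ⟨y, rfl, hy, hyL⟩ := exists_of_toWord_eq_cons hx
    by_cases hℓ : ℓ'.1 = b
    · obtain ⟨c, e⟩ := ℓ'
      simp only at hℓ
      subst hℓ
      rw [lead_base_mul] at h
      obtain ⟨i, z, hz, hzn⟩ := ih h (by omega)
      refine ⟨cond e 1 (-1) + i, z, ?_, by omega⟩
      rw [hz, zpow_add, mul_assoc]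
      cases e
      · simp [mk_false_letter]
      · simp [of]
    · simp only [lead, hx, wordLead, hℓ, if_false, Option.some.injEq] at h
      subst h
      exact ⟨0, y, by simp, by omega⟩

theorem eq_zpow_of_commute {x : FreeGroup α} (h : Commute x (of b)) : ∃ i : ℤ, x = of b ^ i := by
  refine eq_zpow_of_lead (by_contra fun h1 => ?_)
  have h2 := lead_mul_zpow_of_ne (k := 1) h1
  rw [zpow_one, h.eq, lead_of_mul] at h2
  have := congrArg Prod.fst h2
  simp at this

section Transvection

variable {a : α} {ρ : FreeGroup α →* FreeGroup α}

theorem lead_transvection (hab : a ≠ b) (hρa : ρ (of a) = of a * of b)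
    (hρ : ∀ x, x ≠ a → ρ (of x) = of x) (x : FreeGroup α) :
    lead b (ρ x) =
      ((lead b x).1 - if (lead b x).2 = some (a, false) then 1 else 0, (lead b x).2) := by
  have hρ' : ∀ x, x ≠ a → ∀ e, ρ (mk [(x, e)]) = mk [(x, e)] := by
    intro x hx e
    cases e
    · rw [mk_false_letter, _root_.map_inv, hρ x hx]
    · exact hρ x hx
  induction x using lead_induction (b := b) with
  | one => simp [lead_one]
  | base e x ih =>
    rw [_root_.map_mul, hρ' b hab.symm, lead_base_mul, ih, lead_base_mul, add_sub_assoc]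
  | letter ℓ x hℓ hx ih =>
    rw [lead_letter_mul hℓ hx, _root_.map_mul]
    have hx' : (lead b x).2 = some (ℓ.1, !ℓ.2) → (lead b x).1 ≠ 0 := fun h1 h2 =>
      hx (Prod.ext h2 h1)
    obtain ⟨c, e⟩ := ℓ
    by_cases hc : c = a
    · subst hc
      cases e
      · rw [mk_false_letter, _root_.map_inv, hρa, mul_inv_rev, mul_assoc, lead_of_inv_mul,
          ← mk_false_letter, lead_letter_mul hℓ]
        · simp
        · rw [ih]
          simp only [Bool.not_false, ne_eq, Prod.mk.injEq, not_and] at hx' ⊢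
          intro h1 h2
          exact hx' h2 (by simpa [h2] using h1)
      · rw [show mk [(c, true)] = of c from rfl, hρa, mul_assoc]
        refine (lead_letter_mul (ℓ := (c, true)) hℓ ?_).trans (by simp)
        rw [lead_of_mul, ih]
        simp only [Bool.not_true, ne_eq, Prod.mk.injEq, not_and] at hx' ⊢
        intro h1 h2
        exact hx' h2 (by simpa [h2] using h1)
    · rw [hρ' c hc, lead_letter_mul hℓ]
      · simp [hc]
      · rw [ih]
        simp only [ne_eq, Prod.mk.injEq, not_and] at hx' ⊢
        intro h1 h2
        exact hx' h2 (by simpa [h2, hc] using h1)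

/-- The elements moved by the transvection `a ↦ a * b` by right multiplication by a power
of `b`. -/
theorem eq_of_transvection_eq_mul_zpow (hab : a ≠ b) (hρa : ρ (of a) = of a * of b)
    (hρ : ∀ x, x ≠ a → ρ (of x) = of x) {R : Subgroup (FreeGroup α)}
    (hRa : of a * of b * (of a)⁻¹ ∈ R) (hR : ∀ x, x ≠ a → of x ∈ R) (x : FreeGroup α) {k : ℤ}
    (hx : ρ x = x * of b ^ k) : (k = 0 ∧ x ∈ R) ∨ (k = 1 ∧ ∃ h ∈ R, x = h * of a) := by
  have hmul : ∀ r ∈ R, ∀ y, ((k = 0 ∧ y ∈ R) ∨ (k = 1 ∧ ∃ h ∈ R, y = h * of a)) →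
      (k = 0 ∧ r * y ∈ R) ∨ (k = 1 ∧ ∃ h ∈ R, r * y = h * of a) := by
    rintro r hr y (⟨hk, hy⟩ | ⟨hk, h, hh, rfl⟩)
    · exact .inl ⟨hk, R.mul_mem hr hy⟩
    · exact .inr ⟨hk, r * h, R.mul_mem hr hh, (mul_assoc ..).symm⟩
  have hb : ρ (of b) = of b := hρ b hab.symm
  induction hn : x.norm using Nat.strong_induction_on generalizing x with
  | _ n ih =>
  have hlead := lead_transvection hab hρa hρ
  rcases hw : x.toWord with _ | ⟨⟨c, e⟩, L⟩
  · obtain rfl := toWord_eq_nil_iff.1 hw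
    refine .inl ⟨?_, R.one_mem⟩
    rw [_root_.map_one, one_mul, ← zpow_zero (of b)] at hx
    exact (of_zpow_injective hx).symm
  have hwl : c = a → lead b x = (0, some (c, e)) := by
    rintro rfl
    simp [lead, hw, wordLead, hab]
  obtain ⟨y, rfl, hy, hyL⟩ := exists_of_toWord_eq_cons hw
  by_cases hc : c = a
  · specialize hwl hc
    subst hc
    cases e
    · have h1 := hlead (mk [(c, false)] * y)
      rw [hx, lead_mul_zpow_of_ne (by simp [hwl]), hwl] at h1
      simp at h1
    · have h1 : of b * ρ y = y * of b ^ k := by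
        rw [show mk [(c, true)] = of c from rfl, _root_.map_mul, hρa, mul_assoc, mul_assoc] at hx
        exact mul_left_cancel hx
      have h2 := lead_of_mul (b := b) (ρ y)
      rw [h1, hlead y] at h2
      rcases ho : (lead b y).2 with _ | ℓ
      · obtain ⟨i, rfl⟩ := eq_zpow_of_lead ho
        rw [map_zpow, hb, ← zpow_one_add, ← zpow_add] at h1
        have h3 := of_zpow_injective h1
        refine .inr ⟨by omega, (of c * of b * (of c)⁻¹) ^ i, R.zpow_mem hRa i, ?_⟩
        rw [conj_zpow, inv_mul_cancel_right]
        rfl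
      · rw [lead_mul_zpow_of_ne (by simp [ho]), ho] at h2
        have h3 := congrArg Prod.fst h2
        simp only [Option.some.injEq] at h3
        split_ifs at h3 with h4
        · subst h4
          obtain ⟨i, z, rfl, hz⟩ := exists_eq_zpow_mul_of_lead ho
          have h5 : mk [(c, true)] * (of b ^ i * (mk [(c, false)] * z)) =
              (of c * of b * (of c)⁻¹) ^ i * z := by
            rw [conj_zpow, mk_false_letter, show mk [(c, true)] = of c from rfl]
            group
          have h6 : ρ (of c * of b * (of c)⁻¹) = of c * of b * (of c)⁻¹ := by
            simp only [_root_.map_mul, _root_.map_inv, hρa, hb]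
            group
          rw [h5]
          refine hmul _ (R.zpow_mem hRa i) _ (ih z.norm (by omega) z ?_ rfl)
          rw [h5, _root_.map_mul, map_zpow, h6, mul_assoc (_ ^ i)] at hx
          exact mul_left_cancel hx
        · simp at h3
  · have h1 : ρ (mk [(c, e)]) = mk [(c, e)] ∧ mk [(c, e)] ∈ R := by
      cases e
      · rw [mk_false_letter, _root_.map_inv, hρ c hc]
        exact ⟨rfl, R.inv_mem (hR c hc)⟩
      · exact ⟨hρ c hc, hR c hc⟩
    refine hmul _ h1.2 y (ih y.norm (by omega) y ?_ rfl)
    rw [_root_.map_mul, h1.1, mul_assoc] at hx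
    exact mul_left_cancel hx

end Transvection
end Lead

end FreeGroup

section Centralizer

open FreeGroup hiding map_mul map_inv map_one

/-- The injective endomorphism of `F m` sending `a` to `a * b * a⁻¹` and fixing the other basis
elements; its range is the fixed subgroup of `a ↦ a * b`. -/
def fixEmb (m : ℕ) : F m →* F m :=
  lift fun i => if i = 0 then of 0 * of 1 * (of 0)⁻¹ else of i

variable {m : ℕ}

theorem fixEmb_of_zero : fixEmb m (of 0) = of 0 * of 1 * (of 0)⁻¹ := by simp [fixEmb]

theorem fixEmb_of_ne {i : Fin (m + 2)} (hi : i ≠ 0) : fixEmb m (of i) = of i := by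
  simp [fixEmb, hi]

theorem fixEmb_of_one : fixEmb m (of 1) = of 1 := fixEmb_of_ne one_ne_zero

theorem fixEmb_injective : Function.Injective (fixEmb m) := by
  let τ : MulAut (F m) := freeGroupCongr (Equiv.swap 0 1)
  let π : F m →* F m ⋊[MonoidHom.id (MulAut (F m))] MulAut (F m) :=
    lift fun i => if i = 0 then SemidirectProduct.inr τ else SemidirectProduct.inl (of i)
  have h : π.comp (fixEmb m) = SemidirectProduct.inl := by
    refine ext_hom _ _ fun i => ?_
    by_cases hi : i = 0
    · subst hi
      have h1 : τ (of 1) = of 0 := by simp [τ]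
      have h2 := SemidirectProduct.inl_aut (φ := MonoidHom.id (MulAut (F m))) τ (of 1)
      rw [MonoidHom.id_apply, h1, map_inv] at h2
      rw [MonoidHom.comp_apply, fixEmb_of_zero, h2]
      simp [π]
    · rw [MonoidHom.comp_apply, fixEmb_of_ne hi]
      simp [π, hi]
  have h1 : Function.Injective (π ∘ fixEmb m) := by
    rw [← MonoidHom.coe_comp, h]
    exact SemidirectProduct.inl_injective
  exact h1.of_comp

theorem intertwines_of_basis {Ψ φ : MulAut (F m)}
    (h : ∀ i, Ψ (fixEmb m (of i)) = fixEmb m (φ (of i))) (x : F m) :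
    Ψ (fixEmb m x) = fixEmb m (φ x) :=
  DFunLike.congr_fun (ext_hom (Ψ.toMonoidHom.comp (fixEmb m)) ((fixEmb m).comp φ.toMonoidHom) h) x

/-- The automorphisms induced through `fixEmb` by elements of the subgroup `H`. -/
def inducedSubgroup (H : Subgroup (MulAut (F m))) : Subgroup (MulAut (F m)) where
  carrier := {φ | ∃ Ψ ∈ H, ∀ x, Ψ (fixEmb m x) = fixEmb m (φ x)}
  one_mem' := ⟨1, H.one_mem, fun _ => rfl⟩
  mul_mem' := by
    rintro φ φ' ⟨Ψ, hΨ, h⟩ ⟨Ψ', hΨ', h'⟩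
    exact ⟨Ψ * Ψ', H.mul_mem hΨ hΨ', fun x => by
      rw [MulAut.mul_apply, h', h, MulAut.mul_apply]⟩
  inv_mem' := by
    rintro φ ⟨Ψ, hΨ, h⟩
    exact ⟨Ψ⁻¹, H.inv_mem hΨ, fun x => by
      rw [MulAut.inv_apply, MulEquiv.symm_apply_eq, h, MulAut.apply_inv_self]⟩

theorem two_le_iff {i : Fin (m + 2)} : 2 ≤ (i : ℕ) ↔ i ∉ ({0, 1} : Set (Fin (m + 2))) := by
  simp only [Set.mem_insert_iff, Set.mem_singleton_iff, Fin.ext_iff, Fin.val_zero, Fin.val_one]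
  omega

theorem ne_of_two_le {i : Fin (m + 2)} (hi : 2 ≤ (i : ℕ)) : i ≠ 0 ∧ i ≠ 1 := by
  simpa using two_le_iff.1 hi

theorem fixEmb_of_mem_ZSet {i j : Fin (m + 2)} (h : j ≠ i) : fixEmb m (of j) ∈ ZSet m i := by
  by_cases h0 : j = 0
  · rw [h0, fixEmb_of_zero]; exact .inl (.inl rfl)
  by_cases h1 : j = 1
  · rw [h1, fixEmb_of_one]; exact .inl (.inr rfl)
  · rw [fixEmb_of_ne h0]; exact .inr ⟨j, two_le_iff.2 (by simp [h0, h1]), h, rfl⟩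

theorem fixEmb_of_mem_GammaSet {j : Fin (m + 2)} (h1 : j ≠ 1) :
    fixEmb m (of j) ∈ GammaSet m := by
  by_cases h0 : j = 0
  · rw [h0, fixEmb_of_zero]; exact .inl rfl
  · rw [fixEmb_of_ne h0]; exact .inr ⟨j, two_le_iff.2 (by simp [h0, h1]), rfl⟩

theorem lift_fixEmb_of {f : Fin (m + 2) → F m} {i j : Fin (m + 2)} (hi : 2 ≤ (i : ℕ))
    (hf : ∀ k, k ≠ i → f k = of k) (hj : j ≠ i) : lift f (fixEmb m (of j)) = fixEmb m (of j) := by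
  by_cases h0 : j = 0
  · rw [h0, fixEmb_of_zero]
    simp [hf 0 (ne_of_two_le hi).1.symm, hf 1 (ne_of_two_le hi).2.symm]
  · rw [fixEmb_of_ne h0, lift_apply_of, hf j hj]

theorem exists_isGamma {j : Fin (m + 2)} (hj : j ≠ 1) :
    ∃ Ψ : MulAut (F m), Ψ (of 0) = of 0 * fixEmb m (of j) ∧
      Ψ (of 1) = (fixEmb m (of j))⁻¹ * of 1 * fixEmb m (of j) ∧
      ∀ k : Fin (m + 2), 2 ≤ (k : ℕ) → Ψ (of k) = of k := by
  let f : F m → Fin (m + 2) → F m := fun w k =>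
    if k = 0 then of 0 * w else if k = 1 then w⁻¹ * of 1 * w else of k
  have f0 : ∀ w, f w 0 = of 0 * w := fun w => by simp [f]
  have f1 : ∀ w, f w 1 = w⁻¹ * of 1 * w := fun w => by simp [f]
  have f2 : ∀ w k, k ≠ 0 → k ≠ 1 → f w k = of k := fun w k h0 h1 => by simp [f, h0, h1]
  have hz : ∀ w, lift (f w) (fixEmb m (of j)) = fixEmb m (of j) := by
    intro w
    by_cases h0 : j = 0
    · rw [h0, fixEmb_of_zero]
      simp only [map_mul, map_inv, lift_apply_of, f0, f1]
      group
    · rw [fixEmb_of_ne h0, lift_apply_of, f2 w j h0 hj]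
  have key : ∀ w w' : F m, w' = w⁻¹ → lift (f w) w' = w' → ∀ k, lift (f w) (f w' k) = of k := by
    rintro w w' rfl hw k
    by_cases h0 : k = 0
    · rw [h0, f0, map_mul, hw, lift_apply_of, f0]
      group
    by_cases h1 : k = 1
    · rw [h1, f1, map_mul, map_mul, map_inv, hw, lift_apply_of, f1]
      group
    · rw [f2 _ k h0 h1, lift_apply_of, f2 _ k h0 h1]
  obtain ⟨Ψ, hΨ⟩ := exists_mulAut (f (fixEmb m (of j))) (f (fixEmb m (of j))⁻¹)
    (key _ _ rfl (by rw [map_inv, hz])) (key _ _ (inv_inv _).symm (hz _))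
  exact ⟨Ψ, by rw [hΨ, f0], by rw [hΨ, f1], fun k hk => by
    rw [hΨ, f2 _ k (ne_of_two_le hk).1 (ne_of_two_le hk).2]⟩

theorem containsElementary_inducedSubgroup {H : Subgroup (MulAut (F m))}
    (hH : ∀ φ, IsP φ ∨ IsI φ ∨ IsTransC φ ∨ IsGamma φ ∨ IsAinv φ → φ ∈ H) :
    ContainsElementary {0, 1} (inducedSubgroup H) where
  swap κ x y hx hy hxy h1 h2 h3 := by
    have hx' := ne_of_two_le (two_le_iff.2 hx)
    have hy' := ne_of_two_le (two_le_iff.2 hy)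
    refine ⟨κ, hH κ (.inl ⟨x, y, two_le_iff.2 hx, two_le_iff.2 hy, hxy, h1, h2, h3⟩),
      intertwines_of_basis fun i => ?_⟩
    have h30 := h3 0 hx'.1.symm hy'.1.symm
    have h31 := h3 1 hx'.2.symm hy'.2.symm
    by_cases hi : i = 0
    · rw [hi, h30, fixEmb_of_zero]
      simp [h30, h31]
    rw [fixEmb_of_ne hi]
    by_cases hix : i = x
    · rw [hix, h1, fixEmb_of_ne hy'.1]
    by_cases hiy : i = y
    · rw [hiy, h2, fixEmb_of_ne hx'.1]
    rw [h3 i hix hiy, fixEmb_of_ne hi]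
  inv κ x hx h1 h2 := by
    have hx' := ne_of_two_le (two_le_iff.2 hx)
    refine ⟨κ, hH κ (.inr (.inl ⟨x, two_le_iff.2 hx, h1, h2⟩)), intertwines_of_basis fun i => ?_⟩
    have h20 := h2 0 hx'.1.symm
    have h21 := h2 1 hx'.2.symm
    by_cases hi : i = 0
    · rw [hi, h20, fixEmb_of_zero]
      simp [h20, h21]
    rw [fixEmb_of_ne hi]
    by_cases hix : i = x
    · rw [hix, h1, map_inv, fixEmb_of_ne hx'.1]
    rw [h2 i hix, fixEmb_of_ne hi]
  right κ x y hx hxy h1 h2 := by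
    have hx' := ne_of_two_le (two_le_iff.2 hx)
    obtain ⟨Ψ, h3, h4⟩ := exists_mulAut_mul x 1 (fixEmb m (of y)) (by simp)
      fun f hf => lift_fixEmb_of (two_le_iff.2 hx) hf hxy
    rw [one_mul] at h3
    refine ⟨Ψ, hH Ψ (.inr (.inr (.inl ⟨x, two_le_iff.2 hx, _, fixEmb_of_mem_ZSet hxy, .inl h3, h4⟩))),
      intertwines_of_basis fun i => ?_⟩
    by_cases hi : i = 0
    · rw [hi, h2 0 hx'.1.symm, fixEmb_of_zero]
      simp [h4 0 hx'.1.symm, h4 1 hx'.2.symm]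
    rw [fixEmb_of_ne hi]
    by_cases hix : i = x
    · rw [hix, h1, map_mul, fixEmb_of_ne hx'.1, h3]
    rw [h2 i hix, fixEmb_of_ne hi, h4 i hix]
  left κ x y hx hxy h1 h2 := by
    have hx' := ne_of_two_le (two_le_iff.2 hx)
    obtain ⟨Ψ, h3, h4⟩ := exists_mulAut_mul x (fixEmb m (of y))⁻¹ 1
      (fun f hf => by rw [map_inv, lift_fixEmb_of (two_le_iff.2 hx) hf hxy]) (by simp)
    rw [mul_one] at h3
    refine ⟨Ψ, hH Ψ (.inr (.inr (.inl ⟨x, two_le_iff.2 hx, _, fixEmb_of_mem_ZSet hxy, .inr h3, h4⟩))),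
      intertwines_of_basis fun i => ?_⟩
    by_cases hi : i = 0
    · rw [hi, h2 0 hx'.1.symm, fixEmb_of_zero]
      simp [h4 0 hx'.1.symm, h4 1 hx'.2.symm]
    rw [fixEmb_of_ne hi]
    by_cases hix : i = x
    · rw [hix, h1, map_mul, map_inv, fixEmb_of_ne hx'.1, h3]
    rw [h2 i hix, fixEmb_of_ne hi, h4 i hix]
  conj κ x y hx hxy h1 h2 := by
    rcases hx with rfl | rfl
    · obtain ⟨Ψ, h3, h4⟩ := exists_mulAut_mul 0 (of y)⁻¹ 1 (fun f hf => by simp [hf y hxy]) (by simp)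
      rw [mul_one] at h3
      have hy : of y ∈ ({of 1} ∪ {x | ∃ j : Fin (m + 2), 2 ≤ (j : ℕ) ∧ x = of j} : Set (F m)) := by
        by_cases hy1 : y = 1
        · exact .inl (by rw [hy1]; rfl)
        · exact .inr ⟨y, two_le_iff.2 (by simp [hxy, hy1]), rfl⟩
      refine ⟨Ψ, hH Ψ (.inr (.inr (.inr (.inr ⟨of y, hy, h3, h4⟩)))),
        intertwines_of_basis fun i => ?_⟩
      by_cases hi : i = 0
      · simp only [hi, h1, map_mul, map_inv, fixEmb_of_zero, fixEmb_of_ne hxy, h3,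
          h4 1 one_ne_zero]
        group
      · rw [h2 i hi, fixEmb_of_ne hi, h4 i hi]
    · obtain ⟨Ψ, h3, h4, h5⟩ := exists_isGamma hxy
      refine ⟨Ψ, hH Ψ (.inr (.inr (.inr (.inl ⟨_, fixEmb_of_mem_GammaSet hxy, h3, h4, h5⟩)))),
        intertwines_of_basis fun i => ?_⟩
      by_cases hi : i = 0
      · rw [hi, h2 0 zero_ne_one, fixEmb_of_zero]
        simp only [map_mul, map_inv, h3, h4]
        group
      rw [fixEmb_of_ne hi]
      by_cases hi1 : i = 1
      · rw [hi1, h1, h4]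
        simp only [map_mul, map_inv, fixEmb_of_one]
      · rw [h2 i hi1, fixEmb_of_ne hi, h5 i (two_le_iff.2 (by simp [hi, hi1]))]

variable {ρ : MulAut (F m)}

theorem nielsen_apply_fixEmb (hρa : ρ (of 0) = of 0 * of 1)
    (hρ : ∀ i : Fin (m + 2), i ≠ 0 → ρ (of i) = of i) (x : F m) :
    ρ (fixEmb m x) = fixEmb m x := by
  refine intertwines_of_basis (φ := 1) (fun i => ?_) x
  by_cases hi : i = 0
  · rw [hi, MulAut.one_apply, fixEmb_of_zero]
    simp only [map_mul, map_inv, hρa, hρ 1 one_ne_zero]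
    group
  · rw [fixEmb_of_ne hi, hρ i hi, MulAut.one_apply, fixEmb_of_ne hi]

theorem eq_of_nielsen_apply_eq (hρa : ρ (of 0) = of 0 * of 1)
    (hρ : ∀ i : Fin (m + 2), i ≠ 0 → ρ (of i) = of i) {x : F m} {k : ℤ}
    (hx : ρ x = x * of 1 ^ k) :
    (k = 0 ∧ ∃ y, fixEmb m y = x) ∨ (k = 1 ∧ ∃ h, x = fixEmb m h * of 0) := by
  rcases eq_of_transvection_eq_mul_zpow (ρ := ρ.toMonoidHom) (R := (fixEmb m).range) zero_ne_one
    hρa hρ ⟨_, fixEmb_of_zero⟩ (fun i hi => ⟨_, fixEmb_of_ne hi⟩) x hx with h | ⟨hk, _, ⟨h, rfl⟩, hx⟩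
  · exact .inl h
  · exact .inr ⟨hk, h, hx⟩

theorem exists_fixEmb_comp_eq (hρa : ρ (of 0) = of 0 * of 1)
    (hρ : ∀ i : Fin (m + 2), i ≠ 0 → ρ (of i) = of i) {ψ : MulAut (F m)} (hψ : Commute ψ ρ) :
    ∃ f : F m →* F m, ∀ x, fixEmb m (f x) = ψ (fixEmb m x) := by
  have h : ∀ i, ∃ y, fixEmb m y = ψ (fixEmb m (of i)) := by
    intro i
    have h1 : ρ (ψ (fixEmb m (of i))) = ψ (fixEmb m (of i)) * of 1 ^ (0 : ℤ) := by
      rw [← MulAut.mul_apply, ← hψ.eq, MulAut.mul_apply, nielsen_apply_fixEmb hρa hρ, zpow_zero,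
        mul_one]
    rcases eq_of_nielsen_apply_eq hρa hρ h1 with h2 | h2
    · exact h2.2
    · exact absurd h2.1 zero_ne_one
  choose y hy using h
  refine ⟨lift y, fun x => ?_⟩
  refine DFunLike.congr_fun (ext_hom ((fixEmb m).comp (lift y)) (ψ.toMonoidHom.comp (fixEmb m))
    fun i => ?_) x
  simpa using hy i

theorem exists_induced (hρa : ρ (of 0) = of 0 * of 1)
    (hρ : ∀ i : Fin (m + 2), i ≠ 0 → ρ (of i) = of i) {ψ : MulAut (F m)} (hψ : Commute ψ ρ) :
    ∃ φ : MulAut (F m), ∀ x, fixEmb m (φ x) = ψ (fixEmb m x) := by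
  obtain ⟨f, hf⟩ := exists_fixEmb_comp_eq hρa hρ hψ
  obtain ⟨g, hg⟩ := exists_fixEmb_comp_eq hρa hρ hψ.inv_left
  refine ⟨MonoidHom.toMulEquiv f g (MonoidHom.ext fun x => ?_) (MonoidHom.ext fun x => ?_), hf⟩
  · exact fixEmb_injective (by rw [MonoidHom.comp_apply, hg, hf, MulAut.inv_apply_self]; rfl)
  · exact fixEmb_injective (by rw [MonoidHom.comp_apply, hf, hg, MulAut.apply_inv_self]; rfl)

theorem commute_inv_mul_of_conj_eq {G : Type*} [Group G] {x y z : G}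
    (h : x * z * x⁻¹ = y * z * y⁻¹) : Commute (y⁻¹ * x) z := by
  rw [mul_inv_eq_iff_eq_mul] at h
  rw [Commute, SemiconjBy, mul_assoc, h]
  group

theorem isConj_induced (hρa : ρ (of 0) = of 0 * of 1)
    (hρ : ∀ i : Fin (m + 2), i ≠ 0 → ρ (of i) = of i) {ψ φ : MulAut (F m)} (hψ : Commute ψ ρ)
    (hconj : IsConj (of 1) (ψ (of 1))) (hφ : ∀ x, fixEmb m (φ x) = ψ (fixEmb m x)) :
    ∀ x ∈ ({0, 1} : Set (Fin (m + 2))), IsConj (of x) (φ (of x)) := by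
  obtain ⟨g, hg⟩ := isConj_iff.1 hconj
  have hρψ : ∀ x, ρ (ψ x) = ψ (ρ x) := fun x => (DFunLike.congr_fun hψ.eq x).symm
  have hb : ρ (of 1) = of 1 := hρ 1 one_ne_zero
  have h1 : ρ g * of 1 * (ρ g)⁻¹ = g * of 1 * g⁻¹ := by
    rw [hg, ← hb, ← hρψ, ← hg]
    simp only [map_mul, map_inv, hb]
  obtain ⟨k, hk⟩ := eq_zpow_of_commute (commute_inv_mul_of_conj_eq h1)
  have hk1 : ρ g = g * of 1 ^ k := by rw [← hk, mul_inv_cancel_left]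
  have hk2 : ρ (ψ (of 0) * g) = ψ (of 0) * g * of 1 ^ (k + 1) := by
    rw [map_mul, hρψ, hρa, map_mul, ← hg, hk1, zpow_add_one]
    group
  rcases eq_of_nielsen_apply_eq hρa hρ hk1 with ⟨rfl, g', hg'⟩ | ⟨rfl, -⟩
  · rcases eq_of_nielsen_apply_eq hρa hρ hk2 with ⟨h, -⟩ | ⟨-, h, hh⟩
    · omega
    rintro x (rfl | rfl)
    · refine isConj_iff.2 ⟨h, fixEmb_injective ?_⟩
      rw [hφ, fixEmb_of_zero]
      simp only [map_mul, map_inv, fixEmb_of_zero, ← hg]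
      have h3 : ψ (of 0) = fixEmb m h * of 0 * g⁻¹ := by rw [← hh, mul_inv_cancel_right]
      rw [h3]
      group
    · refine isConj_iff.2 ⟨g', fixEmb_injective ?_⟩
      rw [hφ, map_mul, map_mul, map_inv, fixEmb_of_one, hg', hg]
  · rcases eq_of_nielsen_apply_eq hρa hρ hk2 with ⟨h, -⟩ | ⟨h, -⟩ <;> omega

theorem nielsen_zpow_apply (hρa : ρ (of 0) = of 0 * of 1)
    (hρ : ∀ i : Fin (m + 2), i ≠ 0 → ρ (of i) = of i) (k : ℤ) :
    (ρ ^ k) (of 0) = of 0 * of 1 ^ k ∧ ∀ i : Fin (m + 2), i ≠ 0 → (ρ ^ k) (of i) = of i := by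
  have h : ∀ (k : ℤ) (i : Fin (m + 2)), i ≠ 0 → (ρ ^ k) (of i) = of i := fun k i hi =>
    (MulAction.stabilizer (MulAut (F m)) (of i)).zpow_mem (hρ i hi) k
  refine ⟨?_, h k⟩
  induction k with
  | zero => simp
  | succ i ih =>
    rw [zpow_add_one, MulAut.mul_apply, hρa, map_mul, ih, h _ 1 one_ne_zero, zpow_add_one, mul_assoc]
  | pred i ih =>
    have h1 : ρ⁻¹ (of 0) = of 0 * (of 1)⁻¹ := by
      rw [MulAut.inv_apply, MulEquiv.symm_apply_eq, map_mul, map_inv, hρa, hρ 1 one_ne_zero,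
        mul_inv_cancel_right]
    rw [zpow_sub_one, MulAut.mul_apply, h1, map_mul, map_inv, ih, h _ 1 one_ne_zero, zpow_sub_one,
      mul_assoc]

theorem mem_zpowers_of_fixEmb (hρa : ρ (of 0) = of 0 * of 1)
    (hρ : ∀ i : Fin (m + 2), i ≠ 0 → ρ (of i) = of i) {ψ : MulAut (F m)}
    (hψ : ∀ x, ψ (fixEmb m x) = fixEmb m x) : ψ ∈ Subgroup.zpowers ρ := by
  have hi : ∀ i : Fin (m + 2), i ≠ 0 → ψ (of i) = of i := fun i hi => by
    simpa [fixEmb_of_ne hi] using hψ (of i)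
  have h0 := hψ (of 0)
  simp only [fixEmb_of_zero, map_mul, map_inv, hi 1 one_ne_zero] at h0
  obtain ⟨k, hk⟩ := eq_zpow_of_commute (commute_inv_mul_of_conj_eq h0)
  obtain ⟨h2, h3⟩ := nielsen_zpow_apply hρa hρ k
  refine ⟨k, ?_⟩
  have h4 : (ρ ^ k).toMonoidHom = ψ.toMonoidHom := by
    refine ext_hom _ _ fun i => ?_
    by_cases h : i = 0
    · subst h
      exact h2.trans (inv_mul_eq_iff_eq_mul.1 hk).symm
    · exact (h3 i h).trans (hi i h).symm
  exact MulEquiv.ext fun x => DFunLike.congr_fun h4 x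

theorem commute_of_basis (hρa : ρ (of 0) = of 0 * of 1)
    (hρ : ∀ i : Fin (m + 2), i ≠ 0 → ρ (of i) = of i) {ψ : MulAut (F m)}
    (h0 : ρ (ψ (of 0)) = ψ (of 0) * ψ (of 1)) (h : ∀ i, i ≠ 0 → ρ (ψ (of i)) = ψ (of i)) :
    Commute ψ ρ := by
  have h1 : (ψ * ρ).toMonoidHom = (ρ * ψ).toMonoidHom := by
    refine ext_hom _ _ fun i => ?_
    by_cases hi : i = 0
    · subst hi
      exact (by rw [hρa, map_mul] : ψ (ρ (of 0)) = _).trans h0.symm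
    · exact (by rw [hρ i hi] : ψ (ρ (of i)) = _).trans (h i hi).symm
  exact MulEquiv.ext fun x => DFunLike.congr_fun h1 x

theorem apply_fixEmb_of_mem {i : Fin (m + 2)} (hρa : ρ (of 0) = of 0 * of 1)
    (hρ : ∀ i : Fin (m + 2), i ≠ 0 → ρ (of i) = of i) {z : F m}
    (hz : z ∈ ZSet m i ∪ GammaSet m) : ρ z = z := by
  have hc : ∀ j : Fin (m + 2), 2 ≤ (j : ℕ) → ρ (of j) = of j := fun j hj =>
    hρ j (ne_of_two_le hj).1
  have ha : ρ (of 0 * of 1 * (of 0)⁻¹) = of 0 * of 1 * (of 0)⁻¹ := by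
    simpa [fixEmb_of_zero] using nielsen_apply_fixEmb hρa hρ (of 0)
  rcases hz with ((rfl | rfl) | ⟨j, hj, -, rfl⟩) | (rfl | ⟨j, hj, rfl⟩)
  · exact ha
  · exact hρ 1 one_ne_zero
  · exact hc j hj
  · exact ha
  · exact hc j hj

theorem commute_and_isConj_of_isGenerator (hρa : ρ (of 0) = of 0 * of 1)
    (hρ : ∀ i : Fin (m + 2), i ≠ 0 → ρ (of i) = of i) {ψ : MulAut (F m)}
    (hψ : IsP ψ ∨ IsI ψ ∨ IsTransC ψ ∨ IsGamma ψ ∨ IsAinv ψ) :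
    Commute ψ ρ ∧ IsConj (of 1) (ψ (of 1)) := by
  have hb := hρ 1 one_ne_zero
  have key : ψ (of 0) = of 0 → ψ (of 1) = of 1 →
      (∀ i : Fin (m + 2), 2 ≤ (i : ℕ) → ρ (ψ (of i)) = ψ (of i)) →
      Commute ψ ρ ∧ IsConj (of 1) (ψ (of 1)) := by
    intro h0 h1 h2
    refine ⟨commute_of_basis hρa hρ (by rw [h0, h1, hρa]) fun i hi => ?_, by rw [h1]⟩
    by_cases hi1 : i = 1
    · rw [hi1, h1, hb]
    · exact h2 i (two_le_iff.2 (by simp [hi, hi1]))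
  rcases hψ with ⟨i, j, hi, hj, -, h1, h2, h3⟩ | ⟨i, hi, h1, h2⟩ | ⟨i, hi, z, hz, h1, h2⟩ |
    ⟨z, hz, h0, h1, h2⟩ | ⟨z, hz, h0, h1⟩
  · have hi' := ne_of_two_le hi
    have hj' := ne_of_two_le hj
    refine key (h3 0 hi'.1.symm hj'.1.symm) (h3 1 hi'.2.symm hj'.2.symm) fun k hk => ?_
    by_cases hki : k = i
    · rw [hki, h1, hρ j hj'.1]
    by_cases hkj : k = j
    · rw [hkj, h2, hρ i hi'.1]
    rw [h3 k hki hkj, hρ k (ne_of_two_le hk).1]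
  · have hi' := ne_of_two_le hi
    refine key (h2 0 hi'.1.symm) (h2 1 hi'.2.symm) fun k hk => ?_
    by_cases hki : k = i
    · rw [hki, h1, map_inv, hρ i hi'.1]
    rw [h2 k hki, hρ k (ne_of_two_le hk).1]
  · have hi' := ne_of_two_le hi
    have hz' := apply_fixEmb_of_mem hρa hρ (.inl hz)
    refine key (h2 0 hi'.1.symm) (h2 1 hi'.2.symm) fun k hk => ?_
    by_cases hki : k = i
    · rcases h1 with h1 | h1 <;> rw [hki, h1] <;> simp only [map_mul, map_inv, hz', hρ i hi'.1]
    rw [h2 k hki, hρ k (ne_of_two_le hk).1]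
  · have hz' := apply_fixEmb_of_mem (i := 0) hρa hρ (.inr hz)
    refine ⟨commute_of_basis hρa hρ ?_ fun i hi => ?_, ?_⟩
    · rw [h0, h1, map_mul, hz', hρa]
      group
    · by_cases hi1 : i = 1
      · rw [hi1, h1]
        simp only [map_mul, map_inv, hz', hb]
      · rw [h2 i (two_le_iff.2 (by simp [hi, hi1])), hρ i hi]
    · exact isConj_iff.2 ⟨z⁻¹, by rw [h1, inv_inv]⟩
  · have hz' : ρ z = z := by
      rcases hz with rfl | ⟨j, hj, rfl⟩
      · exact hb
      · exact hρ j (ne_of_two_le hj).1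
    refine ⟨commute_of_basis hρa hρ ?_ fun i hi => ?_, by rw [h1 1 one_ne_zero]⟩
    · rw [h0, h1 1 one_ne_zero, map_mul, map_inv, hz', hρa, mul_assoc]
    · rw [h1 i hi, hρ i hi]

/-- The automorphisms in the centralizer of `ρ` preserving the conjugacy class of `b`. -/
def centralizerConj (ρ : MulAut (F m)) : Subgroup (MulAut (F m)) where
  carrier := {ψ | ψ ∈ Subgroup.centralizer {ρ} ∧ IsConj (of 1) (ψ (of 1))}
  one_mem' := ⟨Subgroup.one_mem _, IsConj.refl _⟩
  mul_mem' := by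
    rintro ψ ψ' ⟨h1, h2⟩ ⟨h3, h4⟩
    exact ⟨Subgroup.mul_mem _ h1 h3, h2.trans (ψ.toMonoidHom.map_isConj h4)⟩
  inv_mem' := by
    rintro ψ ⟨h1, h2⟩
    refine ⟨Subgroup.inv_mem _ h1, ?_⟩
    have h3 := (ψ⁻¹).toMonoidHom.map_isConj h2
    simpa using h3.symm

end Centralizer

/-- the set `C⁰(ρ) = {ψ ∈ C(ρ) : ψ(b) is conjugate to b}` is a subgroup
of the centralizer `C(ρ)` of the Nielsen automorphism `ρ : a ↦ ab, b ↦ b, cᵢ ↦ cᵢ`,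
and it is generated by the automorphisms `P_{i,j}`, `I_i`, `(cᵢ^{±1}; z)`, `γ_z`,
`(a⁻¹; z)` together with `ρ` (all the listed generators of `C(ρ)` except `θ`). -/
theorem nielsen_centralizer_C0_generators
    (m : ℕ) (ρ : MulAut (F m))
    (hρa : ρ (FreeGroup.of 0) = FreeGroup.of 0 * FreeGroup.of 1)
    (hρ : ∀ i : Fin (m + 2), i ≠ 0 → ρ (FreeGroup.of i) = FreeGroup.of i) :
    ∃ S : Subgroup (MulAut (F m)),
      (S : Set (MulAut (F m))) =
        {ψ | ψ ∈ Subgroup.centralizer {ρ} ∧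
          IsConj (FreeGroup.of 1) (ψ (FreeGroup.of 1))} ∧
      S = Subgroup.closure
        ({φ | IsP φ ∨ IsI φ ∨ IsTransC φ ∨ IsGamma φ ∨ IsAinv φ} ∪ {ρ}) := by
  refine ⟨centralizerConj ρ, rfl, le_antisymm ?_ ((Subgroup.closure_le _).2 ?_)⟩
  · rintro ψ ⟨hψ, hconj⟩
    have hcomm : Commute ψ ρ := Subgroup.mem_centralizer_singleton_iff.1 hψ
    obtain ⟨φ, hφ⟩ := exists_induced hρa hρ hcomm
    have hgen : ∀ κ, IsP κ ∨ IsI κ ∨ IsTransC κ ∨ IsGamma κ ∨ IsAinv κ →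
        κ ∈ Subgroup.closure
          ({φ | IsP φ ∨ IsI φ ∨ IsTransC φ ∨ IsGamma φ ∨ IsAinv φ} ∪ {ρ}) :=
      fun κ hκ => Subgroup.subset_closure (.inl hκ)
    obtain ⟨Ψ, hΨ, h⟩ := (containsElementary_inducedSubgroup hgen).mem_of_isConj φ
      (isConj_induced hρa hρ hcomm hconj hφ)
    rw [← Subgroup.mul_mem_cancel_left _ (Subgroup.inv_mem _ hΨ)]
    refine (Subgroup.zpowers_le.2 (Subgroup.subset_closure (.inr rfl)))
      (mem_zpowers_of_fixEmb hρa hρ fun x => ?_)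
    rw [MulAut.mul_apply, ← hφ, ← h, MulAut.inv_apply_self]
  · rintro ψ (hψ | rfl)
    · obtain ⟨h1, h2⟩ := commute_and_isConj_of_isGenerator hρa hρ hψ
      exact ⟨Subgroup.mem_centralizer_singleton_iff.2 h1, h2⟩
    · exact ⟨Subgroup.mem_centralizer_singleton_iff.2 rfl, by rw [hρ 1 one_ne_zero]⟩
end

section
/- For every ψ in the centralizer C(ρ) of the Nielsen automorphism ρ in Aut(F_n), the element ψ(b) is conjugate in F_n either to b or to b⁻¹; moreover the set C⁰(ρ) = { ψ ∈ C(ρ) : ψ(b) is conjugate to b in F_n } is a subgroup of index exactly 2 in C(ρ). -/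
namespace FreeGroup

variable {α : Type*} [DecidableEq α]

/-- The number of letters of the reduced word of `x` that differ from `b` and `b⁻¹`. -/
def countNe (b : α) (x : FreeGroup α) : ℕ := x.toWord.countP (fun l => l.1 ≠ b)

lemma countNe_mul_le (b : α) (x y : FreeGroup α) :
    countNe b (x * y) ≤ countNe b x + countNe b y := by
  unfold countNe
  rw [← List.countP_append]
  exact (toWord_mul_sublist x y).countP_le

lemma countNe_inv (b : α) (x : FreeGroup α) : countNe b x⁻¹ = countNe b x := by
  simp [countNe, toWord_inv, invRev, List.countP_map, Function.comp_def]

lemma countNe_of_pow_self (b : α) (k : ℕ) : countNe b (of b ^ k) = 0 := by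
  simp [countNe, toWord_of_pow]

lemma countNe_of_of_ne {a b : α} (h : a ≠ b) : countNe b (of a) = 1 := by
  simp [countNe, h]

/-- An endomorphism which does not increase `countNe b` on generators does not increase it
on any element. -/
lemma countNe_map_le {b : α} (f : FreeGroup α →* FreeGroup α)
    (hf : ∀ i, countNe b (f (of i)) ≤ if i = b then 0 else 1) (x : FreeGroup α) :
    countNe b (f x) ≤ countNe b x := by
  suffices h : ∀ L : List (α × Bool),
      countNe b (f (mk L)) ≤ L.countP (fun l => l.1 ≠ b) by
    simpa only [mk_toWord, countNe] using h x.toWord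
  intro L
  induction L with
  | nil => simp [← one_eq_mk, countNe]
  | cons l L ih =>
    obtain ⟨i, e⟩ := l
    have hl : countNe b (f (mk [(i, e)])) ≤ if i = b then 0 else 1 := by
      cases e with
      | true => exact hf i
      | false =>
        have : mk [(i, false)] = (of i)⁻¹ := by simp [of, invRev]
        rw [this, _root_.map_inv, countNe_inv]
        exact hf i
    have hmul : mk ((i, e) :: L) = mk [(i, e)] * mk L := by simp [mul_mk]
    rw [hmul, _root_.map_mul, List.countP_cons]
    refine (countNe_mul_le b _ _).trans ?_
    by_cases h : i = b <;> simp [h] at hl ⊢ <;> simp at ih <;> omega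

lemma mk_mem_zpowers_of_countP_eq_zero {b : α} {L : List (α × Bool)}
    (h : L.countP (fun l => l.1 ≠ b) = 0) : mk L ∈ Subgroup.zpowers (of b) := by
  induction L with
  | nil => exact one_mem _
  | cons l L ih =>
    obtain ⟨i, e⟩ := l
    rw [List.countP_cons, Nat.add_eq_zero_iff] at h
    obtain rfl : i = b := by simpa using h.2
    have hmul : mk ((i, e) :: L) = mk [(i, e)] * mk L := by simp [mul_mk]
    rw [hmul]
    refine mul_mem ?_ (ih h.1)
    cases e with
    | true => exact Subgroup.mem_zpowers _
    | false =>
      have : mk [(i, false)] = (of i)⁻¹ := by simp [of, invRev]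
      rw [this]
      exact inv_mem (Subgroup.mem_zpowers _)

/-- If the powers of `u` have a bounded number of letters other than `b`, then `u` is conjugate
to a power of `b`. -/
lemma exists_isConj_zpow_of_countNe_pow_le {b : α} {u : FreeGroup α} {C : ℕ}
    (h : ∀ k : ℕ, countNe b (u ^ k) ≤ C) : ∃ j : ℤ, IsConj (of b ^ j) u := by
  have hv : (reduceCyclically u.toWord).countP (fun l => l.1 ≠ b) = 0 := by
    by_contra hne
    have hk := h (C + 1)
    rw [countNe, toWord_pow, reduceCyclically.reduce_flatten_replicate_succ isReduced_toWord,
      List.countP_append, List.countP_append, List.countP_flatten] at hk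
    simp only [List.map_replicate, List.sum_replicate, smul_eq_mul] at hk
    nlinarith [Nat.pos_of_ne_zero hne]
  obtain ⟨j, hj⟩ := Subgroup.mem_zpowers_iff.mp (mk_mem_zpowers_of_countP_eq_zero hv)
  refine ⟨j, isConj_iff.mpr ⟨mk (reduceCyclically.conjugator u.toWord), ?_⟩⟩
  rw [hj, inv_mk, mul_mk, mul_mk, reduceCyclically.conj_conjugator_reduceCyclically, mk_toWord]

/-- The exponent sum of the generator `b`. -/
def exponentSum (b : α) : FreeGroup α →* Multiplicative ℤ :=
  lift fun i => if i = b then Multiplicative.ofAdd 1 else 1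

lemma exponentSum_of_self (b : α) : exponentSum b (of b) = Multiplicative.ofAdd 1 := by
  simp [exponentSum]

lemma not_isConj_of_inv_of (b : α) : ¬ IsConj (of b) (of b)⁻¹ := by
  intro h
  have h' := isConj_iff_eq.mp ((exponentSum b).map_isConj h)
  rw [_root_.map_inv, exponentSum_of_self] at h'
  exact absurd h' (by decide)

/-- If an automorphism maps `b` to a conjugate of a power of `b`, then that power is `b` or
`b⁻¹`. -/
lemma isConj_or_isConj_inv_of_isConj_zpow {b : α} (ψ : MulAut (FreeGroup α)) {j : ℤ}
    (h : IsConj (of b ^ j) (ψ (of b))) :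
    IsConj (of b) (ψ (of b)) ∨ IsConj (of b)⁻¹ (ψ (of b)) := by
  have h' := isConj_iff_eq.mp
    (((exponentSum b).comp (ψ⁻¹ : MulAut (FreeGroup α)).toMonoidHom).map_isConj h)
  have hb : (ψ⁻¹ : MulAut (FreeGroup α)) (ψ (of b)) = of b := ψ.symm_apply_apply _
  simp only [map_zpow, MonoidHom.comp_apply, MulEquiv.coe_toMonoidHom, hb,
    exponentSum_of_self] at h'
  have hj : j * (exponentSum b ((ψ⁻¹ : MulAut (FreeGroup α)) (of b))).toAdd = 1 := by
    simpa using congrArg Multiplicative.toAdd h'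
  rcases Int.eq_one_or_neg_one_of_mul_eq_one hj with rfl | rfl
  · left; simpa using h
  · right; simpa using h

end FreeGroup

open FreeGroup

section Nielsen

variable {m : ℕ} {ρ : MulAut (F m)}

lemma nielsen_pow_apply_zero (hρa : ρ (of 0) = of 0 * of 1)
    (hρ : ∀ i : Fin (m + 2), i ≠ 0 → ρ (of i) = of i) (k : ℕ) :
    (ρ ^ k) (of 0) = of 0 * of 1 ^ k := by
  induction k with
  | zero => simp
  | succ k ih =>
    rw [pow_succ', MulAut.mul_apply, ih, _root_.map_mul, map_pow, hρa, hρ 1 (by simp), mul_assoc,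
      pow_succ']

lemma nielsen_pow_apply_of_ne_zero (hρ : ∀ i : Fin (m + 2), i ≠ 0 → ρ (of i) = of i) (k : ℕ)
    {i : Fin (m + 2)} (hi : i ≠ 0) : (ρ ^ k) (of i) = of i := by
  induction k with
  | zero => simp
  | succ k ih => rw [pow_succ', MulAut.mul_apply, ih, hρ i hi]

lemma countNe_nielsen_pow_le (hρa : ρ (of 0) = of 0 * of 1)
    (hρ : ∀ i : Fin (m + 2), i ≠ 0 → ρ (of i) = of i) (k : ℕ) (x : F m) :
    countNe 1 ((ρ ^ k) x) ≤ countNe 1 x := by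
  refine countNe_map_le (ρ ^ k).toMonoidHom (fun i => ?_) x
  rw [MulEquiv.coe_toMonoidHom]
  by_cases hi : i = 0
  · subst hi
    rw [nielsen_pow_apply_zero hρa hρ, if_neg (by simp)]
    refine (countNe_mul_le _ _ _).trans ?_
    rw [countNe_of_pow_self, countNe_of_of_ne (by simp)]
  · rw [nielsen_pow_apply_of_ne_zero hρ k hi]
    split_ifs with h
    · subst h
      simpa using (countNe_of_pow_self (1 : Fin (m + 2)) 1).le
    · exact (countNe_of_of_ne h).le

/-- An automorphism commuting with the Nielsen automorphism maps `b` to a conjugate of `b` or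
`b⁻¹`. -/
lemma isConj_or_isConj_inv_of_commute_nielsen (hρa : ρ (of 0) = of 0 * of 1)
    (hρ : ∀ i : Fin (m + 2), i ≠ 0 → ρ (of i) = of i) {ψ : MulAut (F m)} (hψ : Commute ψ ρ) :
    IsConj (of 1) (ψ (of 1)) ∨ IsConj (of 1)⁻¹ (ψ (of 1)) := by
  have hbound : ∀ k : ℕ, countNe 1 (ψ (of 1) ^ k) ≤
      countNe 1 (ψ (of 0)) + countNe 1 (ψ (of 0)) := fun k => by
    have h := DFunLike.congr_fun (hψ.pow_right k).eq (of 0)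
    rw [MulAut.mul_apply, MulAut.mul_apply, nielsen_pow_apply_zero hρa hρ, _root_.map_mul, map_pow] at h
    rw [eq_inv_mul_of_mul_eq h]
    refine (countNe_mul_le _ _ _).trans ?_
    rw [countNe_inv]
    gcongr
    exact countNe_nielsen_pow_le hρa hρ k _
  obtain ⟨j, hj⟩ := exists_isConj_zpow_of_countNe_pow_le hbound
  exact isConj_or_isConj_inv_of_isConj_zpow ψ hj

/-- The endomorphism `a ↦ a⁻¹`, `b ↦ a b⁻¹ a⁻¹`, `cᵢ ↦ cᵢ`. -/
def nielsenFlipHom (m : ℕ) : F m →* F m :=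
  lift fun i => if i = 0 then (of 0)⁻¹ else if i = 1 then of 0 * (of 1)⁻¹ * (of 0)⁻¹ else of i

lemma nielsenFlipHom_zero : nielsenFlipHom m (of 0) = (of 0)⁻¹ := by
  simp [nielsenFlipHom]

lemma nielsenFlipHom_one : nielsenFlipHom m (of 1) = of 0 * (of 1)⁻¹ * (of 0)⁻¹ := by
  simp [nielsenFlipHom]

lemma nielsenFlipHom_of_ne {i : Fin (m + 2)} (h0 : i ≠ 0) (h1 : i ≠ 1) :
    nielsenFlipHom m (of i) = of i := by
  simp [nielsenFlipHom, h0, h1]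

lemma nielsenFlipHom_comp_self :
    (nielsenFlipHom m).comp (nielsenFlipHom m) = MonoidHom.id (F m) := by
  refine ext_hom _ _ fun i => ?_
  rw [MonoidHom.comp_apply, MonoidHom.id_apply]
  by_cases h0 : i = 0
  · subst h0
    rw [nielsenFlipHom_zero, _root_.map_inv, nielsenFlipHom_zero, inv_inv]
  by_cases h1 : i = 1
  · subst h1
    simp only [nielsenFlipHom_one, _root_.map_mul, _root_.map_inv, nielsenFlipHom_zero]
    group
  · rw [nielsenFlipHom_of_ne h0 h1, nielsenFlipHom_of_ne h0 h1]

/-- The involution `a ↦ a⁻¹`, `b ↦ a b⁻¹ a⁻¹`, `cᵢ ↦ cᵢ`. -/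
def nielsenFlip (m : ℕ) : MulAut (F m) :=
  MonoidHom.toMulEquiv (nielsenFlipHom m) (nielsenFlipHom m) nielsenFlipHom_comp_self
    nielsenFlipHom_comp_self

lemma nielsenFlip_apply (x : F m) : nielsenFlip m x = nielsenFlipHom m x := rfl

lemma nielsenFlip_mem_centralizer (hρa : ρ (of 0) = of 0 * of 1)
    (hρ : ∀ i : Fin (m + 2), i ≠ 0 → ρ (of i) = of i) :
    nielsenFlip m ∈ Subgroup.centralizer {ρ} := by
  have hρb : ρ (of 1) = of 1 := hρ 1 (by simp)
  rw [Subgroup.mem_centralizer_singleton_iff]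
  refine MulEquiv.toMonoidHom_injective (ext_hom _ _ fun i => ?_)
  simp only [MulEquiv.coe_toMonoidHom, MulAut.mul_apply, nielsenFlip_apply]
  by_cases h0 : i = 0
  · subst h0
    simp only [hρa, nielsenFlipHom_zero, nielsenFlipHom_one, _root_.map_mul, _root_.map_inv]
    group
  by_cases h1 : i = 1
  · subst h1
    simp only [hρa, hρb, nielsenFlipHom_one, _root_.map_mul, _root_.map_inv]
    group
  · rw [hρ i h0, nielsenFlipHom_of_ne h0 h1, hρ i h0]

lemma isConj_nielsenFlip_one : IsConj (nielsenFlip m (of 1)) (of 1)⁻¹ := by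
  rw [nielsenFlip_apply, nielsenFlipHom_one]
  exact (isConj_iff.mpr ⟨of 0, rfl⟩).symm

end Nielsen

/-- The automorphisms in a subgroup `C` mapping `x` to a conjugate of itself. -/
def isConjStabilizer {G : Type*} [Group G] (C : Subgroup (MulAut G)) (x : G) : Subgroup C where
  carrier := {ψ | IsConj x ((ψ : MulAut G) x)}
  one_mem' := IsConj.refl x
  mul_mem' {φ ψ} hφ hψ :=
    IsConj.trans hφ ((φ : MulAut G).toMonoidHom.map_isConj hψ)
  inv_mem' {φ} hφ := by
    have h := ((φ : MulAut G)⁻¹).toMonoidHom.map_isConj hφ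
    have hx : ((φ : MulAut G)⁻¹) ((φ : MulAut G) x) = x := (φ : MulAut G).symm_apply_apply x
    simp only [MulEquiv.coe_toMonoidHom, hx] at h
    exact h.symm

/-- for every `ψ` in the centralizer `C(ρ)` of the Nielsen automorphism
`ρ : a ↦ ab, b ↦ b, cᵢ ↦ cᵢ`, the element `ψ(b)` is conjugate in `F_n` to `b` or to
`b⁻¹`; moreover `C⁰(ρ) = {ψ ∈ C(ρ) : ψ(b) conjugate to b}` is a subgroup of index
exactly `2` in `C(ρ)`. -/
theorem nielsen_centralizer_index_two
    (m : ℕ) (ρ : MulAut (F m))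
    (hρa : ρ (FreeGroup.of 0) = FreeGroup.of 0 * FreeGroup.of 1)
    (hρ : ∀ i : Fin (m + 2), i ≠ 0 → ρ (FreeGroup.of i) = FreeGroup.of i) :
    (∀ ψ : MulAut (F m), ψ ∈ Subgroup.centralizer {ρ} →
        IsConj (FreeGroup.of 1) (ψ (FreeGroup.of 1)) ∨
        IsConj (FreeGroup.of 1)⁻¹ (ψ (FreeGroup.of 1))) ∧
    ∃ S : Subgroup (Subgroup.centralizer {ρ}),
      (S : Set (Subgroup.centralizer {ρ})) =
        {ψ : Subgroup.centralizer {ρ} | IsConj (FreeGroup.of 1) ((ψ : MulAut (F m)) (FreeGroup.of 1))} ∧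
      S.index = 2 := by
  have hconj : ∀ ψ : MulAut (F m), ψ ∈ Subgroup.centralizer {ρ} →
      IsConj (FreeGroup.of 1) (ψ (FreeGroup.of 1)) ∨
      IsConj (FreeGroup.of 1)⁻¹ (ψ (FreeGroup.of 1)) := fun ψ hψ =>
    isConj_or_isConj_inv_of_commute_nielsen hρa hρ (Subgroup.mem_centralizer_singleton_iff.mp hψ)
  refine ⟨hconj, isConjStabilizer _ (of 1), rfl, Subgroup.index_eq_two_iff.mpr
    ⟨⟨nielsenFlip m, nielsenFlip_mem_centralizer hρa hρ⟩, fun ψ => ?_⟩⟩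
  have hflip : IsConj ((ψ : MulAut (F m)) (nielsenFlip m (of 1))) ((ψ : MulAut (F m)) (of 1))⁻¹ := by
    simpa using (ψ : MulAut (F m)).toMonoidHom.map_isConj (isConj_nielsenFlip_one (m := m))
  change Xor (IsConj (of 1) ((ψ : MulAut (F m)) (nielsenFlip m (of 1))))
    (IsConj (of 1) ((ψ : MulAut (F m)) (of 1)))
  have hinv : ∀ {x y : F m}, IsConj x y → IsConj x⁻¹ y⁻¹ := fun h => by
    obtain ⟨c, rfl⟩ := isConj_iff.mp h
    exact isConj_iff.mpr ⟨c, by group⟩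
  rcases hconj ψ ψ.2 with h | h
  · exact Or.inr ⟨h, fun h' =>
      not_isConj_of_inv_of 1 ((h'.trans hflip).trans (hinv h).symm)⟩
  · refine Or.inl ⟨?_, fun h' => not_isConj_of_inv_of 1 (h'.trans h.symm)⟩
    have h₂ := hinv h
    rw [inv_inv] at h₂
    exact h₂.trans hflip.symm
end
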